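/- arXiv:2211.03322 — 2 statements merged into one kernel-verified Lean document; each statement's English description precedes it below -/
import Mathlib

section
/- There exists an absolute constant c > 0 such that for every simple graph G with degree sequence d_1, d_2, …, d_n, the cutwidth satisfies cw(G) ≤ c · sqrt(pcr(G) + Σ_{k=1}^n d_k²). -/
open scoped BigOperators

/-- A drawing of a simple graph in the plane: vertices are distinct points, each edge is a
simple continuous curve joining its endpoints, not passing through any other vertex point;
two distinct edge curves share only finitely many points, and no three edge curves pass
through a common interior point. -/
structure Drawing {V : Type*} (G : SimpleGraph V) where
  pos : V → ℝ × ℝ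
  pos_inj : Function.Injective pos
  curve : G.edgeSet → ℝ → ℝ × ℝ
  curve_cont : ∀ e, ContinuousOn (curve e) (Set.Icc 0 1)
  curve_inj : ∀ e, Set.InjOn (curve e) (Set.Icc 0 1)
  curve_ends : ∀ e : G.edgeSet, ∃ u v : V, (e : Sym2 V) = s(u, v) ∧
    curve e 0 = pos u ∧ curve e 1 = pos v
  curve_avoid : ∀ (e : G.edgeSet), ∀ t ∈ Set.Ioo (0:ℝ) 1, curve e t ∉ Set.range pos
  curve_finite_inter : ∀ e f : G.edgeSet, e ≠ f →
    (curve e '' Set.Icc 0 1 ∩ curve f '' Set.Icc 0 1).Finite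
  no_triple_point : ∀ e f g : G.edgeSet, e ≠ f → f ≠ g → e ≠ g → ∀ p : ℝ × ℝ,
    ¬ (p ∈ curve e '' Set.Ioo 0 1 ∧ p ∈ curve f '' Set.Ioo 0 1 ∧ p ∈ curve g '' Set.Ioo 0 1)

namespace Drawing

variable {V : Type*} {G : SimpleGraph V} (D : Drawing G)

/-- `p` is a crossing point of the edges `e` and `f`: a common interior point of their curves. -/
def IsCross (e f : G.edgeSet) (p : ℝ × ℝ) : Prop :=
  p ∈ D.curve e '' Set.Ioo 0 1 ∧ p ∈ D.curve f '' Set.Ioo 0 1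

/-- The set of crossings of a drawing, recorded as (unordered pair of edges, crossing point). -/
def crossings : Set (Sym2 G.edgeSet × (ℝ × ℝ)) :=
  { x | ∃ e f : G.edgeSet, e ≠ f ∧ x.1 = s(e, f) ∧ D.IsCross e f x.2 }

/-- The number of crossings of a drawing. -/
noncomputable def numCrossings : ℕ := D.crossings.ncard

/-- The set of unordered pairs of distinct edges that cross each other. -/
def crossingPairs : Set (Sym2 G.edgeSet) :=
  { q | ∃ e f : G.edgeSet, e ≠ f ∧ q = s(e, f) ∧ ∃ p, D.IsCross e f p }

/-- The number of pairs of edges that cross each other. -/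
noncomputable def numCrossingPairs : ℕ := D.crossingPairs.ncard

/-- An edge participating in at least one crossing. -/
def CrossingEdge (e : G.edgeSet) : Prop :=
  ∃ f : G.edgeSet, e ≠ f ∧ ∃ p, D.IsCross e f p

/-- A drawing is straight-line if every edge is the line segment between its endpoints. -/
def IsStraightLine : Prop :=
  ∀ (e : G.edgeSet), ∀ t ∈ Set.Icc (0:ℝ) 1,
    D.curve e t = D.curve e 0 + t • (D.curve e 1 - D.curve e 0)

/-- A convex drawing: the vertices are in convex position and edges are straight segments. -/
def IsConvex : Prop :=
  ConvexIndependent ℝ D.pos ∧ D.IsStraightLine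

end Drawing

/-- The crossing number of a graph. -/
noncomputable def crNum {V : Type*} (G : SimpleGraph V) : ℕ :=
  sInf { n | ∃ D : Drawing G, D.numCrossings = n }

/-- The pair crossing number of a graph. -/
noncomputable def pcrNum {V : Type*} (G : SimpleGraph V) : ℕ :=
  sInf { n | ∃ D : Drawing G, D.numCrossingPairs = n }

/-- The sum of the squares of the degrees of a graph. -/
noncomputable def ssqd {V : Type*} (G : SimpleGraph V) : ℕ :=
  ∑ᶠ v : V, ((G.neighborSet v).ncard) ^ 2

/-- The sum over all vertices of (degree choose 2). -/
noncomputable def bds {V : Type*} (G : SimpleGraph V) : ℕ :=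
  ∑ᶠ v : V, ((G.neighborSet v).ncard).choose 2


/-- The cutwidth of a graph: the least `ℓ` for which there is a linear ordering of the
vertices such that every prefix cut has at most `ℓ` edges. -/
noncomputable def cutwidth {n : ℕ} (G : SimpleGraph (Fin n)) : ℕ :=
  sInf { ℓ : ℕ | ∃ σ : Fin n ≃ Fin n, ∀ i : Fin n,
    { e ∈ G.edgeSet | ∃ u v : Fin n, e = s(u, v) ∧ σ.symm u ≤ i ∧ i < σ.symm v }.ncard ≤ ℓ }

namespace CW
section PPD
open scoped BigOperators


lemma quad_finite (A B C : ℝ) (hA : A ≠ 0) : {x : ℝ | A * x ^ 2 + B * x + C = 0}.Finite := by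
  open Polynomial in
  have hp : (Polynomial.C A * X ^ 2 + Polynomial.C B * X + Polynomial.C C : ℝ[X]) ≠ 0 := by
    intro h
    have := congrArg (fun p => Polynomial.coeff p 2) h
    simp at this
    exact hA this
  refine Set.Finite.subset (Polynomial.C A * Polynomial.X ^ 2 + Polynomial.C B * Polynomial.X +
    Polynomial.C C : Polynomial ℝ).roots.toFinset.finite_toSet ?_
  intro x hx
  simp only [Finset.mem_coe, Multiset.mem_toFinset]
  rw [Polynomial.mem_roots hp]
  simpa [Polynomial.IsRoot] using hx

lemma arcs_finite (a b a' b' k k' : ℝ) (h : k ≠ k') :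
    {x : ℝ | k * ((x - a) * (b - x)) = k' * ((x - a') * (b' - x))}.Finite := by
  refine (quad_finite (k' - k) (k * (a + b) - k' * (a' + b')) (k' * a' * b' - k * a * b)
    (sub_ne_zero.2 h.symm)).subset ?_
  intro x hx
  simp only [Set.mem_ofPred_eq] at hx ⊢
  linear_combination hx

lemma exists_coeffs {E : Type*} [DecidableEq E] (a b : E → ℝ) (s : Finset E) :
    ∃ k : E → ℝ, (∀ e, 0 < k e) ∧ (∀ e ∈ s, ∀ f ∈ s, k e = k f → e = f) ∧
      ∀ e ∈ s, ∀ f ∈ s, ∀ g ∈ s, e ≠ f → f ≠ g → e ≠ g → ∀ x,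
        k e * ((x - a e) * (b e - x)) = k f * ((x - a f) * (b f - x)) →
        k f * ((x - a f) * (b f - x)) = k g * ((x - a g) * (b g - x)) →
        k e * ((x - a e) * (b e - x)) ≤ 0 := by
  induction s using Finset.induction_on with
  | empty => exact ⟨fun _ => 1, by simp, by simp, by simp⟩
  | insert g s hg ih =>
    obtain ⟨k, hpos, hinj, htr⟩ := ih
    let q : E → ℝ → ℝ := fun e x => k e * ((x - a e) * (b e - x))
    let Bad : Set ℝ := (k '' s) ∪ ⋃ e ∈ s, ⋃ f ∈ s, ⋃ (_ : e ≠ f),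
      (fun x => q e x / ((x - a g) * (b g - x))) '' {x | q e x = q f x}
    have hBad : Bad.Finite := by
      refine Set.Finite.union (s.finite_toSet.image _) ?_
      refine s.finite_toSet.biUnion fun e he => s.finite_toSet.biUnion fun f hf =>
        Set.finite_iUnion fun hef => Set.Finite.image _ ?_
      exact arcs_finite _ _ _ _ _ _ (fun h => hef (hinj _ he _ hf h))
    obtain ⟨c, hc0, hc⟩ := (Set.Ioi_infinite (0:ℝ)).exists_notMem_finite hBad
    have hc1 : ∀ e ∈ s, k e ≠ c := fun e he h => hc (Or.inl ⟨e, he, h⟩)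
    have hc2 : ∀ e ∈ s, ∀ f ∈ s, e ≠ f → ∀ x, q e x = q f x →
        q e x = c * ((x - a g) * (b g - x)) → q e x ≤ 0 := by
      intro e he f hf hef x h1 h2
      by_contra h3
      push Not at h3
      apply hc
      right
      simp only [Set.mem_iUnion]
      refine ⟨e, he, f, hf, hef, x, h1, ?_⟩
      have : (x - a g) * (b g - x) ≠ 0 := fun h => by rw [h2, h] at h3; simp at h3
      simp only
      rw [h2, mul_div_assoc, div_self this, mul_one]
    have hne : ∀ e ∈ s, e ≠ g := fun e he h => hg (h ▸ he)
    refine ⟨Function.update k g c, ?_, ?_, ?_⟩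
    · intro e
      by_cases h : e = g
      · subst h; simpa using hc0
      · simpa [h] using hpos e
    · intro e he f hf h
      rw [Finset.mem_insert] at he hf
      rcases he with rfl | he <;> rcases hf with rfl | hf
      · rfl
      · rw [Function.update_self, Function.update_of_ne (hne _ hf)] at h
        exact absurd h.symm (hc1 _ hf)
      · rw [Function.update_self, Function.update_of_ne (hne _ he)] at h
        exact absurd h (hc1 _ he)
      · rw [Function.update_of_ne (hne _ hf), Function.update_of_ne (hne _ he)] at h
        exact hinj _ he _ hf h
    · intro e he f hf h hh hef hfh heh x h1 h2
      replace he := (Finset.mem_insert.1 he).symm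
      rcases he with he | rfl
      rotate_left
      · have hf := Finset.mem_of_mem_insert_of_ne hf hef.symm
        have hh := Finset.mem_of_mem_insert_of_ne hh heh.symm
        rw [Function.update_of_ne (hne _ hf), Function.update_self] at h1
        rw [Function.update_of_ne (hne _ hf), Function.update_of_ne (hne _ hh)] at h2
        rw [Function.update_self, h1]
        exact hc2 _ hf _ hh hfh x h2 h1.symm
      · replace hf := (Finset.mem_insert.1 hf).symm
        rcases hf with hf | rfl
        rotate_left
        · have hh := Finset.mem_of_mem_insert_of_ne hh hfh.symm
          rw [Function.update_of_ne (hne _ he), Function.update_self] at h1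
          rw [Function.update_self, Function.update_of_ne (hne _ hh)] at h2
          rw [Function.update_of_ne (hne _ he)]
          exact hc2 _ he _ hh heh x (h1.trans h2) h1
        · rw [Function.update_of_ne (hne _ he), Function.update_of_ne (hne _ hf)] at h1
          rw [Function.update_of_ne (hne _ he)]
          replace hh := (Finset.mem_insert.1 hh).symm
          rcases hh with hh | rfl
          rotate_left
          · rw [Function.update_of_ne (hne _ hf), Function.update_self] at h2
            exact hc2 _ he _ hf hef x h1 (h1.trans h2)
          · rw [Function.update_of_ne (hne _ hf), Function.update_of_ne (hne _ hh)] at h2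
            exact htr _ he _ hf _ hh hef hfh heh x h1 h2

theorem drawing_exists {n : ℕ} (G : SimpleGraph (Fin n)) : Nonempty (Drawing G) := by
  classical
  have h1 : ∀ e : G.edgeSet, ∃ u v : Fin n, (e : Sym2 (Fin n)) = s(u, v) ∧ u < v := by
    rintro ⟨e, he⟩
    induction e using Sym2.ind with
    | _ u v =>
      have huv : u ≠ v := G.ne_of_adj (by simpa using he)
      rcases lt_or_gt_of_ne huv with h | h
      · exact ⟨u, v, rfl, h⟩
      · exact ⟨v, u, Sym2.eq_swap, h⟩
  choose U W hUW hlt using h1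
  let a : G.edgeSet → ℝ := fun e => ((U e : ℕ) : ℝ)
  let b : G.edgeSet → ℝ := fun e => ((W e : ℕ) : ℝ)
  have hab : ∀ e, a e < b e := fun e => Nat.cast_lt.2 (hlt e)
  have : Fintype G.edgeSet := Fintype.ofFinite _
  obtain ⟨k, hpos, hinj, htr⟩ := exists_coeffs a b Finset.univ
  let γ : G.edgeSet → ℝ → ℝ × ℝ := fun e t =>
    (a e + t * (b e - a e), k e * ((b e - a e) ^ 2 * (t * (1 - t))))
  have hγ : ∀ e t, (γ e t).2 = k e * (((γ e t).1 - a e) * (b e - (γ e t).1)) := by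
    intro e t; simp only [γ]; ring
  have hγpos : ∀ e, ∀ t ∈ Set.Ioo (0:ℝ) 1, 0 < (γ e t).2 := by
    intro e t ht
    have h1 := hpos e
    have h2 := sub_pos.2 (hab e)
    have h3 := ht.1
    have h4 := sub_pos.2 ht.2
    simp only [γ]
    positivity
  refine ⟨⟨fun i => (((i : ℕ) : ℝ), 0), ?_, γ, ?_, ?_, ?_, ?_, ?_, ?_⟩⟩
  · intro i j h
    simp only [Prod.mk.injEq, and_true, Nat.cast_inj] at h
    exact Fin.ext h
  · intro e; apply Continuous.continuousOn; simp only [γ]; fun_prop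
  · intro e s _ t _ h
    have := congrArg Prod.fst h
    simp only [γ] at this
    have h2 := (sub_pos.2 (hab e)).ne'
    have : s * (b e - a e) = t * (b e - a e) := by linarith
    exact mul_right_cancel₀ h2 this
  · intro e
    refine ⟨U e, W e, hUW e, ?_, ?_⟩ <;> simp [γ, a, b]
  · rintro e t ht ⟨i, hi⟩
    have := hγpos e t ht
    rw [← hi] at this
    exact lt_irrefl _ this
  · intro e f hef
    have hk : k e ≠ k f := fun h => hef (hinj _ (Finset.mem_univ _) _ (Finset.mem_univ _) h)
    refine ((arcs_finite (a e) (b e) (a f) (b f) _ _ hk).image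
      (fun x => (x, k e * ((x - a e) * (b e - x))))).subset ?_
    rintro p ⟨⟨s, -, hs⟩, ⟨t, -, ht⟩⟩
    have e1 := hγ e s
    have e2 := hγ f t
    rw [hs] at e1
    rw [ht] at e2
    exact ⟨p.1, e1.symm.trans e2, Prod.ext rfl e1.symm⟩
  · rintro e f g hef hfg heg p ⟨⟨s, hs', hs⟩, ⟨t, -, ht⟩, ⟨r, -, hr⟩⟩
    have e1 := hγ e s
    have e2 := hγ f t
    have e3 := hγ g r
    have e0 := hγpos e s hs'
    rw [hs] at e1 e0
    rw [ht] at e2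
    rw [hr] at e3
    have := htr e (Finset.mem_univ _) f (Finset.mem_univ _) g (Finset.mem_univ _) hef hfg heg p.1
      (e1.symm.trans e2) (e2.symm.trans e3)
    linarith

end PPD
end CW

namespace CW
section PPT
open scoped BigOperators

open unitInterval

lemma lift_exists (g : ℝ × ℝ → ℂ) (hg : Continuous g) (h0 : ∀ x, g x ≠ 0) :
    ∃ L : ℝ × ℝ → ℂ, Continuous L ∧ ∀ x, Complex.exp (L x) = g x := by
  obtain ⟨F, ⟨-, hF⟩, -⟩ := Complex.isCoveringMapOn_exp.existsUnique_continuousMap_lifts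
    ⟨g, hg⟩ (a₀ := (0, 0)) (e₀ := Complex.log (g (0,0))) (Complex.exp_log (h0 _)) (fun a => h0 a)
  exact ⟨F, F.continuous, fun x => congrFun hF x⟩

lemma wind_exists (f : ℝ → ℂ) (A B : ℂ) (hA : Complex.exp A = f 0) (hB : Complex.exp B = f 1) :
    ∃ N : ℤ, ∀ L : ℝ → ℂ, Continuous L → (∀ s, Complex.exp (L s) = f s) →
      L 1 - L 0 = B - A + N * (2 * Real.pi * Complex.I) := by
  by_cases h : ∃ L : ℝ → ℂ, Continuous L ∧ (∀ s, Complex.exp (L s) = f s)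
  · obtain ⟨L₀, hc₀, he₀⟩ := h
    obtain ⟨n, hn⟩ := Complex.exp_eq_exp_iff_exists_int.1 (hA.trans (he₀ 0).symm)
    obtain ⟨m, hm⟩ := Complex.exp_eq_exp_iff_exists_int.1 (hB.trans (he₀ 1).symm)
    refine ⟨n - m, fun L hc he => ?_⟩
    have h1 : L = fun s => L₀ s + (L 0 - L₀ 0) := by
      refine Complex.isCoveringMap_exp.eq_of_comp_eq hc (by fun_prop) ?_ 0 (by simp)
      funext s
      apply Subtype.ext
      simp only [Function.comp]
      rw [Complex.exp_add, Complex.exp_sub, he, he, he₀, he₀, div_self, mul_one]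
      rw [← he₀]; exact Complex.exp_ne_zero _
    have h2 := congrFun h1 1
    rw [h2, hn, hm]; push_cast; ring
  · exact ⟨0, fun L hc he => absurd ⟨L, hc, he⟩ h⟩

/-- antisymmetric choice of logarithms -/
lemma log_choice (a : Fin 3 → ℂ) (ha : ∀ i k, i ≠ k → a i ≠ a k) :
    ∃ α : Fin 3 → Fin 3 → ℂ, (∀ i k, i ≠ k → Complex.exp (α i k) = a k - a i) ∧
      ∀ i k, i < k → α k i = α i k + Real.pi * Complex.I := by
  refine ⟨fun i k => if i < k then Complex.log (a k - a i)
    else Complex.log (a i - a k) + Real.pi * Complex.I, ?_, ?_⟩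
  · intro i k h
    dsimp only
    split_ifs with hlt
    · exact Complex.exp_log (sub_ne_zero.2 (ha _ _ h.symm))
    · rw [Complex.exp_add, Complex.exp_log (sub_ne_zero.2 (ha _ _ h)), Complex.exp_pi_mul_I]; ring
  · intro i k h
    simp [h, h.not_gt]

theorem K33_real (a b : Fin 3 → ℂ) (γ : Fin 3 → Fin 3 → ℝ → ℂ) (hc : ∀ i j, Continuous (γ i j))
    (h0 : ∀ i j, γ i j 0 = a i) (h1 : ∀ i j, γ i j 1 = b j) :
    ∃ i k j l, i ≠ k ∧ j ≠ l ∧ ∃ s t, γ i j s = γ k l t := by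
  by_contra hcon
  push Not at hcon
  have hne : ∀ i k j l s t, i ≠ k → j ≠ l → γ i j s ≠ γ k l t :=
    fun i k j l s t h h' => hcon i k j l h h' s t
  have haa : ∀ i k, i ≠ k → a i ≠ a k := fun i k h => by
    have := hne i k 0 1 0 0 h (by decide); rwa [h0, h0] at this
  have hbb : ∀ j l, j ≠ l → b j ≠ b l := fun j l h => by
    have := hne 0 1 j l 1 1 (by decide) h; rwa [h1, h1] at this
  have hab : ∀ i j, a i ≠ b j := fun i j => by
    have := hne i (i+1) (j+1) j 0 1 (by revert i; decide) (by revert j; decide)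
    rwa [h0, h1] at this
  obtain ⟨αa, hαa, hαa'⟩ := log_choice a haa
  obtain ⟨αb, hαb, hαb'⟩ := log_choice b hbb
  let αm : Fin 3 → Fin 3 → ℂ := fun i j => Complex.log (b j - a i)
  have hαm : ∀ i j, Complex.exp (αm i j) = b j - a i := fun i j =>
    Complex.exp_log (sub_ne_zero.2 (hab i j).symm)
  have hαm' : ∀ i j, Complex.exp (αm i j + Real.pi * Complex.I) = a i - b j := fun i j => by
    rw [Complex.exp_add, hαm, Complex.exp_pi_mul_I]; ring
  have HNa : ∀ i j k, ∃ N : ℤ, i ≠ k → ∀ L : ℝ → ℂ, Continuous L →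
      (∀ s, Complex.exp (L s) = γ i j s - a k) →
      L 1 - L 0 = αm k j - αa k i + N * (2 * Real.pi * Complex.I) := by
    intro i j k
    by_cases hik : i = k
    · exact ⟨0, fun h => absurd hik h⟩
    · obtain ⟨N, hN⟩ := wind_exists (fun s => γ i j s - a k) (αa k i) (αm k j)
        (by rw [hαa _ _ (Ne.symm hik), h0]) (by rw [hαm, h1])
      exact ⟨N, fun _ => hN⟩
  have HNb : ∀ i j l, ∃ N : ℤ, j ≠ l → ∀ L : ℝ → ℂ, Continuous L →
      (∀ s, Complex.exp (L s) = γ i j s - b l) →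
      L 1 - L 0 = αb l j - (αm i l + Real.pi * Complex.I) + N * (2 * Real.pi * Complex.I) := by
    intro i j l
    by_cases hik : j = l
    · exact ⟨0, fun h => absurd hik h⟩
    · obtain ⟨N, hN⟩ := wind_exists (fun s => γ i j s - b l) (αm i l + Real.pi * Complex.I) (αb l j)
        (by rw [hαm', h0]) (by rw [hαb _ _ (Ne.symm hik), h1])
      exact ⟨N, fun _ => hN⟩
  choose Na hNa using HNa
  choose Nb hNb using HNb
  have key : ∀ i k j l, i < k → j ≠ l →
      Na i j k + Nb k l j - Nb i j l - Na k l i = if j < l then 1 else 0 := by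
    intro i k j l hik hjl
    have hik' := hik.ne
    obtain ⟨L, hL, he⟩ := lift_exists (fun x => γ i j x.1 - γ k l x.2)
      (by have := hc i j; have := hc k l; fun_prop)
      (fun x => sub_ne_zero.2 (hne _ _ _ _ _ _ hik' hjl))
    have e1 := hNa i j k hik' (fun s => L (s, 0)) (by fun_prop) (fun s => by
      rw [he]; simp only [h0])
    have e2 := hNb i j l hjl (fun s => L (s, 1)) (by fun_prop) (fun s => by
      rw [he]; simp only [h1])
    have e3 := hNa k l i hik'.symm (fun t => L (0, t) + Real.pi * Complex.I) (by fun_prop) (fun s => by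
      rw [Complex.exp_add, he, Complex.exp_pi_mul_I]; simp only [h0]; ring)
    have e4 := hNb k l j hjl.symm (fun t => L (1, t) + Real.pi * Complex.I) (by fun_prop) (fun s => by
      rw [Complex.exp_add, he, Complex.exp_pi_mul_I]; simp only [h1]; ring)
    have hπ : (2 * Real.pi * Complex.I : ℂ) ≠ 0 := Complex.two_pi_I_ne_zero
    have ha' := hαa' _ _ hik
    have : ((Na i j k + Nb k l j - Nb i j l - Na k l i : ℤ) : ℂ) * (2 * Real.pi * Complex.I)
        = ((if j < l then 1 else 0 : ℤ) : ℂ) * (2 * Real.pi * Complex.I) := by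
      push_cast
      split_ifs with hlt
      · have hb' := hαb' _ _ hlt
        linear_combination e2 + e3 - e1 - e4 + ha' + hb'
      · have hb' := hαb' _ _ (lt_of_le_of_ne (not_lt.1 hlt) hjl.symm)
        linear_combination e2 + e3 - e1 - e4 + ha' - hb'
    exact_mod_cast mul_right_cancel₀ hπ this
  have E : ∀ i k : Fin 3, i < k →  
     (Na i 0 k + Nb k 1 0 - Nb i 0 1 - Na k 1 i = 1) ∧ (Na i 1 k + Nb k 0 1 - Nb i 1 0 - Na k 0 i = 0) ∧
     (Na i 0 k + Nb k 2 0 - Nb i 0 2 - Na k 2 i = 1) ∧ (Na i 2 k + Nb k 0 2 - Nb i 2 0 - Na k 0 i = 0) ∧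
     (Na i 1 k + Nb k 2 1 - Nb i 1 2 - Na k 2 i = 1) ∧ (Na i 2 k + Nb k 1 2 - Nb i 2 1 - Na k 1 i = 0) := by
    intro i k h
    refine ⟨?_, ?_, ?_, ?_, ?_, ?_⟩
    all_goals rw [key _ _ _ _ h (by decide)]; decide
  have E1 := E 0 1 (by decide)
  have E2 := E 0 2 (by decide)
  have E3 := E 1 2 (by decide)
  omega

theorem K33_path (a b : Fin 3 → ℂ) (γ : ∀ i j, Path (a i) (b j)) :
    ∃ i k j l, i ≠ k ∧ j ≠ l ∧ ∃ s t, γ i j s = γ k l t := by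
  obtain ⟨i, k, j, l, h, h', s, t, hst⟩ := K33_real a b (fun i j => (γ i j).extend)
    (fun i j => (γ i j).continuous_extend) (fun i j => by simp) (fun i j => by simp)
  have hr : ∀ i j (s : ℝ), ∃ s', γ i j s' = (γ i j).extend s := fun i j s => by
    have : (γ i j).extend s ∈ Set.range (γ i j) := by
      rw [← Path.extend_range]; exact ⟨s, rfl⟩
    exact this
  obtain ⟨s', hs⟩ := hr i j s
  obtain ⟨t', ht⟩ := hr k l t
  exact ⟨i, k, j, l, h, h', s', t', by rw [hs, ht]; exact hst⟩

theorem K33_joined (a b : Fin 3 → ℝ × ℝ) (S : Fin 3 → Fin 3 → Set (ℝ × ℝ))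
    (hS : ∀ i j, JoinedIn (S i j) (a i) (b j)) :
    ∃ i k j l, i ≠ k ∧ j ≠ l ∧ (S i j ∩ S k l).Nonempty := by
  let φ : ℝ × ℝ → ℂ := Complex.equivRealProdCLM.symm
  have hφ : Continuous φ := Complex.equivRealProdCLM.symm.continuous
  obtain ⟨i, k, j, l, h, h', s, t, hst⟩ := K33_path (fun i => φ (a i)) (fun j => φ (b j))
    (fun i j => (hS i j).somePath.map hφ)
  refine ⟨i, k, j, l, h, h', (hS i j).somePath s, (hS i j).somePath_mem s, ?_⟩
  have : (hS i j).somePath s = (hS k l).somePath t :=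
    Complex.equivRealProdCLM.symm.injective hst
  rw [this]; exact (hS k l).somePath_mem t

end PPT
end CW

namespace CW
section PPK
open scoped BigOperators


/-- no two "disjoint" walks in a K33 configuration can avoid touching -/
def K33free {V : Type*} (H : SimpleGraph V) : Prop :=
  ∀ (x y : Fin 3 → V) (P : ∀ i j, H.Walk (x i) (y j)), ∃ i k j l, i ≠ k ∧ j ≠ l ∧
    ∃ p ∈ (P i j).support, ∃ q ∈ (P k l).support, p = q ∨ H.Adj p q

lemma K33free.induce {V : Type*} {H : SimpleGraph V} (h : K33free H) (s : Set V) :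
    K33free (H.induce s) := by
  intro x y P
  let φ : H.induce s →g H := (SimpleGraph.Embedding.induce s).toHom
  obtain ⟨i, k, j, l, hik, hjl, p, hp, q, hq, hpq⟩ := h (fun i => φ (x i)) (fun j => φ (y j))
    (fun i j => (P i j).map φ)
  rw [SimpleGraph.Walk.support_map, List.mem_map] at hp hq
  obtain ⟨p, hp, rfl⟩ := hp
  obtain ⟨q, hq, rfl⟩ := hq
  refine ⟨i, k, j, l, hik, hjl, p, hp, q, hq, ?_⟩
  rcases hpq with h | h
  · left; exact Subtype.ext h
  · right; exact h

/-- the touching graph of a drawing -/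
def touch {V : Type*} {G : SimpleGraph V} (D : Drawing G) : SimpleGraph G.edgeSet where
  Adj e f := e ≠ f ∧ (D.curve e '' Set.Icc 0 1 ∩ D.curve f '' Set.Icc 0 1).Nonempty
  symm := ⟨fun e f h => ⟨h.1.symm, by rw [Set.inter_comm]; exact h.2⟩⟩
  loopless := ⟨fun e h => h.1 rfl⟩

lemma walk_joined {V : Type*} {G : SimpleGraph V} (D : Drawing G) {e f : G.edgeSet}
    (P : (touch D).Walk e f) :
    JoinedIn (⋃ g ∈ {g | g ∈ P.support}, D.curve g '' Set.Icc 0 1) (D.curve e 0) (D.curve f 0) := by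
  have hpc : ∀ e, IsPathConnected (D.curve e '' Set.Icc 0 1) := fun e =>
    IsPathConnected.image' ((convex_Icc (0:ℝ) 1).isPathConnected ⟨0, by simp⟩) (D.curve_cont e)
  have h0 : ∀ e, D.curve e 0 ∈ D.curve e '' Set.Icc 0 1 := fun e => ⟨0, by simp, rfl⟩
  induction P with
  | nil =>
    apply JoinedIn.refl
    simp only [Set.mem_iUnion]
    exact ⟨_, by simp, h0 _⟩
  | @cons u v w h p ih =>
    obtain ⟨z, hzu, hzv⟩ := h.2
    have h1 := (hpc u).joinedIn _ (h0 u) _ hzu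
    have h2 := (hpc v).joinedIn _ hzv _ (h0 v)
    refine ((h1.mono ?_).trans (h2.mono ?_)).trans (ih.mono ?_)
    · exact Set.subset_biUnion_of_mem (u := fun g => D.curve g '' Set.Icc 0 1) (by simp)
    · exact Set.subset_biUnion_of_mem (u := fun g => D.curve g '' Set.Icc 0 1) (by simp)
    · apply Set.biUnion_subset_biUnion_left
      intro g hg
      simp only [Set.mem_ofPred_eq, SimpleGraph.Walk.support_cons, List.mem_cons] at hg ⊢
      exact Or.inr hg

lemma touch_K33free {V : Type*} {G : SimpleGraph V} (D : Drawing G) : K33free (touch D) := by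
  intro x y P
  obtain ⟨i, k, j, l, hik, hjl, z, hz1, hz2⟩ := K33_joined (fun i => D.curve (x i) 0)
    (fun j => D.curve (y j) 0) _ (fun i j => walk_joined D (P i j))
  simp only [Set.mem_iUnion, Set.mem_ofPred_eq] at hz1 hz2
  obtain ⟨p, hp, hzp⟩ := hz1
  obtain ⟨q, hq, hzq⟩ := hz2
  refine ⟨i, k, j, l, hik, hjl, p, hp, q, hq, ?_⟩
  by_cases h : p = q
  · exact Or.inl h
  · exact Or.inr ⟨h, z, hzp, hzq⟩

end PPK
end CW

namespace CW
section PPE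
open scoped BigOperators Classical


section Exp
variable {ι V : Type*} [Fintype ι] [Fintype V]

/-- expectation of `g` under the product measure -/
noncomputable def Ex (μ : V → ℝ) (g : (ι → V) → ℝ) : ℝ := ∑ x, (∏ i, μ (x i)) * g x

lemma Ex_add (μ : V → ℝ) (f g : (ι → V) → ℝ) : Ex μ (fun x => f x + g x) = Ex μ f + Ex μ g := by
  simp only [Ex, mul_add, Finset.sum_add_distrib]

lemma Ex_sum {T : Type*} (s : Finset T) (μ : V → ℝ) (f : T → (ι → V) → ℝ) :
    Ex μ (fun x => ∑ t ∈ s, f t x) = ∑ t ∈ s, Ex μ (f t) := by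
  simp only [Ex, Finset.mul_sum]
  rw [Finset.sum_comm]

lemma Ex_smul (μ : V → ℝ) (c : ℝ) (f : (ι → V) → ℝ) : Ex μ (fun x => c * f x) = c * Ex μ f := by
  simp only [Ex, Finset.mul_sum]
  exact Finset.sum_congr rfl fun x _ => by ring

lemma Ex_mono (μ : V → ℝ) (h0 : ∀ v, 0 ≤ μ v) {f g : (ι → V) → ℝ} (h : ∀ x, f x ≤ g x) :
    Ex μ f ≤ Ex μ g :=
  Finset.sum_le_sum fun x _ => mul_le_mul_of_nonneg_left (h x) (Finset.prod_nonneg fun i _ => h0 _)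

lemma Ex_const (μ : V → ℝ) (h1 : ∑ v, μ v = 1) (c : ℝ) : Ex μ (fun _ : ι → V => c) = c := by
  have : ∑ x : ι → V, ∏ i, μ (x i) = 1 := by
    have := Finset.prod_univ_sum (fun _ : ι => (Finset.univ : Finset V)) (fun _ v => μ v)
    rw [Fintype.piFinset_univ] at this
    rw [← this]; simp [h1]
  rw [Ex, ← Finset.sum_mul, this, one_mul]

lemma Ex_resample (μ : V → ℝ) (h1 : ∑ v, μ v = 1) (a : ι) (g : (ι → V) → ℝ) :
    Ex μ g = Ex μ (fun x => ∑ v, μ v * g (Function.update x a v)) := by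
  have e1 : Ex μ g = ∑ z : (ι → V) × V, (∏ i, μ (z.1 i)) * μ z.2 * g z.1 := by
    rw [Fintype.sum_prod_type, Ex]
    refine Finset.sum_congr rfl fun x _ => ?_
    simp only
    rw [← Finset.sum_mul, ← Finset.mul_sum, h1, mul_one]
  have e2 : Ex μ (fun x => ∑ v, μ v * g (Function.update x a v))
      = ∑ z : (ι → V) × V, (∏ i, μ (z.1 i)) * μ z.2 * g (Function.update z.1 a z.2) := by
    rw [Fintype.sum_prod_type, Ex]
    refine Finset.sum_congr rfl fun x _ => ?_
    simp only
    rw [Finset.mul_sum]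
    exact Finset.sum_congr rfl fun v _ => by ring
  rw [e1, e2]
  have hinv : Function.Involutive (fun z : (ι → V) × V => (Function.update z.1 a z.2, z.1 a)) := by
    intro z; simp
  refine Fintype.sum_equiv hinv.toPerm _ _ fun z => ?_
  simp only [Function.Involutive.coe_toPerm]
  have h2 : ∀ (x : ι → V) (v : V), (∏ i, μ (Function.update x a v i)) * μ (x a) = (∏ i, μ (x i)) * μ v := by
    intro x v
    rw [← Finset.mul_prod_erase Finset.univ (fun i => μ (x i)) (Finset.mem_univ a),
      ← Finset.mul_prod_erase Finset.univ (fun i => μ (Function.update x a v i)) (Finset.mem_univ a)]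
    have : ∏ i ∈ Finset.univ.erase a, μ (Function.update x a v i) = ∏ i ∈ Finset.univ.erase a, μ (x i) :=
      Finset.prod_congr rfl fun i hi => by rw [Function.update_of_ne (Finset.ne_of_mem_erase hi)]
    rw [this, Function.update_self]; ring
  rw [h2]
  simp

lemma Ex_pair_mul (μ : V → ℝ) (h1 : ∑ v, μ v = 1) {a b : ι} (hab : a ≠ b) (h : (ι → V) → ℝ)
    (ha : ∀ x v, h (Function.update x a v) = h x) (hb : ∀ x v, h (Function.update x b v) = h x)
    (f : V → V → ℝ) :
    Ex μ (fun x => h x * f (x a) (x b)) = Ex μ h * ∑ u, ∑ v, μ u * μ v * f u v := by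
  rw [Ex_resample μ h1 a, Ex_resample μ h1 b]
  simp only [ha, hb, Function.update_self, Function.update_of_ne hab, Function.update_of_ne hab.symm]
  rw [mul_comm, ← Ex_smul]
  congr 1
  funext x
  simp only [Finset.sum_mul, Finset.mul_sum]
  rw [Finset.sum_comm]
  exact Finset.sum_congr rfl fun u _ => Finset.sum_congr rfl fun v _ => by ring

lemma Ex_pair (μ : V → ℝ) (h1 : ∑ v, μ v = 1) {a b : ι} (hab : a ≠ b) (f : V → V → ℝ) :
    Ex μ (fun x => f (x a) (x b)) = ∑ u, ∑ v, μ u * μ v * f u v := by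
  have := Ex_pair_mul μ h1 hab (fun _ => 1) (fun _ _ => rfl) (fun _ _ => rfl) f
  simpa [Ex_const μ h1] using this

lemma Ex_four (μ : V → ℝ) (h1 : ∑ v, μ v = 1) {a b c d : ι} (hab : a ≠ b) (hcd : c ≠ d)
    (hac : a ≠ c) (had : a ≠ d) (hbc : b ≠ c) (hbd : b ≠ d) (f g : V → V → ℝ) :
    Ex μ (fun x => f (x a) (x b) * g (x c) (x d)) =
      (∑ u, ∑ v, μ u * μ v * f u v) * ∑ u, ∑ v, μ u * μ v * g u v := by
  rw [Ex_pair_mul μ h1 hcd (fun x => f (x a) (x b)) _ _ g, Ex_pair μ h1 hab]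
  · intro x v; simp [Function.update_of_ne hac, Function.update_of_ne hbc]
  · intro x v; simp [Function.update_of_ne had, Function.update_of_ne hbd]

/-- probability -/
noncomputable def Pr (μ : V → ℝ) (B : (ι → V) → Prop) : ℝ := Ex μ (fun x => if B x then 1 else 0)

lemma Pr_or (μ : V → ℝ) (h0 : ∀ v, 0 ≤ μ v) (A B : (ι → V) → Prop) :
    Pr μ (fun x => A x ∨ B x) ≤ Pr μ A + Pr μ B := by
  rw [Pr, Pr, Pr, ← Ex_add]
  refine Ex_mono μ h0 fun x => ?_
  by_cases hA : A x <;> by_cases hB : B x <;> simp [hA, hB]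

lemma Pr_exists {T : Type*} [Fintype T] (μ : V → ℝ) (h0 : ∀ v, 0 ≤ μ v) (B : T → (ι → V) → Prop)
    (β : ℝ) (h : ∀ t, Pr μ (B t) ≤ β) : Pr μ (fun x => ∃ t, B t x) ≤ Fintype.card T * β := by
  calc Pr μ (fun x => ∃ t, B t x) ≤ ∑ t : T, Pr μ (B t) := by
        simp only [Pr]
        rw [← Ex_sum]
        refine Ex_mono μ h0 fun x => ?_
        have hnn : ∀ t ∈ (Finset.univ : Finset T), (0:ℝ) ≤ if B t x then 1 else 0 := by
          intro t _; split_ifs <;> norm_num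
        split_ifs with hx
        · obtain ⟨t, ht⟩ := hx
          calc (1:ℝ) = if B t x then 1 else 0 := by simp [ht]
            _ ≤ _ := Finset.single_le_sum hnn (Finset.mem_univ t)
        · exact Finset.sum_nonneg hnn
    _ ≤ ∑ _t : T, β := Finset.sum_le_sum fun t _ => h t
    _ = _ := by simp

lemma Pr_false (μ : V → ℝ) : Pr μ (fun _ : ι → V => False) = 0 := by simp [Pr, Ex]

lemma Pr_lt_one (μ : V → ℝ) (h1 : ∑ v, μ v = 1) (B : (ι → V) → Prop) (h : Pr μ B < 1) :
    ∃ x, ¬ B x := by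
  by_contra hc
  push Not at hc
  have : Pr μ B = 1 := by simp only [Pr, hc, if_true]; exact Ex_const μ h1 1
  linarith

lemma Pr_one_coord (μ : V → ℝ) (h0 : ∀ v, 0 ≤ μ v) (h1 : ∑ v, μ v = 1) (a : ι)
    (B : (ι → V) → Prop) (β : ℝ)
    (h : ∀ x, ∑ v, (if B (Function.update x a v) then μ v else 0) ≤ β) : Pr μ B ≤ β := by
  rw [Pr, Ex_resample μ h1 a]
  calc _ ≤ Ex μ (fun _ : ι → V => β) := Ex_mono μ h0 fun x => by simpa using h x
    _ = β := Ex_const μ h1 β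

lemma Pr_two_coord (μ : V → ℝ) (h1 : ∑ v, μ v = 1) {a b : ι} (hab : a ≠ b)
    (B : V → V → Prop) :
    Pr μ (fun x => B (x a) (x b)) = ∑ u, ∑ v, (if B u v then μ u * μ v else 0) := by
  rw [Pr, Ex_pair μ h1 hab (fun u v => if B u v then (1:ℝ) else 0)]
  simp

end Exp
end PPE
end CW

namespace CW
section PPS
open scoped BigOperators Classical


section Spread
variable {V : Type*} [Fintype V]

/-- touching kernel -/
noncomputable def Kt (H : SimpleGraph V) (e f : V) : ℝ := if e = f ∨ H.Adj e f then 1 else 0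

/-- admissible routings -/
def Valid (H : SimpleGraph V) (μ : V → ℝ) (p : ℝ) (R : V → V → Finset V) : Prop :=
  (∀ x y, R x y = ∅ ∨ ∃ P : H.Walk x y, R x y = P.support.toFinset) ∧
    ∑ x, ∑ y, (if R x y = ∅ then μ x * μ y else 0) ≤ p

/-- congestion -/
noncomputable def cong (μ : V → ℝ) (R : V → V → Finset V) (e : V) : ℝ :=
  ∑ x, ∑ y, μ x * μ y * (if e ∈ R x y then 1 else 0)

/-- the index quadruples -/
def QQ : Finset (Fin 3 × Fin 3 × Fin 3 × Fin 3) :=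
  Finset.univ.filter fun q => q.1 ≠ q.2.1 ∧ q.2.2.1 ≠ q.2.2.2

lemma QQ_card : QQ.card = 36 := by decide

lemma route_det (H : SimpleGraph V) (hK : K33free H) (μ : V → ℝ)
    (h0 : ∀ v, 0 ≤ μ v) (h1 : ∑ v, μ v = 1) (p : ℝ) (ρ : Fin 3 × Fin 3 → V → V → Finset V)
    (hρ : ∀ a, Valid H μ p (ρ a)) :
    1 ≤ 9 * p + ∑ q ∈ QQ, ∑ e, ∑ f, Kt H e f *
      (cong μ (ρ (q.1, q.2.2.1)) e * cong μ (ρ (q.2.1, q.2.2.2)) f) := by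
  have key : ∀ x : Fin 3 ⊕ Fin 3 → V, (1:ℝ) ≤
      (∑ a : Fin 3 × Fin 3, if ρ a (x (Sum.inl a.1)) (x (Sum.inr a.2)) = ∅ then 1 else 0) +
      ∑ q ∈ QQ, ∑ e, ∑ f, Kt H e f *
        ((if e ∈ ρ (q.1, q.2.2.1) (x (Sum.inl q.1)) (x (Sum.inr q.2.2.1)) then 1 else 0) *
          (if f ∈ ρ (q.2.1, q.2.2.2) (x (Sum.inl q.2.1)) (x (Sum.inr q.2.2.2)) then 1 else 0)) := by
    intro x
    have nn1 : ∀ a : Fin 3 × Fin 3, (0:ℝ) ≤ if ρ a (x (Sum.inl a.1)) (x (Sum.inr a.2)) = ∅ then 1 else 0 := by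
      intro a; split_ifs <;> norm_num
    have nn2 : ∀ (q : Fin 3 × Fin 3 × Fin 3 × Fin 3) (e f : V), (0:ℝ) ≤ Kt H e f *
        ((if e ∈ ρ (q.1, q.2.2.1) (x (Sum.inl q.1)) (x (Sum.inr q.2.2.1)) then 1 else 0) *
          (if f ∈ ρ (q.2.1, q.2.2.2) (x (Sum.inl q.2.1)) (x (Sum.inr q.2.2.2)) then 1 else 0)) := by
      intro q e f; unfold Kt; split_ifs <;> norm_num
    by_cases hemp : ∃ a : Fin 3 × Fin 3, ρ a (x (Sum.inl a.1)) (x (Sum.inr a.2)) = ∅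
    · obtain ⟨a, ha⟩ := hemp
      have e1 : (1:ℝ) ≤ ∑ a : Fin 3 × Fin 3, if ρ a (x (Sum.inl a.1)) (x (Sum.inr a.2)) = ∅ then 1 else 0 := by
        refine le_trans ?_ (Finset.single_le_sum (fun a _ => nn1 a) (Finset.mem_univ a))
        simp [ha]
      have e2 := Finset.sum_nonneg fun q (_ : q ∈ QQ) => Finset.sum_nonneg fun e (_ : e ∈ Finset.univ) =>
        Finset.sum_nonneg fun f (_ : f ∈ Finset.univ) => nn2 q e f
      linarith
    · push Not at hemp
      have hP : ∀ i j, ∃ P : H.Walk (x (Sum.inl i)) (x (Sum.inr j)),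
          ρ (i, j) (x (Sum.inl i)) (x (Sum.inr j)) = P.support.toFinset := fun i j =>
        ((hρ (i, j)).1 _ _).resolve_left (hemp (i, j)).ne_empty
      choose P hP using hP
      obtain ⟨i, k, j, l, hik, hjl, e, he, f, hf, hef⟩ := hK _ _ P
      have e1 := Finset.sum_nonneg fun a (_ : a ∈ Finset.univ) => nn1 a
      have hq : (i, k, j, l) ∈ QQ := by simp [QQ, hik, hjl]
      have e2 := Finset.single_le_sum (fun q (_ : q ∈ QQ) => Finset.sum_nonneg fun e (_ : e ∈ Finset.univ) =>
        Finset.sum_nonneg fun f (_ : f ∈ Finset.univ) => nn2 q e f) hq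
      have e3 := Finset.single_le_sum (fun e (_ : e ∈ Finset.univ) =>
        Finset.sum_nonneg fun f (_ : f ∈ Finset.univ) => nn2 (i, k, j, l) e f) (Finset.mem_univ e)
      have e4 := Finset.single_le_sum (
        fun f (_ : f ∈ Finset.univ) => nn2 (i, k, j, l) e f) (Finset.mem_univ f)
      have e5 : (1:ℝ) ≤ Kt H e f *
        ((if e ∈ ρ (i, j) (x (Sum.inl i)) (x (Sum.inr j)) then 1 else 0) *
          (if f ∈ ρ (k, l) (x (Sum.inl k)) (x (Sum.inr l)) then 1 else 0)) := by
        rw [if_pos (by rw [hP]; simpa using he), if_pos (by rw [hP]; simpa using hf)]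
        simp [Kt, hef]
      simp only at e2 e3 e4 e5
      linarith
  have h := Ex_mono μ h0 key
  rw [Ex_const μ h1, Ex_add, Ex_sum, Ex_sum] at h
  refine h.trans (add_le_add ?_ (le_of_eq ?_))
  · calc _ ≤ ∑ _a : Fin 3 × Fin 3, p := Finset.sum_le_sum fun a _ => by
          have := (hρ a).2
          rw [Ex_pair μ h1 (a := Sum.inl a.1) (b := Sum.inr a.2) (by simp)
            (fun u v => if ρ a u v = ∅ then (1:ℝ) else 0)]
          simpa using this
      _ = 9 * p := by simp
  · refine Finset.sum_congr rfl fun q hq => ?_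
    simp only [QQ, Finset.mem_filter, Finset.mem_univ, true_and] at hq
    rw [Ex_sum]
    refine Finset.sum_congr rfl fun e _ => ?_
    rw [Ex_sum]
    refine Finset.sum_congr rfl fun f _ => ?_
    rw [Ex_smul, Ex_four μ h1 (a := Sum.inl q.1) (b := Sum.inr q.2.2.1) (c := Sum.inl q.2.1)
      (d := Sum.inr q.2.2.2) (by simp) (by simp) (by simpa using hq.1) (by simp) (by simp)
      (by simpa using hq.2) (fun u v => if e ∈ ρ (q.1, q.2.2.1) u v then (1:ℝ) else 0)
      (fun u v => if f ∈ ρ (q.2.1, q.2.2.2) u v then (1:ℝ) else 0)]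
    rfl

lemma cong_nonneg (μ : V → ℝ) (h0 : ∀ v, 0 ≤ μ v) (R : V → V → Finset V) (e : V) :
    0 ≤ cong μ R e :=
  Finset.sum_nonneg fun x _ => Finset.sum_nonneg fun y _ =>
    mul_nonneg (mul_nonneg (h0 _) (h0 _)) (by split_ifs <;> norm_num)

lemma route_frac (H : SimpleGraph V) (hK : K33free H) (μ : V → ℝ)
    (h0 : ∀ v, 0 ≤ μ v) (h1 : ∑ v, μ v = 1) (p θ : ℝ) (hθ : 0 ≤ θ)
    (lam : {R // Valid H μ p R} → ℝ) (hl0 : ∀ R, 0 ≤ lam R) (hl1 : ∑ R, lam R = 1)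
    (hc : ∀ e, ∑ R, lam R * cong μ R.1 e ≤ θ) :
    1 ≤ 9 * p + 36 * (θ ^ 2 * ∑ e, ∑ f, Kt H e f) := by
  have h := Ex_mono (ι := Fin 3 × Fin 3) lam hl0
    (fun ρ => route_det H hK μ h0 h1 p (fun a => (ρ a).1) (fun a => (ρ a).2))
  rw [Ex_const lam hl1, Ex_add, Ex_const lam hl1, Ex_sum] at h
  refine h.trans (add_le_add le_rfl ?_)
  have : (36:ℝ) * (θ ^ 2 * ∑ e, ∑ f, Kt H e f) = ∑ _q ∈ QQ, (θ ^ 2 * ∑ e, ∑ f, Kt H e f) := by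
    rw [Finset.sum_const, QQ_card]; simp
  rw [this]
  refine Finset.sum_le_sum fun q hq => ?_
  simp only [QQ, Finset.mem_filter, Finset.mem_univ, true_and] at hq
  rw [Ex_sum, Finset.mul_sum]
  refine Finset.sum_le_sum fun e _ => ?_
  rw [Ex_sum, Finset.mul_sum]
  refine Finset.sum_le_sum fun f _ => ?_
  rw [Ex_smul, Ex_pair lam hl1 (a := (q.1, q.2.2.1)) (b := (q.2.1, q.2.2.2))
    (by intro h; exact hq.1 (congrArg Prod.fst h))
    (fun u v => cong μ u.1 e * cong μ v.1 f)]
  have e1 : ∑ u : {R // Valid H μ p R}, ∑ v : {R // Valid H μ p R}, lam u * lam v * (cong μ u.1 e * cong μ v.1 f)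
      = (∑ R, lam R * cong μ R.1 e) * (∑ R, lam R * cong μ R.1 f) := by
    rw [Finset.sum_mul_sum]
    exact Finset.sum_congr rfl fun u _ => Finset.sum_congr rfl fun v _ => by ring
  rw [e1, mul_comm (θ ^ 2), sq]
  have hk : 0 ≤ Kt H e f := by unfold Kt; split_ifs <;> norm_num
  refine mul_le_mul_of_nonneg_left (mul_le_mul (hc e) (hc f) ?_ hθ) hk
  exact Finset.sum_nonneg fun R _ => mul_nonneg (hl0 R) (cong_nonneg μ h0 _ _)

/-- duality: either a fractional routing of small congestion or a metric -/
lemma dual (H : SimpleGraph V) (μ : V → ℝ) (p θ : ℝ) (hθ : 0 < θ)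
    (hne : Nonempty {R // Valid H μ p R})
    (hno : ¬ ∃ lam : {R // Valid H μ p R} → ℝ, (∀ R, 0 ≤ lam R) ∧ ∑ R, lam R = 1 ∧
      ∀ e, ∑ R, lam R * cong μ R.1 e < θ) :
    ∃ ω : V → ℝ, (∀ e, 0 ≤ ω e) ∧ ∑ e, ω e = 1 ∧
      ∀ R : {R // Valid H μ p R}, θ ≤ ∑ e, ω e * cong μ R.1 e := by
  let T : ({R // Valid H μ p R} → ℝ) →ₗ[ℝ] (V → ℝ) :=
    { toFun := fun lam e => ∑ R, lam R * cong μ R.1 e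
      map_add' := fun a b => by funext e; simp [add_mul, Finset.sum_add_distrib]
      map_smul' := fun c a => by funext e; simp [mul_assoc, Finset.mul_sum] }
  let S : Set (V → ℝ) := T '' (stdSimplex ℝ {R // Valid H μ p R})
  let B : Set (V → ℝ) := Set.pi Set.univ (fun _ => Set.Iio θ)
  have hS : Convex ℝ S := (convex_stdSimplex ℝ _).linear_image T
  have hB : Convex ℝ B := convex_pi fun _ _ => convex_Iio θ
  have hBo : IsOpen B := isOpen_set_pi Set.finite_univ fun _ _ => isOpen_Iio
  have hdisj : Disjoint B S := by
    rw [Set.disjoint_left]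
    rintro c hc ⟨lam, hlam, rfl⟩
    exact hno ⟨lam, hlam.1, hlam.2, fun e => hc e (Set.mem_univ e)⟩
  obtain ⟨F, u, hFB, hFS⟩ := geometric_hahn_banach_open hB hBo hS hdisj
  let φ : V → ℝ := fun e => F (Pi.single e 1)
  have hF : ∀ c : V → ℝ, F c = ∑ e, φ e * c e := by
    intro c
    have : c = ∑ e, c e • (Pi.single e 1 : V → ℝ) := by
      funext x; simp [Finset.sum_apply, Pi.single_apply]
    conv_lhs => rw [this]
    rw [map_sum]
    exact Finset.sum_congr rfl fun e _ => by rw [map_smul, smul_eq_mul, mul_comm]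
  have hu0 : 0 < u := by
    have := hFB 0 (fun e _ => hθ)
    simpa using this
  have hφ0 : ∀ e, 0 ≤ φ e := by
    intro e
    by_contra hneg
    push Not at hneg
    have hmem : (fun x => if x = e then u / φ e else 0 : V → ℝ) ∈ B := by
      intro x _
      simp only [Set.mem_Iio]
      split_ifs
      · exact lt_of_le_of_lt (div_nonpos_of_nonneg_of_nonpos hu0.le hneg.le) hθ
      · exact hθ
    have := hFB _ hmem
    rw [hF] at this
    simp only [mul_ite, mul_zero, Finset.sum_ite_eq', Finset.mem_univ, if_true] at this
    rw [mul_div_cancel₀ _ hneg.ne] at this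
    exact lt_irrefl _ this
  obtain ⟨R0⟩ := hne
  have hRS : ∀ R : {R // Valid H μ p R}, u ≤ ∑ e, φ e * cong μ R.1 e := by
    intro R
    have := hFS (T (Pi.single R 1)) ⟨_, single_mem_stdSimplex ℝ R, rfl⟩
    rw [hF] at this
    convert this using 3 with e
    simp [T, Pi.single_apply]
  have hsum : 0 < ∑ e, φ e := by
    rcases (Finset.sum_nonneg fun e (_ : e ∈ Finset.univ) => hφ0 e).lt_or_eq with h | h
    · exact h
    · have hz := (Finset.sum_eq_zero_iff_of_nonneg (fun e _ => hφ0 e)).1 h.symm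
      have := hRS R0
      rw [Finset.sum_eq_zero (fun e he => by rw [hz e he, zero_mul])] at this
      linarith
  have hθu : θ * ∑ e, φ e ≤ u := by
    by_contra hlt
    push Not at hlt
    have hlt' : u / ∑ e, φ e < θ := by rwa [div_lt_iff₀ hsum]
    have := hFB (fun _ => u / ∑ e, φ e) (fun e _ => hlt')
    rw [hF, ← Finset.sum_mul, mul_div_cancel₀ _ hsum.ne'] at this
    exact lt_irrefl _ this
  refine ⟨fun e => φ e / ∑ e, φ e, fun e => div_nonneg (hφ0 e) hsum.le, ?_, fun R => ?_⟩
  · rw [← Finset.sum_div, div_self hsum.ne']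
  · have := hRS R
    have e1 : ∑ e, φ e / (∑ e, φ e) * cong μ R.1 e = (∑ e, φ e * cong μ R.1 e) / ∑ e, φ e := by
      rw [Finset.sum_div]
      exact Finset.sum_congr rfl fun e _ => by ring
    rw [e1, le_div_iff₀ hsum]
    linarith

lemma sum_toFinset_le (l : List V) (ω : V → ℝ) (h : ∀ e, 0 ≤ ω e) :
    ∑ e ∈ l.toFinset, ω e ≤ (l.map ω).sum := by
  induction l with
  | nil => simp
  | cons a l ih =>
    rw [List.toFinset_cons, List.map_cons, List.sum_cons]
    by_cases ha : a ∈ l.toFinset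
    · rw [Finset.insert_eq_of_mem ha]; linarith [h a]
    · rw [Finset.sum_insert ha]; linarith

theorem spread (H : SimpleGraph V) (hK : K33free H) [Nonempty V] (μ : V → ℝ)
    (h0 : ∀ v, 0 ≤ μ v) (h1 : ∑ v, μ v = 1) (θ : ℝ) (hθ : 0 < θ)
    (hθW : 81 * (θ ^ 2 * ∑ e, ∑ f, Kt H e f) ≤ 1) :
    ∃ ω : V → ℝ, (∀ e, 0 ≤ ω e) ∧ ∑ e, ω e = 1 ∧
      ∑ x, ∑ y, (if ∃ P : H.Walk x y, (P.support.map ω).sum ≤ θ / 2 then μ x * μ y else 0)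
        ≤ 1 - 1 / 20 := by
  have hmm : ∑ x, ∑ y, μ x * μ y = 1 := by rw [← Finset.sum_mul_sum, h1, one_mul]
  have main : ∃ ω : V → ℝ, (∀ e, 0 ≤ ω e) ∧ ∑ e, ω e = 1 ∧
      ∀ R : {R // Valid H μ (1/20) R}, θ ≤ ∑ e, ω e * cong μ R.1 e := by
    by_cases hne : Nonempty {R // Valid H μ (1/20) R}
    · refine dual H μ _ θ hθ hne ?_
      rintro ⟨lam, hl0, hl1, hc⟩
      have := route_frac H hK μ h0 h1 _ θ hθ.le lam hl0 hl1 (fun e => (hc e).le)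
      linarith
    · refine ⟨fun _ => 1 / Fintype.card V, fun _ => by positivity, ?_, fun R => absurd ⟨R⟩ hne⟩
      simp
  obtain ⟨ω, hω0, hω1, hR⟩ := main
  refine ⟨ω, hω0, hω1, ?_⟩
  by_contra hcon
  push Not at hcon
  let R : V → V → Finset V := fun x y =>
    if h : ∃ P : H.Walk x y, (P.support.map ω).sum ≤ θ / 2 then h.choose.support.toFinset else ∅
  have hRv : Valid H μ (1/20) R := by
    refine ⟨fun x y => ?_, ?_⟩
    · by_cases h : ∃ P : H.Walk x y, (P.support.map ω).sum ≤ θ / 2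
      · right; exact ⟨h.choose, by simp only [R, dif_pos h]⟩
      · left; simp only [R, dif_neg h]
    · have : ∀ x y, (if R x y = ∅ then μ x * μ y else 0) ≤ μ x * μ y -
          (if ∃ P : H.Walk x y, (P.support.map ω).sum ≤ θ / 2 then μ x * μ y else 0) := by
        intro x y
        by_cases h : ∃ P : H.Walk x y, (P.support.map ω).sum ≤ θ / 2
        · have : R x y ≠ ∅ := by
            simp only [R, dif_pos h]
            exact Finset.ne_empty_of_mem (List.mem_toFinset.2 (SimpleGraph.Walk.start_mem_support _))
          rw [if_neg this, if_pos h]; simp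
        · rw [if_neg h, sub_zero]
          split_ifs
          · exact le_rfl
          · exact mul_nonneg (h0 _) (h0 _)
      calc _ ≤ ∑ x, ∑ y, (μ x * μ y -
          (if ∃ P : H.Walk x y, (P.support.map ω).sum ≤ θ / 2 then μ x * μ y else 0)) :=
            Finset.sum_le_sum fun x _ => Finset.sum_le_sum fun y _ => this x y
        _ ≤ 1 / 20 := by
          simp only [Finset.sum_sub_distrib]
          rw [hmm]; linarith
  have h2 := hR ⟨R, hRv⟩
  have h3 : ∑ e, ω e * cong μ R e ≤ θ / 2 := by
    have e1 : ∑ e, ω e * cong μ R e = ∑ x, ∑ y, μ x * μ y * ∑ e ∈ R x y, ω e := by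
      simp only [cong, Finset.mul_sum]
      rw [Finset.sum_comm]
      refine Finset.sum_congr rfl fun x _ => ?_
      rw [Finset.sum_comm]
      refine Finset.sum_congr rfl fun y _ => ?_
      rw [← Finset.sum_filter_add_sum_filter_not Finset.univ (fun e => e ∈ R x y)]
      rw [Finset.sum_eq_zero (s := Finset.univ.filter fun e => ¬ e ∈ R x y), add_zero]
      · rw [Finset.filter_mem_eq_inter, Finset.univ_inter]
        exact Finset.sum_congr rfl fun e he => by rw [if_pos he]; ring
      · intro e he
        rw [if_neg (Finset.mem_filter.1 he).2]; ring
    rw [e1]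
    calc _ ≤ ∑ x, ∑ y, μ x * μ y * (θ / 2) := by
          refine Finset.sum_le_sum fun x _ => Finset.sum_le_sum fun y _ =>
            mul_le_mul_of_nonneg_left ?_ (mul_nonneg (h0 _) (h0 _))
          by_cases h : ∃ P : H.Walk x y, (P.support.map ω).sum ≤ θ / 2
          · simp only [R, dif_pos h]
            exact (sum_toFinset_le _ ω hω0).trans h.choose_spec
          · simp only [R, dif_neg h]; simp; exact (half_pos hθ).le
      _ = θ / 2 := by simp only [← Finset.sum_mul]; rw [hmm, one_mul]
  simp only at h2
  linarith

end Spread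
end PPS
end CW

namespace CW
section PPM
open scoped BigOperators Classical


section Metric
variable {V : Type*} {H : SimpleGraph V} (ω : V → ℕ)

/-- weighted length of a walk (all visited vertices) -/
def wl {x y : V} (P : H.Walk x y) : ℕ := (P.support.map ω).sum

lemma wl_nil (x : V) : wl ω (SimpleGraph.Walk.nil : H.Walk x x) = ω x := by simp [wl]

lemma wl_cons {x y z : V} (h : H.Adj x y) (P : H.Walk y z) :
    wl ω (SimpleGraph.Walk.cons h P) = ω x + wl ω P := by simp [wl]

lemma wl_append {x y z : V} (P : H.Walk x y) (Q : H.Walk y z) :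
    wl ω (P.append Q) + ω y = wl ω P + wl ω Q := by
  induction P with
  | nil => rw [SimpleGraph.Walk.nil_append, wl_nil]; ring
  | cons h p ih =>
    have := ih Q
    rw [SimpleGraph.Walk.cons_append, wl_cons, wl_cons]
    omega

lemma wl_reverse {x y : V} (P : H.Walk x y) : wl ω P.reverse = wl ω P := by
  simp [wl, SimpleGraph.Walk.support_reverse]

lemma two_decomp {x y c p : V} (P1 : H.Walk x c) (P2 : H.Walk c y) (Q1 : H.Walk x p)
    (Q2 : H.Walk p y) (h : P1.append P2 = Q1.append Q2) :
    ∃ R : H.Walk c p, (∀ v ∈ R.support, v ∈ P1.support ∨ v ∈ Q1.support) ∧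
      (wl ω R + wl ω P1 = wl ω Q1 + ω c ∨ wl ω R + wl ω Q1 = wl ω P1 + ω p) := by
  induction P1 with
  | nil =>
    refine ⟨Q1, fun v hv => Or.inr hv, Or.inl ?_⟩
    rw [wl_nil]
  | @cons u v w hadj P1 ih =>
    cases Q1 with
    | nil =>
      refine ⟨(SimpleGraph.Walk.cons hadj P1).reverse, fun z hz => Or.inl ?_, Or.inr ?_⟩
      · rwa [SimpleGraph.Walk.support_reverse, List.mem_reverse] at hz
      · rw [wl_reverse, wl_nil]
    | @cons _ v' _ hadj' Q1 =>
      rw [SimpleGraph.Walk.cons_append, SimpleGraph.Walk.cons_append] at h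
      rw [SimpleGraph.Walk.cons.injEq] at h
      obtain ⟨rfl, h⟩ := h
      obtain ⟨R, hR, hR'⟩ := ih P2 Q1 (eq_of_heq h)
      refine ⟨R, fun z hz => ?_, ?_⟩
      · rw [SimpleGraph.Walk.support_cons, SimpleGraph.Walk.support_cons]
        rcases hR z hz with h | h
        · exact Or.inl (List.mem_cons_of_mem _ h)
        · exact Or.inr (List.mem_cons_of_mem _ h)
      · rw [wl_cons, wl_cons]; omega

variable (H)

/-- reachable inside `A` within weighted length `ℓ` -/
def Near (A : Finset V) (x y : V) (ℓ : ℕ) : Prop :=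
  ∃ P : H.Walk x y, (∀ v ∈ P.support, v ∈ A) ∧ wl ω P ≤ ℓ

/-- reachable inside `A` -/
def Reach (A : Finset V) (x y : V) : Prop :=
  ∃ P : H.Walk x y, (∀ v ∈ P.support, v ∈ A)

variable {H} {ω}

lemma Near.symm {A : Finset V} {x y : V} {ℓ : ℕ} (h : Near H ω A x y ℓ) : Near H ω A y x ℓ := by
  obtain ⟨P, hP, hl⟩ := h
  refine ⟨P.reverse, fun v hv => hP v ?_, by rwa [wl_reverse]⟩
  rwa [SimpleGraph.Walk.support_reverse, List.mem_reverse] at hv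

lemma Near.mono {A B : Finset V} {x y : V} {ℓ ℓ' : ℕ} (h : Near H ω A x y ℓ) (hAB : A ⊆ B)
    (hl : ℓ ≤ ℓ') : Near H ω B x y ℓ' := by
  obtain ⟨P, hP, hl'⟩ := h
  exact ⟨P, fun v hv => hAB (hP v hv), hl'.trans hl⟩

lemma Near.reach {A : Finset V} {x y : V} {ℓ : ℕ} (h : Near H ω A x y ℓ) : Reach H A x y := by
  obtain ⟨P, hP, _⟩ := h
  exact ⟨P, hP⟩

lemma Reach.mono {A B : Finset V} {x y : V} (h : Reach H A x y) (hAB : A ⊆ B) : Reach H B x y := by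
  obtain ⟨P, hP⟩ := h
  exact ⟨P, fun v hv => hAB (hP v hv)⟩

lemma Reach.symm {A : Finset V} {x y : V} (h : Reach H A x y) : Reach H A y x := by
  obtain ⟨P, hP⟩ := h
  refine ⟨P.reverse, fun v hv => hP v ?_⟩
  rwa [SimpleGraph.Walk.support_reverse, List.mem_reverse] at hv

lemma Reach.trans {A : Finset V} {x y z : V} (h : Reach H A x y) (h' : Reach H A y z) :
    Reach H A x z := by
  obtain ⟨P, hP⟩ := h
  obtain ⟨Q, hQ⟩ := h'
  refine ⟨P.append Q, fun v hv => ?_⟩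
  rw [SimpleGraph.Walk.mem_support_append_iff] at hv
  exact hv.elim (hP v) (hQ v)

lemma Near.join {A : Finset V} {x p q y : V} {a b : ℕ} (h1 : Near H ω A x p a)
    (h2 : Near H ω A q y b) (h : p = q ∨ H.Adj p q) : Near H ω A x y (a + b) := by
  obtain ⟨P, hP, hPl⟩ := h1
  obtain ⟨Q, hQ, hQl⟩ := h2
  rcases h with rfl | h
  · refine ⟨P.append Q, fun v hv => ?_, ?_⟩
    · rw [SimpleGraph.Walk.mem_support_append_iff] at hv
      exact hv.elim (hP v) (hQ v)
    · have := wl_append ω P Q; omega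
  · refine ⟨P.append (SimpleGraph.Walk.cons h Q), fun v hv => ?_, ?_⟩
    · rw [SimpleGraph.Walk.mem_support_append_iff, SimpleGraph.Walk.support_cons, List.mem_cons] at hv
      rcases hv with hv | rfl | hv
      · exact hP v hv
      · exact hP _ P.end_mem_support
      · exact hQ v hv
    · have := wl_append ω P (SimpleGraph.Walk.cons h Q)
      rw [wl_cons] at this; omega

lemma Near.step {A : Finset V} {x z y : V} {r : ℕ} (h : Near H ω A x z r) (hzy : H.Adj z y)
    (hy : y ∈ A) : Near H ω A x y (r + ω y) :=
  h.join ⟨SimpleGraph.Walk.nil, by simpa using hy, (wl_nil ω y).le⟩ (Or.inr hzy)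

/-- splitting a walk at a vertex -/
lemma split_walk {A : Finset V} {x y : V} (P : H.Walk x y) (hP : ∀ v ∈ P.support, v ∈ A)
    {p : V} (hp : p ∈ P.support) : ∃ (P1 : H.Walk x p) (P2 : H.Walk p y), P = P1.append P2 ∧
      (∀ v ∈ P1.support, v ∈ A) ∧ (∀ v ∈ P2.support, v ∈ A) ∧
      wl ω P + ω p = wl ω P1 + wl ω P2 := by
  obtain ⟨P1, P2, h⟩ := SimpleGraph.Walk.mem_support_iff_exists_append.1 hp
  subst h
  refine ⟨P1, P2, rfl, fun v hv => hP v ?_, fun v hv => hP v ?_, wl_append ω P1 P2⟩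
  · exact SimpleGraph.Walk.mem_support_append_iff _ _ |>.2 (Or.inl hv)
  · exact SimpleGraph.Walk.mem_support_append_iff _ _ |>.2 (Or.inr hv)

variable (H ω)

/-- sphere cut -/
noncomputable def cutS (Y : Finset V) (x : V) (r : ℕ) : Finset V :=
  Y.filter fun y => ¬ Near H ω Y x y r ∧ ∃ z, Near H ω Y x z r ∧ H.Adj z y

variable {H ω}

lemma mem_cutS {Y : Finset V} {x y : V} {r : ℕ} : y ∈ cutS H ω Y x r ↔
    y ∈ Y ∧ ¬ Near H ω Y x y r ∧ ∃ z, Near H ω Y x z r ∧ H.Adj z y := by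
  rw [cutS, Finset.mem_filter]

lemma cut_comp (Y : Finset V) (x : V) (r : ℕ) {z y : V} (h : Reach H (Y \ cutS H ω Y x r) z y)
    (hz : Near H ω Y x z r) : Near H ω Y x y r := by
  obtain ⟨P, hP⟩ := h
  induction P with
  | nil => exact hz
  | @cons u v w hadj p ih =>
    refine ih ?_ (fun z hz => hP z (by rw [SimpleGraph.Walk.support_cons]; exact List.mem_cons_of_mem _ hz))
    by_contra hv
    have h1 := hP v (by simp)
    rw [Finset.mem_sdiff] at h1
    exact h1.2 (mem_cutS.2 ⟨h1.1, hv, u, hz, hadj⟩)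

lemma cut_exists [Fintype V] (Y : Finset V) (x : V) (a u : ℕ) (hu : 0 < u) :
    ∃ r, a ≤ r ∧ r < a + u ∧ (cutS H ω Y x r).card * u ≤ ∑ v, ω v := by
  by_contra hcon
  push Not at hcon
  have hcount : ∀ y, ((Finset.Ico a (a + u)).filter fun r => y ∈ cutS H ω Y x r).card ≤ ω y := by
    intro y
    set T := (Finset.Ico a (a + u)).filter fun r => y ∈ cutS H ω Y x r with hT
    by_cases hne : T.Nonempty
    · have hmin := T.min'_mem hne
      have : T ⊆ Finset.Ico (T.min' hne) (T.min' hne + ω y) := by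
        intro r hr
        rw [Finset.mem_Ico]
        refine ⟨T.min'_le r hr, ?_⟩
        by_contra hge
        push Not at hge
        have h1 := (Finset.mem_filter.1 hmin).2
        have h2 := (Finset.mem_filter.1 hr).2
        obtain ⟨hy, -, z, hz, hzy⟩ := mem_cutS.1 h1
        exact (mem_cutS.1 h2).2.1 ((hz.step hzy hy).mono subset_rfl hge)
      simpa using Finset.card_le_card this
    · rw [Finset.not_nonempty_iff_eq_empty] at hne
      simp [hne]
  have hdc : ∑ r ∈ Finset.Ico a (a + u), (cutS H ω Y x r).card =
      ∑ y, ((Finset.Ico a (a + u)).filter fun r => y ∈ cutS H ω Y x r).card := by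
    have := Finset.sum_card_bipartiteAbove_eq_sum_card_bipartiteBelow
      (s := Finset.Ico a (a + u)) (t := (Finset.univ : Finset V)) (fun r y => y ∈ cutS H ω Y x r)
    simp only [Finset.bipartiteAbove, Finset.bipartiteBelow] at this
    rw [← this]
    refine Finset.sum_congr rfl fun r _ => ?_
    congr 1; ext y; simp
  have h1 : ∑ r ∈ Finset.Ico a (a + u), (cutS H ω Y x r).card ≤ ∑ v, ω v := by
    rw [hdc]; exact Finset.sum_le_sum fun y _ => hcount y
  have h2 : ∑ _r ∈ Finset.Ico a (a + u), (∑ v, ω v) < ∑ r ∈ Finset.Ico a (a + u), (cutS H ω Y x r).card * u := by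
    refine Finset.sum_lt_sum_of_nonempty (by simp [hu]) fun r hr => ?_
    rw [Finset.mem_Ico] at hr
    exact hcon r hr.1 hr.2
  rw [← Finset.sum_mul, Finset.sum_const, Nat.card_Ico] at h2
  simp only [add_tsub_cancel_left, smul_eq_mul] at h2
  have := Nat.mul_le_mul_right u h1
  rw [mul_comm u] at h2
  omega

end Metric

section Mass
variable {V : Type*} [Fintype V] (μ : V → ℝ)

/-- mass of a set -/
noncomputable def ms (S : V → Prop) : ℝ := ∑ v, if S v then μ v else 0
/-- mass of a set of pairs -/
noncomputable def ms2 (S : V → V → Prop) : ℝ := ∑ u, ∑ v, if S u v then μ u * μ v else 0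

variable {μ}

lemma ms_mono (h0 : ∀ v, 0 ≤ μ v) {S T : V → Prop} (h : ∀ v, S v → T v) : ms μ S ≤ ms μ T := by
  refine Finset.sum_le_sum fun v _ => ?_
  by_cases hS : S v
  · simp [hS, h v hS]
  · simp only [hS, if_false]; split_ifs <;> simp [h0]

lemma ms_nonneg (h0 : ∀ v, 0 ≤ μ v) (S : V → Prop) : 0 ≤ ms μ S :=
  Finset.sum_nonneg fun v _ => by split_ifs <;> simp [h0]

lemma ms_compl (h1 : ∑ v, μ v = 1) (S : V → Prop) : ms μ S + ms μ (fun v => ¬ S v) = 1 := by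
  rw [ms, ms, ← Finset.sum_add_distrib, ← h1]
  exact Finset.sum_congr rfl fun v _ => by by_cases h : S v <;> simp [h]

lemma ms_le_one (h0 : ∀ v, 0 ≤ μ v) (h1 : ∑ v, μ v = 1) (S : V → Prop) : ms μ S ≤ 1 := by
  have := ms_compl h1 S; have := ms_nonneg h0 (fun v => ¬ S v); linarith

lemma ms_inter (h0 : ∀ v, 0 ≤ μ v) (S T : V → Prop) :
    ms μ S ≤ ms μ (fun v => S v ∧ T v) + ms μ (fun v => ¬ T v) := by
  rw [ms, ms, ms, ← Finset.sum_add_distrib]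
  refine Finset.sum_le_sum fun v _ => ?_
  by_cases hS : S v <;> by_cases hT : T v <;> simp [hS, hT, h0]

lemma ms2_eq (S : V → V → Prop) : ms2 μ S = ∑ u, μ u * ms μ (S u) := by
  rw [ms2]
  refine Finset.sum_congr rfl fun u _ => ?_
  rw [ms, Finset.mul_sum]
  exact Finset.sum_congr rfl fun v _ => by simp

lemma ms2_mono (h0 : ∀ v, 0 ≤ μ v) {S T : V → V → Prop} (h : ∀ u v, S u v → T u v) :
    ms2 μ S ≤ ms2 μ T := by
  rw [ms2_eq, ms2_eq]
  exact Finset.sum_le_sum fun u _ => mul_le_mul_of_nonneg_left (ms_mono h0 (h u)) (h0 u)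

lemma ms2_compl (h1 : ∑ v, μ v = 1) (S : V → V → Prop) :
    ms2 μ S + ms2 μ (fun u v => ¬ S u v) = 1 := by
  rw [ms2_eq, ms2_eq, ← Finset.sum_add_distrib, ← h1]
  refine Finset.sum_congr rfl fun u _ => ?_
  rw [← mul_add, ms_compl h1, mul_one]

lemma ms2_swap (S : V → V → Prop) : ms2 μ S = ms2 μ (fun u v => S v u) := by
  rw [ms2, ms2, Finset.sum_comm]
  exact Finset.sum_congr rfl fun u _ => Finset.sum_congr rfl fun v _ => by rw [mul_comm]

/-- lower bound for `ms2` -/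
lemma ms2_ge (h0 : ∀ v, 0 ≤ μ v) (S : V → V → Prop) (T : V → Prop) (c : ℝ)
    (h : ∀ u, T u → c ≤ ms μ (S u)) : ms μ T * c ≤ ms2 μ S := by
  rw [ms2_eq, ms, Finset.sum_mul]
  refine Finset.sum_le_sum fun u _ => ?_
  by_cases hu : T u
  · simp only [hu, if_true]; exact mul_le_mul_of_nonneg_left (h u hu) (h0 u)
  · simp only [hu, if_false, zero_mul]; exact mul_nonneg (h0 u) (ms_nonneg h0 _)

/-- upper bound for `ms2` -/
lemma ms2_le (h0 : ∀ v, 0 ≤ μ v) (S : V → V → Prop) (T : V → Prop) (c : ℝ)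
    (h : ∀ u, T u → ms μ (S u) ≤ c) (h' : ∀ u v, S u v → T u) : ms2 μ S ≤ ms μ T * c := by
  rw [ms2_eq, ms, Finset.sum_mul]
  refine Finset.sum_le_sum fun u _ => ?_
  by_cases hu : T u
  · simp only [hu, if_true]; exact mul_le_mul_of_nonneg_left (h u hu) (h0 u)
  · have : ms μ (S u) = 0 := Finset.sum_eq_zero fun v _ => if_neg fun hh => hu (h' u v hh)
    simp [hu, this]

lemma Pr_ms {ι : Type*} [Fintype ι] (h0 : ∀ v, 0 ≤ μ v) (h1 : ∑ v, μ v = 1) (a : ι) (S : V → Prop) :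
    Pr μ (fun x : ι → V => S (x a)) ≤ ms μ S :=
  Pr_one_coord μ h0 h1 a _ _ fun x => by simp [ms]

lemma Pr_ms2 {ι : Type*} [Fintype ι] (h1 : ∑ v, μ v = 1) {a b : ι} (hab : a ≠ b) (S : V → V → Prop) :
    Pr μ (fun x : ι → V => S (x a) (x b)) = ms2 μ S := Pr_two_coord μ h1 hab S

end Mass
end PPM
end CW

namespace CW
section PPN
open scoped BigOperators Classical


section Sep
variable {V : Type*} [Fintype V] {H : SimpleGraph V} {ω : V → ℕ} {μ : V → ℝ}

/-- concentration property -/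
def Conc (H : SimpleGraph V) (ω : V → ℕ) (μ : V → ℝ) (u : ℕ) (Y : Finset V) : Prop :=
  ∀ x a, ms μ (fun y => Near H ω Y x y a) < 1/200 ∨
    1 - 1/200 < ms μ (fun y => Near H ω Y x y (a + u))

lemma pair_conc (h0 : ∀ v, 0 ≤ μ v) (h1 : ∑ v, μ v = 1) {u : ℕ} {Y : Finset V}
    (hc : Conc H ω μ u Y) (a : ℕ) :
    ms2 μ (fun x y => Near H ω Y x y a) ≤ 3/200 ∨
      1 - 4/200 ≤ ms2 μ (fun x y => Near H ω Y x y (a + 2 * u)) := by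
  set Sh : V → Prop := fun x => 1/200 ≤ ms μ (fun y => Near H ω Y x y a) with hSh
  set Z : V → Prop := fun z => ms μ (fun y => Near H ω Y z y (a + u)) < 1/200 with hZ
  by_cases hs : ms μ Sh ≤ 2/200
  · left
    rw [ms2_eq]
    calc _ ≤ ∑ x, ((if Sh x then μ x else 0) + μ x * (1/200)) := by
          refine Finset.sum_le_sum fun x _ => ?_
          by_cases hx : Sh x
          · have := ms_le_one h0 h1 (fun y => Near H ω Y x y a)
            have := h0 x
            simp only [hx, if_true]; nlinarith
          · have hx' : ms μ (fun y => Near H ω Y x y a) < 1/200 := not_le.1 hx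
            have := h0 x
            simp only [hx, if_false]; nlinarith
      _ = ms μ Sh + 1/200 := by
          rw [Finset.sum_add_distrib, ← Finset.sum_mul, h1, one_mul]; rfl
      _ ≤ _ := by linarith
  · right
    push Not at hs
    have hlow : ms μ Sh * (ms μ Z - 1/200) ≤ ms2 μ (fun x y => Z y ∧ Near H ω Y x y (a + u)) := by
      refine ms2_ge h0 _ Sh _ fun x hx => ?_
      have h2 := (hc x a).resolve_left (not_lt.2 hx)
      have h3 := ms_compl h1 (fun y => Near H ω Y x y (a + u))
      have h4 := ms_inter h0 Z (fun y => Near H ω Y x y (a + u))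
      linarith
    have hup : ms2 μ (fun x y => Z y ∧ Near H ω Y x y (a + u)) ≤ ms μ Z * (1/200) := by
      rw [ms2_swap]
      refine ms2_le h0 _ Z _ (fun z hz => ?_) (fun z y h => h.1)
      refine le_trans (ms_mono h0 fun y hy => ?_) (le_of_lt hz)
      exact hy.2.symm
    have hZle : ms μ Z ≤ 2/200 := by
      have := ms_nonneg h0 Z
      by_contra hgt
      push Not at hgt
      nlinarith
    have hge := ms2_ge h0 (fun x y => Near H ω Y x y (a + 2 * u)) (fun z => ¬ Z z) (1 - 1/200)
      (fun z hz => by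
        have := (hc z (a + u)).resolve_left hz
        rw [show a + 2 * u = a + u + u by ring]
        exact this.le)
    have := ms_compl h1 Z
    nlinarith

lemma center (hK : K33free H) (h0 : ∀ v, 0 ≤ μ v) (h1 : ∑ v, μ v = 1) {u : ℕ} {Y : Finset V}
    (hc : Conc H ω μ u Y) (hω : ∀ v ∈ Y, ω v ≤ u)
    (hlo : ms2 μ (fun x y => Near H ω Y x y (998 * u)) ≤ 3/200)
    (hhi : 1 - 4/200 ≤ ms2 μ (fun x y => Near H ω Y x y (1052 * u))) :
    ∃ c, 1 - 1/200 < ms μ (fun y => Near H ω Y c y (694 * u)) := by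
  by_contra hcon
  push Not at hcon
  have hsmall : ∀ c, ms μ (fun y => Near H ω Y c y (693 * u)) < 1/200 := by
    intro c
    refine (hc c (693 * u)).resolve_right (not_lt.2 ?_)
    rw [show 693 * u + u = 694 * u by ring]
    exact hcon c
  have hsel : ∀ x y, ∃ c : V, Near H ω Y x y (1052 * u) → ∃ P : H.Walk x y,
      (∀ v ∈ P.support, v ∈ Y) ∧ wl ω P ≤ 1052 * u ∧
      ((∃ v, ∃ (P1 : H.Walk x v) (P2 : H.Walk v y), P = P1.append P2 ∧
          943 * u ≤ 2 * wl ω P1 ∧ 943 * u ≤ 2 * wl ω P2) →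
        ∃ (P1 : H.Walk x c) (P2 : H.Walk c y), P = P1.append P2 ∧
          943 * u ≤ 2 * wl ω P1 ∧ 943 * u ≤ 2 * wl ω P2) := by
    intro x y
    by_cases hn : Near H ω Y x y (1052 * u)
    · obtain ⟨P, hP, hPl⟩ := hn
      by_cases hb : ∃ v, ∃ (P1 : H.Walk x v) (P2 : H.Walk v y), P = P1.append P2 ∧
          943 * u ≤ 2 * wl ω P1 ∧ 943 * u ≤ 2 * wl ω P2
      · obtain ⟨c, hc⟩ := hb
        exact ⟨c, fun _ => ⟨P, hP, hPl, fun _ => hc⟩⟩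
      · exact ⟨x, fun _ => ⟨P, hP, hPl, fun h => absurd h hb⟩⟩
    · exact ⟨x, fun h => absurd h hn⟩
  choose c hcsel using hsel
  let B1 : (Fin 3 ⊕ Fin 3 → V) → Prop := fun x =>
    ∃ t : Fin 3 × Fin 3, ¬ Near H ω Y (x (Sum.inl t.1)) (x (Sum.inr t.2)) (1052 * u)
  let B2 : (Fin 3 ⊕ Fin 3 → V) → Prop := fun x =>
    ∃ t : (Fin 3 ⊕ Fin 3) × (Fin 3 ⊕ Fin 3), t.1 ≠ t.2 ∧ Near H ω Y (x t.1) (x t.2) (998 * u)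
  let B3 : (Fin 3 ⊕ Fin 3 → V) → Prop := fun x =>
    ∃ t : Fin 3 × Fin 3 × Fin 3, t.1 ≠ t.2.2 ∧
      Near H ω Y (c (x (Sum.inl t.1)) (x (Sum.inr t.2.1))) (x (Sum.inl t.2.2)) (693 * u)
  have p1 : Pr μ B1 ≤ 36/200 := by
    have := Pr_exists μ h0 (fun (t : Fin 3 × Fin 3) (x : Fin 3 ⊕ Fin 3 → V) =>
      ¬ Near H ω Y (x (Sum.inl t.1)) (x (Sum.inr t.2)) (1052 * u)) (4/200) (fun t => by
        rw [Pr_ms2 h1 (a := Sum.inl t.1) (b := Sum.inr t.2) (by simp)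
          (fun x y => ¬ Near H ω Y x y (1052 * u))]
        have := ms2_compl h1 (fun x y => Near H ω Y x y (1052 * u))
        linarith)
    refine this.trans ?_
    simp; norm_num
  have p2 : Pr μ B2 ≤ 108/200 := by
    have := Pr_exists μ h0 (fun (t : (Fin 3 ⊕ Fin 3) × (Fin 3 ⊕ Fin 3)) (x : Fin 3 ⊕ Fin 3 → V) =>
      t.1 ≠ t.2 ∧ Near H ω Y (x t.1) (x t.2) (998 * u)) (3/200) (fun t => by
        by_cases ht : t.1 = t.2
        · simp only [ht, ne_eq, not_true_eq_false, false_and]; rw [Pr_false]; norm_num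
        · simp only [ht, ne_eq, not_false_eq_true, true_and]
          rw [Pr_ms2 h1 ht (fun x y => Near H ω Y x y (998 * u))]
          exact hlo)
    refine this.trans ?_
    simp; norm_num
  have p3 : Pr μ B3 ≤ 27/200 := by
    have := Pr_exists μ h0 (fun (t : Fin 3 × Fin 3 × Fin 3) (x : Fin 3 ⊕ Fin 3 → V) =>
      t.1 ≠ t.2.2 ∧
      Near H ω Y (c (x (Sum.inl t.1)) (x (Sum.inr t.2.1))) (x (Sum.inl t.2.2)) (693 * u))
      (1/200) (fun t => by
        by_cases ht : t.1 = t.2.2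
        · simp only [ht, ne_eq, not_true_eq_false, false_and]; rw [Pr_false]; norm_num
        · simp only [ht, ne_eq, not_false_eq_true, true_and]
          refine Pr_one_coord μ h0 h1 (Sum.inl t.2.2) _ _ fun x => ?_
          have hne : (Sum.inl t.1 : Fin 3 ⊕ Fin 3) ≠ Sum.inl t.2.2 := by simpa using ht
          have hne2 : (Sum.inr t.2.1 : Fin 3 ⊕ Fin 3) ≠ Sum.inl t.2.2 := by simp
          refine le_trans (le_of_eq ?_) (hsmall (c (x (Sum.inl t.1)) (x (Sum.inr t.2.1)))).le
          rw [ms]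
          refine Finset.sum_congr rfl fun v _ => ?_
          simp only [Function.update, dif_neg hne, dif_neg hne2, dif_pos])
    refine this.trans ?_
    simp; norm_num
  have hp : Pr μ (fun x => (B1 x ∨ B2 x) ∨ B3 x) < 1 := by
    have e1 := Pr_or μ h0 (fun x => B1 x ∨ B2 x) B3
    have e2 := Pr_or μ h0 B1 B2
    linarith
  obtain ⟨x, hx⟩ := Pr_lt_one μ h1 _ hp
  simp only [B1, B2, B3, not_or, not_exists, not_not, Prod.forall, not_and] at hx
  obtain ⟨⟨q1, q2⟩, q3⟩ := hx
  have hP := fun i j => hcsel _ _ (q1 i j)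
  choose P hPY hPl hPc using hP
  obtain ⟨i, k, j, l, hik, hjl, p, hp, q, hq, hpq⟩ := hK _ _ P
  obtain ⟨P1, P2, eP, hP1, hP2, lP⟩ := split_walk (ω := ω) _ (hPY i j) hp
  obtain ⟨Q1, Q2, eQ, hQ1, hQ2, lQ⟩ := split_walk (ω := ω) _ (hPY k l) hq
  have wp : ω p ≤ u := hω p (hPY i j p hp)
  have wq : ω q ≤ u := hω q (hPY k l q hq)
  have l1 := hPl i j
  have l2 := hPl k l
  have nP1 : Near H ω Y _ _ _ := ⟨P1, hP1, le_rfl⟩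
  have nP2 : Near H ω Y _ _ _ := ⟨P2, hP2, le_rfl⟩
  have nQ1 : Near H ω Y _ _ _ := ⟨Q1, hQ1, le_rfl⟩
  have nQ2 : Near H ω Y _ _ _ := ⟨Q2, hQ2, le_rfl⟩
  have hqp : q = p ∨ H.Adj q p := hpq.imp Eq.symm (fun h => h.symm)
  have i1 : 998 * u < wl ω P1 + wl ω Q1 := by
    by_contra hle
    exact q2 (Sum.inl i) (Sum.inl k) (by simpa using hik)
      ((nP1.join nQ1.symm hpq).mono subset_rfl (not_lt.1 hle))
  have i2 : 998 * u < wl ω P1 + wl ω Q2 := by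
    by_contra hle
    exact q2 (Sum.inl i) (Sum.inr l) (by simp)
      ((nP1.join nQ2 hpq).mono subset_rfl (not_lt.1 hle))
  have i3 : 998 * u < wl ω P2 + wl ω Q1 := by
    by_contra hle
    exact q2 (Sum.inr j) (Sum.inl k) (by simp)
      ((nP2.symm.join nQ1.symm hpq).mono subset_rfl (not_lt.1 hle))
  have i4 : 998 * u < wl ω P2 + wl ω Q2 := by
    by_contra hle
    exact q2 (Sum.inr j) (Sum.inr l) (by simpa using hjl)
      ((nP2.symm.join nQ2 hpq).mono subset_rfl (not_lt.1 hle))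
  obtain ⟨C1, C2, eC, c1, c2⟩ := hPc i j ⟨p, P1, P2, eP, by omega, by omega⟩
  obtain ⟨R, hR, hRl⟩ := two_decomp ω C1 C2 P1 P2 (eC.symm.trans eP)
  have hC1 : ∀ v ∈ C1.support, v ∈ Y := fun v hv => hPY i j v (by
    rw [eC]; exact (SimpleGraph.Walk.mem_support_append_iff _ _).2 (Or.inl hv))
  have hRY : ∀ v ∈ R.support, v ∈ Y := fun v hv => (hR v hv).elim (hC1 v) (hP1 v)
  have wc := hω _ (hC1 _ C1.end_mem_support)
  have lC := wl_append ω C1 C2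
  rw [← eC] at lC
  have nR : Near H ω Y _ _ _ := ⟨R, hRY, le_rfl⟩
  exact q3 i j k hik ((nR.join nQ1.symm hpq).mono subset_rfl (by omega))

lemma three (hK : K33free H) (h0 : ∀ v, 0 ≤ μ v) (h1 : ∑ v, μ v = 1) {u : ℕ}
    (Y : Fin 3 → Finset V) (hY : ∀ i j, i ≤ j → Y j ⊆ Y i) (hω : ∀ v ∈ Y 0, ω v ≤ u)
    (hlo : ms2 μ (fun x y => Near H ω (Y 0) x y (998 * u)) ≤ 3/200) (c : Fin 3 → V)
    (hc : ∀ i, 1 - 1/200 < ms μ (fun y => Near H ω (Y i) (c i) y (694 * u)))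
    (hfar : ∀ i j, i < j → ¬ Near H ω (Y i) (c i) (c j) (400 * u)) : False := by
  let B1 : (Fin 3 → V) → Prop := fun x =>
    ∃ t : Fin 3 × Fin 3, ¬ Near H ω (Y t.1) (c t.1) (x t.2) (694 * u)
  let B2 : (Fin 3 → V) → Prop := fun x =>
    ∃ t : Fin 3 × Fin 3, t.1 ≠ t.2 ∧ Near H ω (Y 0) (x t.1) (x t.2) (998 * u)
  have p1 : Pr μ B1 ≤ 9/200 := by
    have := Pr_exists μ h0 (fun (t : Fin 3 × Fin 3) (x : Fin 3 → V) =>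
      ¬ Near H ω (Y t.1) (c t.1) (x t.2) (694 * u)) (1/200) (fun t => by
        refine (Pr_ms h0 h1 t.2 (fun y => ¬ Near H ω (Y t.1) (c t.1) y (694 * u))).trans ?_
        have := ms_compl h1 (fun y => Near H ω (Y t.1) (c t.1) y (694 * u))
        have := hc t.1
        linarith)
    refine this.trans ?_
    simp; norm_num
  have p2 : Pr μ B2 ≤ 27/200 := by
    have := Pr_exists μ h0 (fun (t : Fin 3 × Fin 3) (x : Fin 3 → V) =>
      t.1 ≠ t.2 ∧ Near H ω (Y 0) (x t.1) (x t.2) (998 * u)) (3/200) (fun t => by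
        by_cases ht : t.1 = t.2
        · simp only [ht, ne_eq, not_true_eq_false, false_and]; rw [Pr_false]; norm_num
        · simp only [ht, ne_eq, not_false_eq_true, true_and]
          rw [Pr_ms2 h1 ht (fun x y => Near H ω (Y 0) x y (998 * u))]
          exact hlo)
    refine this.trans ?_
    simp; norm_num
  have hp : Pr μ (fun x => B1 x ∨ B2 x) < 1 := by
    have e2 := Pr_or μ h0 B1 B2
    linarith
  obtain ⟨x, hx⟩ := Pr_lt_one μ h1 _ hp
  simp only [B1, B2, not_or, not_exists, not_not, Prod.forall, not_and] at hx
  obtain ⟨q1, q2⟩ := hx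
  choose P hPY hPl using q1
  have key : ∀ i j a b, i < j → a ≠ b → ∀ p ∈ (P i a).support, ∀ q ∈ (P j b).support,
      (p = q ∨ H.Adj p q) → False := by
    intro i j a b hij hab p hp q hq hpq
    obtain ⟨P1, P2, eP, hP1, hP2, lP⟩ := split_walk (ω := ω) _ (hPY i a) hp
    obtain ⟨Q1, Q2, eQ, hQ1, hQ2, lQ⟩ := split_walk (ω := ω) _ (hPY j b) hq
    have wp : ω p ≤ u := hω p (hY 0 i (Fin.zero_le _) (hPY i a p hp))
    have wq : ω q ≤ u := hω q (hY 0 j (Fin.zero_le _) (hPY j b q hq))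
    have l1 := hPl i a
    have l2 := hPl j b
    have nP1 : Near H ω (Y i) _ _ _ := ⟨P1, hP1, le_rfl⟩
    have nP2 : Near H ω (Y i) _ _ _ := ⟨P2, hP2, le_rfl⟩
    have nQ1 : Near H ω (Y j) _ _ _ := ⟨Q1, hQ1, le_rfl⟩
    have nQ2 : Near H ω (Y j) _ _ _ := ⟨Q2, hQ2, le_rfl⟩
    have i1 : 998 * u < wl ω P2 + wl ω Q2 := by
      by_contra hle
      exact q2 a b hab (((nP2.mono (hY 0 i (Fin.zero_le _)) le_rfl).symm.join
        (nQ2.mono (hY 0 j (Fin.zero_le _)) le_rfl) hpq).mono subset_rfl (not_lt.1 hle))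
    exact hfar i j hij ((nP1.join (nQ1.mono (hY i j hij.le) le_rfl).symm hpq).mono subset_rfl
      (by omega))
  obtain ⟨i, j, a, b, hij, hab, p, hp, q, hq, hpq⟩ := hK _ _ P
  rcases lt_or_gt_of_ne hij with h | h
  · exact key i j a b h hab p hp q hq hpq
  · exact key j i b a h hab.symm q hq p hp (hpq.imp Eq.symm (fun h => h.symm))

end Sep
end PPN
end CW

namespace CW
section PPO
open scoped BigOperators Classical


section Sep2
variable {V : Type*} [Fintype V] {H : SimpleGraph V} {ω : V → ℕ} {μ : V → ℝ}

lemma conc_of (h0 : ∀ v, 0 ≤ μ v) (h1 : ∑ v, μ v = 1) {u : ℕ} (hu : 0 < u) {Y : Finset V}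
    (hX : ∀ X : Finset V, X.card * u ≤ ∑ v, ω v →
      ∃ z, 1 - 1/200 < ms μ (fun y => Reach H (Y \ X) z y)) : Conc H ω μ u Y := by
  intro x a
  obtain ⟨r, hr1, hr2, hr3⟩ := cut_exists (H := H) (ω := ω) Y x a u hu
  obtain ⟨z, hz⟩ := hX _ hr3
  by_cases hn : Near H ω Y x z r
  · right
    refine lt_of_lt_of_le hz (ms_mono h0 fun y hy => ?_)
    exact (cut_comp Y x r hy hn).mono subset_rfl hr2.le
  · left
    have e1 : 1 - 1/200 < ms μ (fun y => ¬ Near H ω Y x y r) := by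
      refine lt_of_lt_of_le hz (ms_mono h0 fun y hy hy' => hn (cut_comp Y x r hy.symm hy'))
    have e2 := ms_compl h1 (fun y => Near H ω Y x y r)
    have e3 : ms μ (fun y => Near H ω Y x y a) ≤ ms μ (fun y => Near H ω Y x y r) :=
      ms_mono h0 fun y hy => hy.mono subset_rfl hr1
    linarith

lemma pair_of_ball (h0 : ∀ v, 0 ≤ μ v) {Y : Finset V} {c : V} {r : ℕ}
    (h : 1 - 1/200 < ms μ (fun y => Near H ω Y c y r)) :
    1 - 2/200 < ms2 μ (fun x y => Near H ω Y x y (2 * r)) := by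
  have := ms2_ge h0 (fun x y => Near H ω Y x y (2 * r)) (fun x => Near H ω Y c x r) (1 - 1/200)
    (fun x hx => h.le.trans (ms_mono h0 fun y hy => by
      rw [two_mul]; exact hx.symm.join hy (Or.inl rfl)))
  nlinarith

lemma good (hK : K33free H) (h0 : ∀ v, 0 ≤ μ v) (h1 : ∑ v, μ v = 1) {u : ℕ} (hu : 0 < u)
    {Y A : Finset V} (hYA : Y ⊆ A) (hω : ∀ v ∈ Y, ω v ≤ u)
    (hA : ms2 μ (fun x y => Near H ω A x y (1000 * u)) ≤ 1 - 1/20)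
    (hX : ∀ X : Finset V, X.card * u ≤ ∑ v, ω v →
      (∃ z, 1 - 1/200 < ms μ (fun y => Reach H (Y \ X) z y)) ∧
      1 - 1/20 < ms2 μ (fun x y => Near H ω (Y \ X) x y (1050 * u))) :
    ms2 μ (fun x y => Near H ω Y x y (998 * u)) ≤ 3/200 ∧
    ∃ c, 1 - 1/200 < ms μ (fun y => Near H ω Y c y (694 * u)) := by
  have hc : Conc H ω μ u Y := conc_of h0 h1 hu fun X h => (hX X h).1
  have hlo : ms2 μ (fun x y => Near H ω Y x y (998 * u)) ≤ 3/200 := by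
    refine (pair_conc h0 h1 hc (998 * u)).resolve_right fun h => ?_
    have : ms2 μ (fun x y => Near H ω Y x y (998 * u + 2 * u)) ≤
        ms2 μ (fun x y => Near H ω A x y (1000 * u)) :=
      ms2_mono h0 fun x y hxy => hxy.mono hYA (by omega)
    linarith
  refine ⟨hlo, center hK h0 h1 hc hω hlo ?_⟩
  have hh := (pair_conc h0 h1 hc (1050 * u)).resolve_left (fun h => by
    have := (hX ∅ (by simp)).2
    rw [Finset.sdiff_empty] at this
    linarith)
  rw [show 1052 * u = 1050 * u + 2 * u by ring]
  exact hh

lemma step (hK : K33free H) (h0 : ∀ v, 0 ≤ μ v) (h1 : ∑ v, μ v = 1) {u : ℕ} (hu : 0 < u)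
    (A : Finset V) (hA : ms2 μ (fun x y => Near H ω A x y (1000 * u)) ≤ 1 - 1/20) :
    ∃ X : Finset V, X.card * u ≤ 4 * ∑ v, ω v ∧
      ((∀ z, ms μ (fun y => Reach H (A \ X) z y) ≤ 1 - 1/200) ∨
        ms2 μ (fun x y => Near H ω (A \ X) x y (1050 * u)) ≤ 1 - 1/20) := by
  by_contra hcon
  push Not at hcon
  set Ω := ∑ v, ω v with hΩ
  set X0 : Finset V := Finset.univ.filter fun v => u < ω v with hX0
  have hX0c : X0.card * u ≤ Ω := by
    rw [← smul_eq_mul, ← Finset.sum_const]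
    refine le_trans (Finset.sum_le_sum (fun v hv => ?_))
      (Finset.sum_le_sum_of_subset (Finset.subset_univ X0))
    exact ((Finset.mem_filter.1 hv).2).le
  have hω0 : ∀ v ∈ A \ X0, ω v ≤ u := fun v hv => by
    by_contra h
    exact (Finset.mem_sdiff.1 hv).2 (Finset.mem_filter.2 ⟨Finset.mem_univ _, not_le.1 h⟩)
  have G : ∀ X : Finset V, X0 ⊆ X → X.card * u ≤ 3 * Ω →
      ms2 μ (fun x y => Near H ω (A \ X) x y (998 * u)) ≤ 3/200 ∧
      ∃ c, 1 - 1/200 < ms μ (fun y => Near H ω (A \ X) c y (694 * u)) := by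
    intro X h0X hXc
    refine good hK h0 h1 hu Finset.sdiff_subset
      (fun v hv => hω0 v (Finset.sdiff_subset_sdiff subset_rfl h0X hv)) hA fun X' hX' => ?_
    have hcd : (X ∪ X').card * u ≤ 4 * Ω := by
      have := Nat.mul_le_mul_right u (Finset.card_union_le X X')
      rw [add_mul] at this
      omega
    have := hcon (X ∪ X') hcd
    rw [sdiff_sdiff_left]
    exact this
  -- one cut
  have K : ∀ X : Finset V, ∀ m, X0 ⊆ X → X.card * u ≤ m * Ω → m ≤ 2 → ∀ c, 
      ∃ X' : Finset V, X ⊆ X' ∧ X'.card * u ≤ (m + 1) * Ω ∧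
      ∀ Z : Finset V, Z ⊆ A \ X' → ∀ c', 
        1 - 1/200 < ms μ (fun y => Near H ω Z c' y (694 * u)) →
        ¬ Near H ω (A \ X) c c' (400 * u) := by
    intro X m h0X hXc hm c
    obtain ⟨r, hr1, hr2, hr3⟩ := cut_exists (H := H) (ω := ω) (A \ X) c (400 * u) u hu
    refine ⟨X ∪ cutS H ω (A \ X) c r, Finset.subset_union_left, ?_, ?_⟩
    · have := Nat.mul_le_mul_right u (Finset.card_union_le X (cutS H ω (A \ X) c r))
      rw [add_mul] at this
      rw [add_mul]
      omega
    · intro Z hZ c' hc' hn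
      have hlo := (G X h0X (hXc.trans (Nat.mul_le_mul_right _ (by omega)))).1
      have hb : 1 - 1/200 < ms μ (fun y => Near H ω (A \ X) c y r) := by
        refine lt_of_lt_of_le hc' (ms_mono h0 fun y hy => ?_)
        refine cut_comp (A \ X) c r (z := c') ?_ (hn.mono subset_rfl hr1)
        rw [sdiff_sdiff_left]
        exact hy.reach.mono hZ
      have h2 := pair_of_ball h0 hb
      have : ms2 μ (fun x y => Near H ω (A \ X) x y (2 * r)) ≤
        ms2 μ (fun x y => Near H ω (A \ X) x y (998 * u)) :=
        ms2_mono h0 fun x y hxy => hxy.mono subset_rfl (by omega)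
      linarith
  obtain ⟨hlo, c1, hc1⟩ := G X0 subset_rfl (by omega)
  obtain ⟨X1, h01, hX1, k1⟩ := K X0 1 subset_rfl (by omega) (by omega) c1
  obtain ⟨_, c2, hc2⟩ := G X1 h01 (by omega)
  obtain ⟨X2, h12, hX2, k2⟩ := K X1 2 h01 (by omega) (by omega) c2
  obtain ⟨_, c3, hc3⟩ := G X2 (h01.trans h12) (by omega)
  have s1 : A \ X1 ⊆ A \ X0 := Finset.sdiff_subset_sdiff subset_rfl h01
  have s2 : A \ X2 ⊆ A \ X1 := Finset.sdiff_subset_sdiff subset_rfl h12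
  refine three hK h0 h1 (Y := ![A \ X0, A \ X1, A \ X2]) (ω := ω) (u := u) ?_ hω0 hlo ![c1, c2, c3] ?_ ?_
  · intro i j hij
    fin_cases i <;> fin_cases j <;> first
      | exact subset_rfl
      | exact s1
      | exact s2
      | exact s2.trans s1
      | exact absurd hij (by decide)
  · intro i
    fin_cases i
    · exact hc1
    · exact hc2
    · exact hc3
  · intro i j hij
    fin_cases i <;> fin_cases j <;> first
      | exact absurd hij (by decide)
      | exact k1 _ subset_rfl _ hc2
      | exact k1 _ s2 _ hc3
      | exact k2 _ subset_rfl _ hc3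

lemma reach_near {A : Finset V} {x y : V} (h : Reach H A x y) : Near H ω A x y (∑ v, ω v) := by
  obtain ⟨P, hP⟩ := h
  refine ⟨P.bypass, fun v hv => hP v (P.support_bypass_subset_support hv), ?_⟩
  have hnd : P.bypass.support.Nodup := P.bypass_isPath.support_nodup
  rw [wl, ← List.sum_toFinset ω hnd]
  exact Finset.sum_le_sum_of_subset (Finset.subset_univ _)

lemma sep (hK : K33free H) (h0 : ∀ v, 0 ≤ μ v) (h1 : ∑ v, μ v = 1) :
    ∀ k u : ℕ, 40 ≤ u → ∑ v, ω v + 1 ≤ u + k → ∀ A : Finset V,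
    ms2 μ (fun x y => Near H ω A x y (1000 * u)) ≤ 1 - 1/20 →
    ∃ X : Finset V, X.card * u ≤ 164 * ∑ v, ω v ∧
      ∀ z, ms μ (fun y => Reach H (A \ X) z y) ≤ 1 - 1/200 := by
  intro k
  induction k with
  | zero =>
    intro u hu hk A hA
    refine ⟨∅, by simp, fun z => ?_⟩
    rw [Finset.sdiff_empty]
    by_contra hz
    push Not at hz
    have hz' : 1 - 1/200 < ms μ (fun y => Near H ω A z y (∑ v, ω v)) :=
      lt_of_lt_of_le hz (ms_mono h0 fun y hy => reach_near hy)
    have h2 := pair_of_ball h0 hz'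
    have : ms2 μ (fun x y => Near H ω A x y (2 * ∑ v, ω v)) ≤
        ms2 μ (fun x y => Near H ω A x y (1000 * u)) :=
        ms2_mono h0 fun x y hxy => hxy.mono subset_rfl (by omega)
    linarith
  | succ k ih =>
    intro u hu hk A hA
    obtain ⟨X, hXc, hX | hX⟩ := step hK h0 h1 (by omega) A hA
    · exact ⟨X, by omega, hX⟩
    · obtain ⟨X', hX'c, hX'⟩ := ih (u + u / 20) (by omega) (by omega) (A \ X) (by
        refine le_trans (ms2_mono h0 fun x y hxy => hxy.mono subset_rfl ?_) hX
        omega)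
      refine ⟨X ∪ X', ?_, fun z => ?_⟩
      · have a1 := Nat.mul_le_mul_right u (Finset.card_union_le X X')
        rw [add_mul] at a1
        have a2 : X'.card * (41 * u) ≤ X'.card * (40 * (u + u / 20)) :=
          Nat.mul_le_mul_left _ (by omega)
        have a3 : X'.card * (41 * u) = 41 * (X'.card * u) := by ring
        have a4 : X'.card * (40 * (u + u / 20)) = 40 * (X'.card * (u + u / 20)) := by ring
        omega
      · have hz := hX' z
        rw [sdiff_sdiff_left] at hz
        exact hz

end Sep2
end PPO
end CW

namespace CW
section PPR
open scoped BigOperators Classical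


section Sep3
variable {V : Type*} [Fintype V] {H : SimpleGraph V}

lemma Kt_self (e : V) : Kt H e e = 1 := by simp [Kt]
lemma Kt_nonneg (e f : V) : 0 ≤ Kt H e f := by unfold Kt; split_ifs <;> norm_num

theorem separator (hK : K33free H) : ∃ X : Finset V,
    (X.card : ℝ) ≤ 11808000 * √(∑ e, ∑ f, Kt H e f) ∧
    ∀ z, ∑ y, (if Reach H (Finset.univ \ X) z y then ∑ f, Kt H y f else 0) ≤
      (1 - 1/200) * ∑ e, ∑ f, Kt H e f := by
  rcases isEmpty_or_nonempty V with hV | hV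
  · exact ⟨∅, by simp, fun z => (hV.false z).elim⟩
  set W := ∑ e, ∑ f, Kt H e f with hW
  set w : V → ℝ := fun e => ∑ f, Kt H e f with hw
  have w1 : ∀ e, 1 ≤ w e := fun e => by
    rw [← Kt_self (H := H) e]
    exact Finset.single_le_sum (f := fun f => Kt H e f) (fun f _ => Kt_nonneg e f) (Finset.mem_univ e)
  have hW1 : 1 ≤ W := by
    obtain ⟨e⟩ := hV
    exact (w1 e).trans (Finset.single_le_sum (f := w)
      (fun f _ => zero_le_one.trans (w1 f)) (Finset.mem_univ e))
  have hWp : 0 < W := by linarith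
  have hs : 0 < √W := Real.sqrt_pos.2 hWp
  have hs2 : √W ^ 2 = W := Real.sq_sqrt hWp.le
  set μ : V → ℝ := fun e => w e / W with hμ
  have h0 : ∀ v, 0 ≤ μ v := fun v => div_nonneg (zero_le_one.trans (w1 v)) hWp.le
  have h1 : ∑ v, μ v = 1 := by
    rw [hμ, ← Finset.sum_div]
    exact div_self hWp.ne'
  set θ : ℝ := 1 / (9 * √W) with hθ
  have hθp : 0 < θ := by positivity
  have hθW : 81 * (θ ^ 2 * W) ≤ 1 := by
    rw [hθ, div_pow, mul_pow, hs2]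
    apply le_of_eq
    field_simp
    norm_num
  obtain ⟨ν, ν0, ν1, hν⟩ := spread H hK μ h0 h1 θ hθp hθW
  obtain ⟨T, hT⟩ := exists_nat_ge (max (Fintype.card V : ℝ) (2000 * 41 / θ))
  have hT1 : (Fintype.card V : ℝ) ≤ T := (le_max_left _ _).trans hT
  have hT2 : 41 ≤ T * θ / 2000 := by
    have := (le_max_right _ _).trans hT
    rw [div_le_iff₀ hθp] at this
    linarith
  set ω : V → ℕ := fun v => ⌈T * ν v⌉₊ with hω
  set u : ℕ := ⌊T * θ / 2000⌋₊ with hu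
  have hTn : (0:ℝ) ≤ T := Nat.cast_nonneg _
  have hu1 : (u : ℝ) ≤ T * θ / 2000 := Nat.floor_le (by linarith)
  have hu2 : T * θ / 2000 < u + 1 := Nat.lt_floor_add_one _
  have hu40 : 40 ≤ u := Nat.le_floor (by push_cast; linarith)
  have hΩ : ((∑ v, ω v : ℕ) : ℝ) ≤ 2 * T := by
    push_cast
    calc ∑ v, (ω v : ℝ) ≤ ∑ v, (T * ν v + 1) := Finset.sum_le_sum fun v _ =>
          (Nat.ceil_lt_add_one (mul_nonneg hTn (ν0 v))).le
      _ = T + Fintype.card V := by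
          rw [Finset.sum_add_distrib, ← Finset.mul_sum, ν1]; simp
      _ ≤ _ := by linarith
  have hN : ms2 μ (fun x y => Near H ω Finset.univ x y (1000 * u)) ≤ 1 - 1/20 := by
    refine le_trans (ms2_mono h0 (T := fun x y => ∃ P : H.Walk x y, (P.support.map ν).sum ≤ θ / 2)
      fun x y hxy => ?_) hν
    obtain ⟨P, -, hP⟩ := hxy
    refine ⟨P, ?_⟩
    have hl : ∀ l : List V, T * (l.map ν).sum ≤ ((l.map ω).sum : ℕ) := by
      intro l
      induction l with
      | nil => simp
      | cons a l ih =>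
        have := Nat.le_ceil (T * ν a)
        simp only [List.map_cons, List.sum_cons, Nat.cast_add]
        rw [mul_add]
        exact add_le_add this ih
    have h2 := hl P.support
    have h3 : (((P.support.map ω).sum : ℕ) : ℝ) ≤ 1000 * u := by exact_mod_cast hP
    have hTp : (0:ℝ) < T := by
      rcases hTn.eq_or_lt with h | h
      · rw [← h] at hT2; norm_num at hT2
      · exact h
    have : T * (P.support.map ν).sum ≤ T * (θ / 2) := by linarith
    exact le_of_mul_le_mul_left this hTp
  obtain ⟨X, hXc, hX⟩ := sep hK h0 h1 (∑ v, ω v + 1) u hu40 (by omega) Finset.univ hN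
  refine ⟨X, ?_, fun z => ?_⟩
  · have e1 : (X.card : ℝ) * u ≤ 164 * ((∑ v, ω v : ℕ) : ℝ) := by exact_mod_cast hXc
    have e2 : T * θ / 4000 ≤ u := by linarith
    have e3 : (X.card : ℝ) * (T * θ / 4000) ≤ 328 * T := by
      have := mul_le_mul_of_nonneg_left e2 (Nat.cast_nonneg (α := ℝ) X.card)
      linarith
    have hTp : (0:ℝ) < T := by
      rcases hTn.eq_or_lt with h | h
      · rw [← h] at hT2; norm_num at hT2
      · exact h
    have e4 : (X.card : ℝ) * θ ≤ 1312000 := by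
      refine le_of_mul_le_mul_left (a := (T:ℝ)) ?_ hTp
      linarith
    rw [hθ, mul_one_div, div_le_iff₀ (by positivity)] at e4
    linarith
  · have := hX z
    have e : ms μ (fun y => Reach H (Finset.univ \ X) z y) * W =
        ∑ y, (if Reach H (Finset.univ \ X) z y then w y else 0) := by
      rw [ms, Finset.sum_mul]
      refine Finset.sum_congr rfl fun y _ => ?_
      split_ifs
      · rw [hμ]; exact div_mul_cancel₀ _ hWp.ne'
      · simp
    rw [← e]
    exact mul_le_mul_of_nonneg_right this hWp.le

end Sep3
end PPR
end CW

namespace CW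
section PPL
open scoped BigOperators Classical


section Lay
variable {E : Type*} [Fintype E] (H : SimpleGraph E)

/-- weight of a set of edges -/
noncomputable def WF (F : Finset E) : ℝ := ∑ e ∈ F, ∑ f ∈ F, Kt H e f

variable {H}

lemma separatorF (hK : K33free H) (F : Finset E) : ∃ X : Finset E,
    (X.card : ℝ) ≤ 11808000 * √(WF H F) ∧
    ∀ z, ∑ y ∈ F, (if Reach H (F \ X) z y then ∑ f ∈ F, Kt H y f else 0) ≤
      (1 - 1/200) * WF H F := by
  set s : Set E := {x | x ∈ F} with hs
  have hK' := hK.induce s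
  obtain ⟨X, hXc, hX⟩ := separator hK'
  have kt : ∀ e f : s, Kt (H.induce s) e f = Kt H e.1 f.1 := by
    intro e f
    unfold Kt
    simp only [SimpleGraph.comap_adj, Function.Embedding.subtype_apply, Subtype.ext_iff]
  have sm : ∀ g : E → ℝ, ∑ e : s, g e.1 = ∑ e ∈ F, g e := by
    intro g
    symm
    exact Finset.sum_subtype F (fun x => Iff.rfl) g
  have sW : ∑ e : s, ∑ f : s, Kt (H.induce s) e f = WF H F := by
    simp only [kt]
    rw [WF, ← sm]
    exact Finset.sum_congr rfl fun e _ => sm _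
  rw [sW] at hXc hX
  refine ⟨X.map ⟨Subtype.val, Subtype.val_injective⟩, by rwa [Finset.card_map], fun z => ?_⟩
  have hR : ∀ z y, Reach H (F \ X.map ⟨Subtype.val, Subtype.val_injective⟩) z y →
      ∃ (hz : z ∈ s) (hy : y ∈ s), Reach (H.induce s) (Finset.univ \ X) ⟨z, hz⟩ ⟨y, hy⟩ := by
    rintro z y ⟨P, hP⟩
    have hPs : ∀ v ∈ P.support, v ∈ s := fun v hv => (Finset.mem_sdiff.1 (hP v hv)).1
    refine ⟨hPs _ P.start_mem_support, hPs _ P.end_mem_support, P.induce s hPs, fun v hv => ?_⟩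
    rw [SimpleGraph.Walk.support_induce, List.mem_attachWith] at hv
    refine Finset.mem_sdiff.2 ⟨Finset.mem_univ _, fun hvX => ?_⟩
    exact (Finset.mem_sdiff.1 (hP _ hv)).2 (Finset.mem_map.2 ⟨v, hvX, rfl⟩)
  by_cases hz : z ∈ s
  · refine le_trans ?_ (hX ⟨z, hz⟩)
    rw [← sm]
    refine Finset.sum_le_sum fun y _ => ?_
    have e : ∑ f : s, Kt (H.induce s) y f = ∑ f ∈ F, Kt H y.1 f := by
      simp only [kt]; exact sm _
    rw [e]
    by_cases h : Reach H (F \ X.map ⟨Subtype.val, Subtype.val_injective⟩) z y.1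
    · obtain ⟨_, _, h'⟩ := hR _ _ h
      rw [if_pos h]
      refine le_of_eq (if_pos ?_).symm
      convert h'
    · rw [if_neg h]
      split_ifs
      · exact Finset.sum_nonneg fun f _ => Kt_nonneg _ _
      · exact le_rfl
  · rw [Finset.sum_eq_zero]
    · exact mul_nonneg (by norm_num) (Finset.sum_nonneg fun e _ => Finset.sum_nonneg fun f _ => Kt_nonneg _ _)
    · intro y _
      rw [if_neg]
      exact fun h => hz (hR _ _ h).1

variable {U : Type*} [Fintype U] (a b : E → U)

/-- edge `e` is cut at height `t` -/
def Cut (r : U → ℕ) (t : ℕ) (e : E) : Prop :=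
  (r (a e) ≤ t ∧ t < r (b e)) ∨ (r (b e) ≤ t ∧ t < r (a e))

theorem layout (hK : K33free H)
    (hinc : ∀ e f, (a e = a f ∨ a e = b f ∨ b e = a f ∨ b e = b f) → e = f ∨ H.Adj e f)
    (F : Finset E) : ∃ r : U → ℕ, Function.Injective r ∧
      ∀ t, ((F.filter (Cut a b r t)).card : ℝ) ≤ 400 * 11808000 * √(WF H F) := by
  induction F using Finset.strongInduction with
  | H F ih =>
  obtain ⟨r0, hr0⟩ : ∃ r : U → ℕ, Function.Injective r :=
    ⟨fun v => (Fintype.equivFin U v : ℕ), fun x y h => (Fintype.equivFin U).injective (Fin.ext h)⟩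
  rcases F.eq_empty_or_nonempty with rfl | hF
  · exact ⟨r0, hr0, fun t => by simp⟩
  have hWp : 0 < WF H F := by
    obtain ⟨e, he⟩ := hF
    refine Finset.sum_pos' (fun e _ => Finset.sum_nonneg fun f _ => Kt_nonneg _ _) ⟨e, he, ?_⟩
    refine Finset.sum_pos' (fun f _ => Kt_nonneg _ _) ⟨e, he, ?_⟩
    rw [Kt_self]; norm_num
  have ih' : ∀ S : Finset E, ∃ r : U → ℕ, Function.Injective r ∧ (S ⊂ F → 
      ∀ t, ((S.filter (Cut a b r t)).card : ℝ) ≤ 400 * 11808000 * √(WF H S)) := by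
    intro S
    by_cases hS : S ⊂ F
    · obtain ⟨r, h1, h2⟩ := ih S hS
      exact ⟨r, h1, fun _ => h2⟩
    · exact ⟨r0, hr0, fun h => absurd h hS⟩
  choose R hRi hRc using ih'
  obtain ⟨X, hXc, hX⟩ := separatorF hK F
  set comp : E → Finset E := fun e => F.filter (Reach H (F \ X) e) with hcomp
  have mem_comp : ∀ e f, f ∈ comp e ↔ f ∈ F ∧ Reach H (F \ X) e f := fun e f => Finset.mem_filter
  have hself : ∀ e ∈ F, e ∉ X → e ∈ comp e := fun e he hx => (mem_comp e e).2
    ⟨he, SimpleGraph.Walk.nil, by simp [he, hx]⟩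
  have hcW : ∀ e, WF H (comp e) ≤ (1 - 1/200) * WF H F := by
    intro e
    refine le_trans ?_ (hX e)
    rw [← Finset.sum_filter, WF]
    refine Finset.sum_le_sum fun y _ => ?_
    exact Finset.sum_le_sum_of_subset_of_nonneg (Finset.filter_subset _ _) fun f _ _ => Kt_nonneg _ _
  have hcs : ∀ e, comp e ⊂ F := by
    intro e
    refine lt_of_le_of_ne (Finset.filter_subset _ _) fun h => ?_
    have := hcW e
    rw [h] at this
    linarith
  have hshare : ∀ e f, e ∈ F → e ∉ X → f ∈ F → f ∉ X →
      (a e = a f ∨ a e = b f ∨ b e = a f ∨ b e = b f) → comp e = comp f := by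
    intro e f he hx hf hfx h
    have hr : Reach H (F \ X) e f := by
      rcases hinc e f h with rfl | hadj
      · exact ⟨SimpleGraph.Walk.nil, by simp [he, hx]⟩
      · exact ⟨SimpleGraph.Walk.cons hadj SimpleGraph.Walk.nil, by simp [he, hx, hf, hfx]⟩
    ext y
    rw [mem_comp, mem_comp]
    exact ⟨fun h => ⟨h.1, hr.symm.trans h.2⟩, fun h => ⟨h.1, hr.trans h.2⟩⟩
  have hL : ∀ v : U, ∃ S : Finset E, ∀ e ∈ F, e ∉ X → (a e = v ∨ b e = v) → comp e = S := by
    intro v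
    by_cases h : ∃ e ∈ F, e ∉ X ∧ (a e = v ∨ b e = v)
    · obtain ⟨f, hf, hfx, hfv⟩ := h
      refine ⟨comp f, fun e he hex hev => hshare e f he hex hf hfx ?_⟩
      rcases hfv with h1 | h1 <;> rcases hev with h2 | h2 <;> simp [h1, h2]
    · exact ⟨∅, fun e he hex hev => absurd ⟨e, he, hex, hev⟩ h⟩
  choose L hL using hL
  obtain ⟨code, hcode⟩ : ∃ c : Finset E → ℕ, Function.Injective c :=
    ⟨fun v => (Fintype.equivFin (Finset E) v : ℕ),
      fun x y h => (Fintype.equivFin (Finset E)).injective (Fin.ext h)⟩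
  obtain ⟨N, hN⟩ : ∃ N, ∀ S v, R S v < N := by
    refine ⟨∑ S, ∑ v, R S v + 1, fun S v => Nat.lt_succ_of_le ?_⟩
    exact (Finset.single_le_sum (f := fun v => R S v) (fun _ _ => Nat.zero_le _) (Finset.mem_univ v)).trans
      (Finset.single_le_sum (f := fun S => ∑ v, R S v) (fun _ _ => Nat.zero_le _) (Finset.mem_univ S))
  have hdiv : ∀ S v, (N * code S + R S v) / N = code S := fun S v => by
    have := hN S v
    rw [Nat.mul_add_div (by omega), Nat.div_eq_of_lt this, add_zero]
  have hmod : ∀ S v, (N * code S + R S v) % N = R S v := fun S v => by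
    rw [Nat.mul_add_mod, Nat.mod_eq_of_lt (hN S v)]
  refine ⟨fun v => N * code (L v) + R (L v) v, ?_, fun t => ?_⟩
  · intro v v' h
    have h1 : code (L v) = code (L v') := by
      rw [← hdiv (L v) v, ← hdiv (L v') v']; exact congrArg (· / N) h
    have h2 : L v = L v' := hcode h1
    have h3 : R (L v) v = R (L v') v' := by
      rw [← hmod (L v) v, ← hmod (L v') v']; exact congrArg (· % N) h
    rw [← h2] at h3
    exact hRi _ h3
  · have key : ∀ e ∈ F, e ∉ X → Cut a b (fun v => N * code (L v) + R (L v) v) t e →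
        code (comp e) = t / N ∧ Cut a b (R (comp e)) (t % N) e := by
      intro e he hex hc
      have ha := hL (a e) e he hex (Or.inl rfl)
      have hb := hL (b e) e he hex (Or.inr rfl)
      unfold Cut at hc
      simp only at hc
      rw [← ha, ← hb] at hc
      have n1 := hN (comp e) (a e)
      have n2 := hN (comp e) (b e)
      obtain ⟨s, hs, hsN⟩ : ∃ s, t = N * code (comp e) + s ∧ s < N := by
        refine ⟨t - N * code (comp e), ?_, ?_⟩ <;> omega
      have d1 : t / N = code (comp e) := by
        rw [hs, Nat.mul_add_div (by omega), Nat.div_eq_of_lt hsN, add_zero]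
      have d2 : t % N = s := by rw [hs, Nat.mul_add_mod, Nat.mod_eq_of_lt hsN]
      refine ⟨d1.symm, ?_⟩
      rw [d2]
      unfold Cut
      omega
    set Q := F.filter (Cut a b (fun v => N * code (L v) + R (L v) v) t) with hQ
    have memQ : ∀ e, e ∈ Q ↔ e ∈ F ∧ Cut a b (fun v => N * code (L v) + R (L v) v) t e :=
      fun e => Finset.mem_filter
    have hs0 : 0 < √(WF H F) := Real.sqrt_pos.2 hWp
    by_cases hQX : Q ⊆ X
    · have : (Q.card : ℝ) ≤ X.card := by exact_mod_cast Finset.card_le_card hQX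
      linarith
    · obtain ⟨e0, he0, hx0⟩ := Finset.not_subset.1 hQX
      obtain ⟨hF0, hC0⟩ := (memQ _).1 he0
      obtain ⟨k1, k2⟩ := key e0 hF0 hx0 hC0
      have hsub : Q ⊆ X ∪ (comp e0).filter (Cut a b (R (comp e0)) (t % N)) := by
        intro e he
        obtain ⟨heF, heC⟩ := (memQ _).1 he
        by_cases hex : e ∈ X
        · exact Finset.mem_union_left _ hex
        · obtain ⟨l1, l2⟩ := key e heF hex heC
          have : comp e = comp e0 := hcode (l1.trans k1.symm)
          rw [← this]
          exact Finset.mem_union_right _ (Finset.mem_filter.2 ⟨hself e heF hex, l2⟩)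
      have c1 : (Q.card : ℝ) ≤ X.card + ((comp e0).filter (Cut a b (R (comp e0)) (t % N))).card := by
        exact_mod_cast (Finset.card_le_card hsub).trans (Finset.card_union_le _ _)
      have c2 := hRc (comp e0) (hcs e0) (t % N)
      have c3 : √(WF H (comp e0)) ≤ (1 - 1/400) * √(WF H F) := by
        rw [Real.sqrt_le_left (by positivity), mul_pow, Real.sq_sqrt hWp.le]
        refine (hcW e0).trans (mul_le_mul_of_nonneg_right (by norm_num) hWp.le)
      linarith

end Lay
end PPL
end CW

namespace CW
section PPF
open scoped BigOperators Classical


section Fin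
variable {n : ℕ} {G : SimpleGraph (Fin n)} (D : Drawing G)

lemma touch_cases {e f : G.edgeSet} (h : (touch D).Adj e f) :
    (e ≠ f ∧ ∃ p, D.IsCross e f p) ∨ ∃ v : Fin n, v ∈ e.1 ∧ v ∈ f.1 := by
  obtain ⟨hne, p, ⟨s, hs, hsp⟩, ⟨t, ht, htp⟩⟩ := h
  obtain ⟨a, b, eab, ea, eb⟩ := D.curve_ends e
  obtain ⟨c, d, fcd, fc, fd⟩ := D.curve_ends f
  have hE : s ∈ Set.Ioo (0:ℝ) 1 ∨ ∃ v ∈ e.1, D.curve e s = D.pos v := by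
    rcases eq_or_lt_of_le hs.1 with h0 | h0
    · right; exact ⟨a, by rw [eab]; simp, by rw [← h0, ea]⟩
    rcases eq_or_lt_of_le hs.2 with h1 | h1
    · right; exact ⟨b, by rw [eab]; simp, by rw [h1, eb]⟩
    · exact Or.inl ⟨h0, h1⟩
  have hF : t ∈ Set.Ioo (0:ℝ) 1 ∨ ∃ v ∈ f.1, D.curve f t = D.pos v := by
    rcases eq_or_lt_of_le ht.1 with h0 | h0
    · right; exact ⟨c, by rw [fcd]; simp, by rw [← h0, fc]⟩
    rcases eq_or_lt_of_le ht.2 with h1 | h1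
    · right; exact ⟨d, by rw [fcd]; simp, by rw [h1, fd]⟩
    · exact Or.inl ⟨h0, h1⟩
  rcases hE with hE | ⟨v, hv, hv'⟩ <;> rcases hF with hF | ⟨w, hw, hw'⟩
  · exact Or.inl ⟨hne, p, ⟨s, hE, hsp⟩, ⟨t, hF, htp⟩⟩
  · exact absurd ⟨w, by rw [← hw', htp, hsp]⟩ (D.curve_avoid e s hE)
  · exact absurd ⟨v, by rw [← hv', htp, hsp]⟩ (D.curve_avoid f t hF)
  · right
    have : v = w := D.pos_inj (by rw [← hv', ← hw', hsp, htp])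
    exact ⟨v, hv, this ▸ hw⟩

lemma deg_sum (v : Fin n) : ∑ e : G.edgeSet, (if v ∈ e.1 then (1:ℝ) else 0) ≤ (G.neighborSet v).ncard := by
  rw [Finset.sum_boole]
  have h : (Finset.univ.filter fun e : G.edgeSet => v ∈ e.1).card ≤ (G.neighborSet v).ncard := by
    rw [← Nat.card_coe_set_eq, ← Nat.card_congr (G.incidenceSetEquivNeighborSet v), Nat.card_coe_set_eq,
      ← Set.ncard_coe_finset, ← Set.ncard_image_of_injective _ Subtype.val_injective]
    refine Set.ncard_le_ncard ?_ (Set.toFinite _)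
    rintro _ ⟨e, he, rfl⟩
    exact ⟨e.2, (Finset.mem_filter.1 he).2⟩
  exact_mod_cast h

lemma cross_sum : ∑ e : G.edgeSet, ∑ f : G.edgeSet,
    (if e ≠ f ∧ ∃ p, D.IsCross e f p then (1:ℝ) else 0) ≤ 2 * D.numCrossingPairs := by
  rw [← Finset.sum_product', Finset.sum_boole]
  set S := (Finset.univ ×ˢ Finset.univ : Finset (G.edgeSet × G.edgeSet)).filter
    (fun x => x.1 ≠ x.2 ∧ ∃ p, D.IsCross x.1 x.2 p) with hS
  have memS : ∀ x, x ∈ S ↔ x.1 ≠ x.2 ∧ ∃ p, D.IsCross x.1 x.2 p := fun x => by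
    rw [hS, Finset.mem_filter]; simp
  have h1 := Finset.card_le_mul_card_image (f := fun x : G.edgeSet × G.edgeSet => s(x.1, x.2)) S 2
    (by
      intro q _
      induction q using Sym2.ind with
      | _ x y =>
        refine le_trans (Finset.card_le_card (t := {(x, y), (y, x)}) ?_) Finset.card_le_two
        intro z hz
        have := (Finset.mem_filter.1 hz).2
        rw [Sym2.eq_iff] at this
        rw [Finset.mem_insert, Finset.mem_singleton]
        exact this.imp (fun h => Prod.ext h.1 h.2) (fun h => Prod.ext h.1 h.2))
  have h2 : (S.image fun x : G.edgeSet × G.edgeSet => s(x.1, x.2)).card ≤ D.numCrossingPairs := by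
    rw [← Set.ncard_coe_finset]
    refine Set.ncard_le_ncard ?_ (Set.toFinite _)
    intro q hq
    obtain ⟨x, hx, rfl⟩ := Finset.mem_image.1 hq
    obtain ⟨hx1, hx2⟩ := (memS x).1 hx
    exact ⟨x.1, x.2, hx1, rfl, hx2⟩
  have h3 : S.card ≤ 2 * D.numCrossingPairs := h1.trans (Nat.mul_le_mul_left _ h2)
  exact_mod_cast h3

lemma WF_le : WF (touch D) Finset.univ ≤ 2 * D.numCrossingPairs + ssqd G := by
  have hpt : ∀ e f : G.edgeSet, Kt (touch D) e f ≤
      (if e ≠ f ∧ ∃ p, D.IsCross e f p then (1:ℝ) else 0) +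
      ∑ v, (if v ∈ e.1 then (1:ℝ) else 0) * (if v ∈ f.1 then (1:ℝ) else 0) := by
    intro e f
    have hn : ∀ v ∈ (Finset.univ : Finset (Fin n)),
      0 ≤ (if v ∈ e.1 then (1:ℝ) else 0) * (if v ∈ f.1 then (1:ℝ) else 0) := fun v _ => by
        split_ifs <;> norm_num
    have hsh : ∀ v, v ∈ e.1 → v ∈ f.1 → 1 ≤ ∑ v, (if v ∈ e.1 then (1:ℝ) else 0) *
        (if v ∈ f.1 then (1:ℝ) else 0) := fun v hv hw => by
      have := Finset.single_le_sum hn (Finset.mem_univ v)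
      simpa [hv, hw] using this
    have h0 : 0 ≤ (if e ≠ f ∧ ∃ p, D.IsCross e f p then (1:ℝ) else 0) := by
      split_ifs <;> norm_num
    by_cases h : e = f ∨ (touch D).Adj e f
    · rw [Kt, if_pos h]
      have h' : (e ≠ f ∧ ∃ p, D.IsCross e f p) ∨ ∃ v : Fin n, v ∈ e.1 ∧ v ∈ f.1 := by
        rcases h with rfl | h
        · obtain ⟨a, b, eab, -⟩ := D.curve_ends e
          exact Or.inr ⟨a, by rw [eab]; simp, by rw [eab]; simp⟩
        · exact touch_cases D h
      rcases h' with h' | ⟨v, hv, hw⟩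
      · rw [if_pos h']
        have := Finset.sum_nonneg hn
        linarith
      · have := hsh v hv hw
        linarith
    · rw [Kt, if_neg h]
      exact add_nonneg h0 (Finset.sum_nonneg hn)
  have hsq : ∑ e : G.edgeSet, ∑ f : G.edgeSet, ∑ v : Fin n,
      (if v ∈ e.1 then (1:ℝ) else 0) * (if v ∈ f.1 then (1:ℝ) else 0) ≤ ssqd G := by
    have e1 : ∑ e : G.edgeSet, ∑ f : G.edgeSet, ∑ v : Fin n,
      (if v ∈ e.1 then (1:ℝ) else 0) * (if v ∈ f.1 then (1:ℝ) else 0) =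
      ∑ v : Fin n, (∑ e : G.edgeSet, (if v ∈ e.1 then (1:ℝ) else 0)) ^ 2 := by
      have : ∀ e : G.edgeSet, ∑ f : G.edgeSet, ∑ v : Fin n,
        (if v ∈ e.1 then (1:ℝ) else 0) * (if v ∈ f.1 then (1:ℝ) else 0) =
        ∑ v : Fin n, ∑ f : G.edgeSet,
        (if v ∈ e.1 then (1:ℝ) else 0) * (if v ∈ f.1 then (1:ℝ) else 0) :=
          fun e => Finset.sum_comm
      simp only [this]
      rw [Finset.sum_comm]
      refine Finset.sum_congr rfl fun v _ => ?_
      rw [sq, Finset.sum_mul_sum]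
    rw [e1, ssqd, finsum_eq_sum_of_fintype]
    push_cast
    refine Finset.sum_le_sum fun v _ => ?_
    refine pow_le_pow_left₀ (Finset.sum_nonneg fun e _ => by split_ifs <;> norm_num) (deg_sum v) 2
  calc WF (touch D) Finset.univ ≤ ∑ e : G.edgeSet, ∑ f : G.edgeSet,
      ((if e ≠ f ∧ ∃ p, D.IsCross e f p then (1:ℝ) else 0) +
      ∑ v, (if v ∈ e.1 then (1:ℝ) else 0) * (if v ∈ f.1 then (1:ℝ) else 0)) :=
        Finset.sum_le_sum fun e _ => Finset.sum_le_sum fun f _ => hpt e f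
    _ ≤ _ := by
      simp only [Finset.sum_add_distrib]
      exact add_le_add (cross_sum D) hsq

lemma cutwidth_le : (cutwidth G : ℝ) ≤ 400 * 11808000 * √(WF (touch D) Finset.univ) := by
  choose a b hab ha hb using D.curve_ends
  have m0 : (0:ℝ) ∈ Set.Icc (0:ℝ) 1 := by simp
  have m1 : (1:ℝ) ∈ Set.Icc (0:ℝ) 1 := by simp
  obtain ⟨r, hr, hcut⟩ := layout (H := touch D) a b (touch_K33free D) (by
    intro e f h
    by_cases hef : e = f
    · exact Or.inl hef
    · refine Or.inr ⟨hef, ?_⟩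
      rcases h with h | h | h | h
      · exact ⟨D.pos (a e), ⟨0, m0, ha e⟩, ⟨0, m0, by rw [ha f, h]⟩⟩
      · exact ⟨D.pos (a e), ⟨0, m0, ha e⟩, ⟨1, m1, by rw [hb f, h]⟩⟩
      · exact ⟨D.pos (b e), ⟨1, m1, hb e⟩, ⟨0, m0, by rw [ha f, h]⟩⟩
      · exact ⟨D.pos (b e), ⟨1, m1, hb e⟩, ⟨1, m1, by rw [hb f, h]⟩⟩) Finset.univ
  set σ : Fin n ≃ Fin n := Tuple.sort r with hσ
  have hmono : StrictMono (r ∘ σ) :=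
    (Tuple.monotone_sort r).strictMono_of_injective (hr.comp σ.injective)
  have hle : ∀ u i, σ.symm u ≤ i → r u ≤ r (σ i) := fun u i h => by
    simpa using hmono.monotone h
  have hlt : ∀ v i, i < σ.symm v → r (σ i) < r v := fun v i h => by
    simpa using hmono h
  have hfl : cutwidth G ≤ ⌊400 * 11808000 * √(WF (touch D) Finset.univ)⌋₊ := by
    refine Nat.sInf_le ⟨σ, fun i => ?_⟩
    refine Nat.le_floor (le_trans ?_ (hcut (r (σ i))))
    have : { e ∈ G.edgeSet | ∃ u v : Fin n, e = s(u, v) ∧ σ.symm u ≤ i ∧ i < σ.symm v }.ncard ≤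
        (Finset.univ.filter (Cut a b r (r (σ i)))).card := by
      rw [← Set.ncard_coe_finset, ← Set.ncard_image_of_injective _ Subtype.val_injective]
      refine Set.ncard_le_ncard ?_ (Set.toFinite _)
      rintro e ⟨he, u, v, huv, h1, h2⟩
      refine ⟨⟨e, he⟩, ?_, rfl⟩
      refine Finset.mem_coe.2 (Finset.mem_filter.2 ⟨Finset.mem_univ _, ?_⟩)
      have h3 := hab ⟨e, he⟩
      have h3' : s(a ⟨e, he⟩, b ⟨e, he⟩) = s(u, v) := h3.symm.trans huv
      rw [Sym2.eq_iff] at h3'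
      rcases h3' with ⟨h4, h5⟩ | ⟨h4, h5⟩
      · left; rw [h4, h5]; exact ⟨hle _ _ h1, hlt _ _ h2⟩
      · right; rw [h4, h5]; exact ⟨hle _ _ h1, hlt _ _ h2⟩
    exact_mod_cast this
  exact (Nat.cast_le.2 hfl).trans (Nat.floor_le (by positivity))

theorem main_bound (G : SimpleGraph (Fin n)) :
    (cutwidth G : ℝ) ≤ (2 * (400 * 11808000)) * √(pcrNum G + ssqd G) := by
  obtain ⟨D0⟩ := drawing_exists G
  obtain ⟨D, hD⟩ : ∃ D : Drawing G, D.numCrossingPairs = pcrNum G :=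
    Nat.sInf_mem (s := { n | ∃ D : Drawing G, D.numCrossingPairs = n }) ⟨_, D0, rfl⟩
  have h1 := cutwidth_le D
  have h2 := WF_le D
  rw [hD] at h2
  have h3 : √(WF (touch D) Finset.univ) ≤ 2 * √(pcrNum G + ssqd G) := by
    rw [Real.sqrt_le_left (by positivity), mul_pow, Real.sq_sqrt (by positivity)]
    have : (0:ℝ) ≤ pcrNum G := Nat.cast_nonneg _
    have : (0:ℝ) ≤ ssqd G := Nat.cast_nonneg _
    linarith
  linarith

end Fin
end PPF
end CW

/-- There exists an absolute constant `c > 0` such that for every simple graph `G`,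
`cw(G) ≤ c · sqrt(pcr(G) + Σ d_k²)`. -/
theorem cutwidth_le_sqrt_pcr_ssqd :
    ∃ c : ℝ, 0 < c ∧ ∀ (n : ℕ) (G : SimpleGraph (Fin n)),
      (cutwidth G : ℝ) ≤ c * Real.sqrt (pcrNum G + ssqd G) := by
  exact ⟨2 * (400 * 11808000), by norm_num, fun _ G => CW.main_bound G⟩
end

section
/- There exists an absolute constant c > 0 such that for every simple graph G with degree sequence d_1, d_2, …, d_n, the bisection width satisfies bw(G) ≤ c · sqrt(pcr(G) + Σ_{k=1}^n d_k²). -/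
open scoped BigOperators

/-- The bisection width of a graph on `n` vertices: the least number of edges running across
a partition of the vertex set into two parts of at most `2n/3` vertices each. -/
noncomputable def bisectionWidth {n : ℕ} (G : SimpleGraph (Fin n)) : ℕ :=
  sInf { m : ℕ | ∃ A : Set (Fin n),
    3 * A.ncard ≤ 2 * n ∧ 3 * Aᶜ.ncard ≤ 2 * n ∧
    { e ∈ G.edgeSet | ∃ u v : Fin n, e = s(u, v) ∧ u ∈ A ∧ v ∉ A }.ncard = m }

namespace BW

/-- closure form of connectedness of a set with respect to a relation -/
def Conn {α : Type*} (r : α → α → Prop) (A : Set α) : Prop :=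
  ∀ P : α → Prop, (∃ a ∈ A, P a) → (∀ a ∈ A, ∀ b ∈ A, r a b → P a → P b) → ∀ a ∈ A, P a

/-- grid adjacency in the square grid -/
def Adj (p q : ℤ × ℤ) : Prop :=
  (p.2 = q.2 ∧ (q.1 = p.1 + 1 ∨ p.1 = q.1 + 1)) ∨ (p.1 = q.1 ∧ (q.2 = p.2 + 1 ∨ p.2 = q.2 + 1))

theorem Adj.symm {p q : ℤ × ℤ} (h : Adj p q) : Adj q p := by
  unfold Adj at *; omega

open Classical in
/-- crossing of the edge `u v` with the ray from `p` -/
noncomputable def phi (p u v : ℤ × ℤ) : ZMod 2 :=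
  if u.1 = v.1 ∧ p.1 < u.1 ∧ ((u.2 = p.2 ∧ v.2 = p.2 + 1) ∨ (v.2 = p.2 ∧ u.2 = p.2 + 1)) then 1 else 0

theorem phi_symm (p u v : ℤ × ℤ) : phi p u v = phi p v u := by
  unfold phi
  congr 1
  apply propext
  constructor <;> (rintro ⟨h1, h2, h3⟩; refine ⟨h1.symm, by omega, by omega⟩)

/-- walks from `o` inside `K`, remembering the crossing function -/
inductive Wk (o : ℤ × ℤ) (K : Set (ℤ × ℤ)) : (ℤ × ℤ → ZMod 2) → ℤ × ℤ → Prop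
  | nil : o ∈ K → Wk o K (fun _ => 0) o
  | cons {g u v} : Wk o K g u → Adj u v → v ∈ K → Wk o K (fun p => g p + phi p u v) v

theorem Wk.mono {o K K' g v} (h : Wk o K g v) (hK : K ⊆ K') : Wk o K' g v := by
  induction h with
  | nil h => exact .nil (hK h)
  | cons _ ha hv ih => exact .cons ih ha (hK hv)

theorem Wk.mem {o K g v} (h : Wk o K g v) : v ∈ K := by
  cases h <;> assumption

open Classical in
noncomputable def psi (p p' v : ℤ × ℤ) : ZMod 2 :=
  if p.1 = p'.1 ∧ p.1 < v.1 ∧ ((p'.2 = p.2 + 1 ∧ v.2 = p'.2) ∨ (p.2 = p'.2 + 1 ∧ v.2 = p.2)) then 1 else 0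

theorem zz (a : ZMod 2) : a + a = 0 := by revert a; decide

theorem phi_psi {p p' u v : ℤ × ℤ} (hp : Adj p p') (ha : Adj u v)
    (h1 : u ≠ p) (h2 : u ≠ p') (h3 : v ≠ p) (h4 : v ≠ p') :
    phi p u v + phi p' u v = psi p p' u + psi p p' v := by
  obtain ⟨a, b⟩ := p
  obtain ⟨a', b'⟩ := p'
  obtain ⟨x, y⟩ := u
  obtain ⟨x', y'⟩ := v
  simp only [ne_eq, Prod.mk.injEq, Adj] at *
  rcases hp with ⟨rfl, rfl | rfl⟩ | ⟨rfl, rfl | rfl⟩ <;>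
  rcases ha with ⟨rfl, rfl | rfl⟩ | ⟨rfl, rfl | rfl⟩ <;>
  simp only [phi, psi, true_and, and_true, true_or, or_true] <;>
  split_ifs <;> first | rfl | (exfalso; omega)

theorem Wk.inv {o K g v} (h : Wk o K g v) {p p' : ℤ × ℤ} (hp : Adj p p') (h1 : p ∉ K) (h2 : p' ∉ K) :
    g p + g p' = psi p p' o + psi p p' v := by
  induction h with
  | nil h => simp [zz]
  | @cons g u v hw ha hv ih =>
    have hu := hw.mem
    have := phi_psi hp ha (by rintro rfl; exact h1 hu) (by rintro rfl; exact h2 hu)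
      (by rintro rfl; exact h1 hv) (by rintro rfl; exact h2 hv)
    calc g p + phi p u v + (g p' + phi p' u v) = (g p + g p') + (phi p u v + phi p' u v) := by ring
      _ = psi p p' o + (psi p p' u + psi p p' u) + psi p p' v := by rw [ih, this]; ring
      _ = _ := by rw [zz]; ring

/-- the winding parity of the closed walk through `u v` -/
noncomputable def val (g : ℤ × ℤ → ℤ × ℤ → ZMod 2) (p u v : ℤ × ℤ) : ZMod 2 :=
  g u p + phi p u v + g v p

theorem val_inv {o : ℤ × ℤ} {Ku Kv : Set (ℤ × ℤ)} {g : ℤ × ℤ → ℤ × ℤ → ZMod 2} {u v : ℤ × ℤ}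
    (hu : Wk o Ku (g u) u) (hv : Wk o Kv (g v) v) (ha : Adj u v) {p p' : ℤ × ℤ} (hp : Adj p p')
    (h1 : p ∉ Ku) (h2 : p' ∉ Ku) (h3 : p ∉ Kv) (h4 : p' ∉ Kv) : val g p u v = val g p' u v := by
  have e1 := hu.inv hp h1 h2
  have e2 := hv.inv hp h3 h4
  have e3 := phi_psi hp ha (by rintro rfl; exact h1 hu.mem) (by rintro rfl; exact h2 hu.mem)
      (by rintro rfl; exact h3 hv.mem) (by rintro rfl; exact h4 hv.mem)
  unfold val
  generalize g u p = a1 at *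
  generalize g u p' = a2 at *
  generalize g v p = a3 at *
  generalize g v p' = a4 at *
  generalize phi p u v = a5 at *
  generalize phi p' u v = a6 at *
  generalize psi p p' u = a7 at *
  generalize psi p p' v = a8 at *
  generalize psi p p' o = a9 at *
  revert a1 a2 a3 a4 a5 a6 a7 a8 a9
  decide

theorem sum_grid (h v : ℕ → ℕ → ZMod 2) (m n : ℕ)
    (H : ∀ i < m, ∀ j < n, h i j + v (i + 1) j + h i (j + 1) + v i j = 0) :
    (∑ i ∈ Finset.range m, (h i 0 + h i n)) + ∑ j ∈ Finset.range n, (v 0 j + v m j) = 0 := by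
  induction n with
  | zero => simp [zz]
  | succ n ih =>
    have ih' := ih (fun i hi j hj => H i hi j (by omega))
    have row : ∀ m' ≤ m, (∑ i ∈ Finset.range m', (h i n + h i (n + 1))) + (v 0 n + v m' n) = 0 := by
      intro m' hm'
      induction m' with
      | zero => simp [zz]
      | succ m' ihm =>
        have a := ihm (by omega)
        have b := H m' (by omega) n (by omega)
        rw [Finset.sum_range_succ]
        clear ihm
        generalize (∑ i ∈ Finset.range m', (h i n + h i (n + 1))) = s at *
        generalize h m' n = a1 at *
        generalize h m' (n+1) = a2 at *
        generalize v 0 n = a3 at *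
        generalize v m' n = a4 at *
        generalize v (m'+1) n = a5 at *
        revert s a1 a2 a3 a4 a5
        decide
    have r := row m le_rfl
    clear row ih
    rw [Finset.sum_range_succ]
    rw [Finset.sum_add_distrib] at *
    generalize (∑ i ∈ Finset.range m, h i 0) = a1 at *
    generalize (∑ i ∈ Finset.range m, h i n) = a2 at *
    generalize (∑ i ∈ Finset.range m, h i (n+1)) = a3 at *
    generalize (∑ j ∈ Finset.range n, (v 0 j + v m j)) = a4 at *
    generalize v 0 n = a5 at *
    generalize v m n = a6 at *
    revert a1 a2 a3 a4 a5 a6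
    decide

/-- lattice point with offset -/
def pt (c : ℤ) (i j : ℕ) : ℤ × ℤ := (c + i, c + j)

theorem face_sum (g : ℤ × ℤ → ℤ × ℤ → ZMod 2) (c : ℤ) (i j : ℕ) (p : ℤ × ℤ) (hp : p ≠ pt c i j) :
    val g p (pt c i j) (pt c (i+1) j) + val g p (pt c (i+1) j) (pt c (i+1) (j+1))
      + val g p (pt c i (j+1)) (pt c (i+1) (j+1)) + val g p (pt c i j) (pt c i (j+1)) = 0 := by
  have : phi p (pt c i j) (pt c (i+1) j) + phi p (pt c (i+1) j) (pt c (i+1) (j+1))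
      + phi p (pt c i (j+1)) (pt c (i+1) (j+1)) + phi p (pt c i j) (pt c i (j+1)) = 0 := by
    obtain ⟨a, b⟩ := p
    simp only [ne_eq, Prod.mk.injEq, phi, pt, true_and, and_true] at *
    push_cast
    by_cases q : b = c + j
    · subst q
      rcases lt_trichotomy a (c + i) with h | h | h
      · rw [if_neg (by omega), if_pos (by simp; omega), if_neg (by omega), if_pos (by simp; omega)]; rfl
      · exact absurd ⟨h, rfl⟩ hp
      · rw [if_neg (by omega), if_neg (by omega), if_neg (by omega), if_neg (by omega)]; rfl
    · rw [if_neg (by omega), if_neg (by omega), if_neg (by omega), if_neg (by omega)]; rfl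
  unfold val
  generalize phi p (pt c i j) (pt c (i+1) j) = a1 at *
  generalize phi p (pt c (i+1) j) (pt c (i+1) (j+1)) = a2 at *
  generalize phi p (pt c i (j+1)) (pt c (i+1) (j+1)) = a3 at *
  generalize phi p (pt c i j) (pt c i (j+1)) = a4 at *
  generalize g (pt c i j) p = a5 at *
  generalize g (pt c (i+1) j) p = a6 at *
  generalize g (pt c i (j+1)) p = a7 at *
  generalize g (pt c (i+1) (j+1)) p = a8 at *
  revert a1 a2 a3 a4 a5 a6 a7 a8
  decide

theorem adj_h (c : ℤ) (i j : ℕ) : Adj (pt c i j) (pt c (i+1) j) := by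
  simp [Adj, pt]; try omega
theorem adj_v (c : ℤ) (i j : ℕ) : Adj (pt c i j) (pt c i (j+1)) := by
  simp [Adj, pt]; try omega

theorem perim (g : ℤ × ℤ → ℤ × ℤ → ZMod 2) (c : ℤ) (n : ℕ) (p : ℤ × ℤ)
    (h1 : c ≤ p.1) (h2 : p.1 < c + n) (h3 : c ≤ p.2) (h4 : p.2 < c + n) :
    (∑ i ∈ Finset.range n, (val g p (pt c i 0) (pt c (i+1) 0) + val g p (pt c i n) (pt c (i+1) n))) +
    ∑ j ∈ Finset.range n, (val g p (pt c 0 j) (pt c 0 (j+1)) + val g p (pt c n j) (pt c n (j+1))) = 1 := by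
  have tel : ∀ (q : ℕ → ZMod 2) (m : ℕ), ∑ i ∈ Finset.range m, (q i + q (i+1)) = q 0 + q m := by
    intro q m
    induction m with
    | zero => simp [zz]
    | succ m ih =>
      rw [Finset.sum_range_succ, ih]
      generalize q 0 = a; generalize q m = b; generalize q (m+1) = d
      revert a b d; decide
  have hh : ∀ i j, phi p (pt c i j) (pt c (i+1) j) = 0 := by
    intro i j
    simp only [phi, pt]; push_cast
    rw [if_neg]; omega
  have hl : ∀ j, phi p (pt c 0 j) (pt c 0 (j+1)) = 0 := by
    intro j
    simp only [phi, pt]; push_cast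
    rw [if_neg]; omega
  have hr : ∑ j ∈ Finset.range n, phi p (pt c n j) (pt c n (j+1)) = 1 := by
    rw [Finset.sum_eq_single (p.2 - c).toNat]
    · simp only [phi, pt]; push_cast
      rw [if_pos]; refine ⟨trivial, by omega, by omega⟩
    · intro b _ hb
      simp only [phi, pt]; push_cast
      rw [if_neg]; omega
    · intro h; simp only [Finset.mem_range] at h; omega
  have e1 : ∀ j, ∑ i ∈ Finset.range n, val g p (pt c i j) (pt c (i+1) j) = g (pt c 0 j) p + g (pt c n j) p := by
    intro j
    rw [← tel (fun i => g (pt c i j) p)]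
    apply Finset.sum_congr rfl
    intro i _
    simp [val, hh]
  have e2 : ∀ i, ∑ j ∈ Finset.range n, val g p (pt c i j) (pt c i (j+1))
      = g (pt c i 0) p + g (pt c i n) p + ∑ j ∈ Finset.range n, phi p (pt c i j) (pt c i (j+1)) := by
    intro i
    rw [← tel (fun j => g (pt c i j) p), ← Finset.sum_add_distrib]
    apply Finset.sum_congr rfl
    intro j _
    simp only [val]; ring
  rw [Finset.sum_add_distrib, Finset.sum_add_distrib, e1, e1, e2, e2, hr]
  simp only [hl, Finset.sum_const_zero]
  generalize g (pt c 0 0) p = a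
  generalize g (pt c n 0) p = b
  generalize g (pt c 0 n) p = d
  generalize g (pt c n n) p = e
  revert a b d e; decide

/-- The topological lemma. -/
theorem topo (o : ℤ × ℤ) (c : ℤ) (n : ℕ) (K : ℤ × ℤ → Set (ℤ × ℤ))
    (g : ℤ × ℤ → ℤ × ℤ → ZMod 2)
    (hw : ∀ i ≤ n, ∀ j ≤ n, Wk o (K (pt c i j)) (g (pt c i j)) (pt c i j))
    (pe : ℤ × ℤ → ℤ × ℤ → ℤ × ℤ) (pf : ℕ → ℕ → ℤ × ℤ) (pinf : ℤ × ℤ)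
    (h1 : c ≤ pinf.1) (h2 : pinf.1 < c + n) (h3 : c ≤ pinf.2) (h4 : pinf.2 < c + n)
    (hb : ∀ i < n, pe (pt c i 0) (pt c (i+1) 0) = pinf)
    (ht : ∀ i < n, pe (pt c i n) (pt c (i+1) n) = pinf)
    (hl : ∀ j < n, pe (pt c 0 j) (pt c 0 (j+1)) = pinf)
    (hr : ∀ j < n, pe (pt c n j) (pt c n (j+1)) = pinf)
    (hpf : ∀ i < n, ∀ j < n, pf i j ≠ pt c i j)
    (link : ∀ i < n, ∀ j < n, ∀ u v, (u = pt c i j ∧ v = pt c (i+1) j ∨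
        u = pt c (i+1) j ∧ v = pt c (i+1) (j+1) ∨ u = pt c i (j+1) ∧ v = pt c (i+1) (j+1) ∨
        u = pt c i j ∧ v = pt c i (j+1)) → ∃ A : Set (ℤ × ℤ), Conn Adj A ∧ Disjoint A (K u) ∧
          Disjoint A (K v) ∧ pf i j ∈ A ∧ pe u v ∈ A) : False := by
  have key : ∀ i < n, ∀ j < n, ∀ u v, (u = pt c i j ∧ v = pt c (i+1) j ∨
        u = pt c (i+1) j ∧ v = pt c (i+1) (j+1) ∨ u = pt c i (j+1) ∧ v = pt c (i+1) (j+1) ∨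
        u = pt c i j ∧ v = pt c i (j+1)) → val g (pe u v) u v = val g (pf i j) u v := by
    intro i hi j hj u v huv
    obtain ⟨A, hA, d1, d2, m1, m2⟩ := link i hi j hj u v huv
    have hall : Adj u v ∧ Wk o (K u) (g u) u ∧ Wk o (K v) (g v) v := by
      rcases huv with ⟨rfl, rfl⟩ | ⟨rfl, rfl⟩ | ⟨rfl, rfl⟩ | ⟨rfl, rfl⟩
      · exact ⟨adj_h _ _ _, hw _ (by omega) _ (by omega), hw _ (by omega) _ (by omega)⟩
      · exact ⟨adj_v _ _ _, hw _ (by omega) _ (by omega), hw _ (by omega) _ (by omega)⟩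
      · exact ⟨adj_h _ _ _, hw _ (by omega) _ (by omega), hw _ (by omega) _ (by omega)⟩
      · exact ⟨adj_v _ _ _, hw _ (by omega) _ (by omega), hw _ (by omega) _ (by omega)⟩
    obtain ⟨ha, w1, w2⟩ := hall
    rw [Set.disjoint_left] at d1 d2
    refine hA (fun x => val g x u v = val g (pf i j) u v) ⟨_, m1, rfl⟩ ?_ _ m2
    intro a haA b hbA hab h
    rw [← h]
    exact (val_inv w1 w2 ha hab (d1 haA) (d1 hbA) (d2 haA) (d2 hbA)).symm
  have s := sum_grid (fun i j => val g (pe (pt c i j) (pt c (i+1) j)) (pt c i j) (pt c (i+1) j))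
    (fun i j => val g (pe (pt c i j) (pt c i (j+1))) (pt c i j) (pt c i (j+1))) n n (by
      intro i hi j hj
      have := face_sum g c i j (pf i j) (hpf i hi j hj)
      rw [← key i hi j hj _ _ (Or.inl ⟨rfl, rfl⟩), ← key i hi j hj _ _ (Or.inr (Or.inl ⟨rfl, rfl⟩)),
        ← key i hi j hj _ _ (Or.inr (Or.inr (Or.inl ⟨rfl, rfl⟩))),
        ← key i hi j hj _ _ (Or.inr (Or.inr (Or.inr ⟨rfl, rfl⟩)))] at this
      exact this)
  have q := perim g c n pinf h1 h2 h3 h4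
  have : (0 : ZMod 2) = 1 := by
    rw [← s, ← q]
    congr 1
    · apply Finset.sum_congr rfl
      intro i hi
      rw [Finset.mem_range] at hi
      simp only [hb i hi, ht i hi]
    · apply Finset.sum_congr rfl
      intro i hi
      rw [Finset.mem_range] at hi
      simp only [hl i hi, hr i hi]
  exact absurd this (by decide)

end BW
namespace BW

section bramble

variable {S : Type*}

/-- weighted reachability from `r` avoiding `X` -/
inductive Reach (T : S → S → Prop) (w : S → ℕ) (X : Finset S) (r : S) : ℕ → S → Prop
  | root : Reach T w X r (w r) r
  | step {n s t} : Reach T w X r n s → T s t → t ∉ X → Reach T w X r (n + w t) t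

/-- weighted distance -/
noncomputable def dist (T : S → S → Prop) (w : S → ℕ) (X : Finset S) (r s : S) : ℕ :=
  sInf {n | Reach T w X r n s}

variable {T : S → S → Prop} {w : S → ℕ} {X : Finset S} {r : S}

theorem dist_spec {s : S} (h : ∃ n, Reach T w X r n s) : Reach T w X r (dist T w X r s) s :=
  Nat.sInf_mem (s := {n | Reach T w X r n s}) h

theorem dist_le {s : S} {n : ℕ} (h : Reach T w X r n s) : dist T w X r s ≤ n :=
  Nat.sInf_le (s := {n | Reach T w X r n s}) h

theorem dist_step {s t : S} (h : ∃ n, Reach T w X r n s) (hT : T s t) (ht : t ∉ X) :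
    dist T w X r t ≤ dist T w X r s + w t :=
  dist_le (.step (dist_spec h) hT ht)

theorem le_dist {s : S} (h : ∃ n, Reach T w X r n s) : w s ≤ dist T w X r s := by
  have h1 := dist_spec h
  generalize dist T w X r s = n at h1
  cases h1 with
  | root => exact le_rfl
  | step _ _ _ => omega

theorem dist_parent {s : S} (h : ∃ n, Reach T w X r n s) :
    (s = r ∧ dist T w X r s = w s) ∨ ∃ p, (∃ n, Reach T w X r n p) ∧ T p s ∧
      dist T w X r s = dist T w X r p + w s := by
  have h1 := dist_spec h
  generalize hn : dist T w X r s = n at h1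
  cases h1 with
  | root => left; exact ⟨rfl, rfl⟩
  | @step m p _ hp hT hs =>
    right
    refine ⟨p, ⟨m, hp⟩, hT, ?_⟩
    have a := dist_le hp
    have b := dist_step ⟨m, hp⟩ hT hs
    omega

theorem no_bramble [Fintype S] [DecidableEq S] (R : S → Set (ℤ × ℤ)) (c : ℤ) (nn : ℕ)
    (hbd : ∀ s, ∀ p ∈ R s, c < p.1 ∧ p.1 < c + nn ∧ c < p.2 ∧ p.2 < c + nn)
    (hne : ∀ s, (R s).Nonempty) (hconn : ∀ s, Conn Adj (R s))
    (T : S → S → Prop) (hT : ∀ s t, T s t ↔ (R s ∩ R t).Nonempty)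
    (nb : S → Finset S) (hnb : ∀ s t, t ∈ nb s ↔ T s t)
    (k : ℕ) (hk : 1 ≤ k) (hW : ∑ s, (nb s).card ≤ k * k)
    (β : Finset S → Set S) (hβ : ∀ X : Finset S, X.card ≤ 11 * k →
      (β X).Nonempty ∧ Conn T (β X) ∧ ∀ s ∈ β X, s ∉ X)
    (touch : ∀ X Y : Finset S, X.card ≤ 11 * k → Y.card ≤ 11 * k → ∃ s ∈ β X, ∃ t ∈ β Y, T s t) :
    False := by
  classical
  have Tsymm : ∀ s t, T s t → T t s := by
    intro s t h
    rw [hT] at *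
    rwa [Set.inter_comm]
  have Trefl : ∀ s, T s s := by
    intro s; rw [hT]; simpa using hne s
  set w : S → ℕ := fun s => (nb s).card with hw
  have wpos : ∀ s, 1 ≤ w s := by
    intro s
    exact Finset.card_pos.2 ⟨s, (hnb _ _).2 (Trefl s)⟩
  -- big strings
  set XB : Finset S := Finset.univ.filter (fun s => k < w s) with hXB
  have hXBc : XB.card ≤ k := by
    by_contra hcon
    have h1 : ∑ s ∈ XB, k ≤ ∑ s ∈ XB, w s := Finset.sum_le_sum (by
      intro s hs; simp only [hXB, Finset.mem_filter] at hs; omega)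
    have h2 : ∑ s ∈ XB, w s ≤ ∑ s, w s := Finset.sum_le_sum_of_subset (Finset.subset_univ _)
    simp only [Finset.sum_const, smul_eq_mul] at h1
    have : (k + 1) * k ≤ XB.card * k := Nat.mul_le_mul_right _ (by omega)
    have h3 : ∑ s, w s ≤ k * k := hW
    nlinarith
  obtain ⟨⟨r, hr⟩, cB, aB⟩ := hβ XB (by omega)
  set d := dist T w XB r with hd
  set S1 : Set S := {s | ∃ n, Reach T w XB r n s} with hS1
  have step1 : ∀ s ∈ S1, ∀ t, T s t → t ∉ XB → t ∈ S1 := by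
    rintro s ⟨n, hn⟩ t hst ht
    exact ⟨_, .step hn hst ht⟩
  have rS1 : r ∈ S1 := ⟨_, .root⟩
  have S1X : ∀ s ∈ S1, s ∉ XB := by
    rintro s ⟨n, hn⟩
    cases hn with
    | root => exact aB r hr
    | step _ _ h => exact h
  have wk : ∀ s ∈ S1, w s ≤ k := by
    intro s hs
    have := S1X s hs
    simp only [hXB, Finset.mem_filter, Finset.mem_univ, true_and] at this
    omega
  have dstep : ∀ s ∈ S1, ∀ t, T s t → t ∈ S1 → d t ≤ d s + w t := by
    intro s hs t hst ht
    exact dist_step hs hst (S1X t ht)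
  have BS1 : ∀ s ∈ β XB, s ∈ S1 :=
    cB _ ⟨r, hr, rS1⟩ (fun a _ b hb hab ha => step1 a ha b hab (aB b hb))
  have absorb : ∀ Y : Finset S, Y.card ≤ 11 * k → XB ⊆ Y → ∀ s ∈ β Y, s ∈ S1 := by
    intro Y hY hXY
    obtain ⟨_, cY, aY⟩ := hβ Y hY
    obtain ⟨s, hs, t, ht, hst⟩ := touch XB Y (by omega) hY
    exact cY _ ⟨t, ht, step1 s (BS1 s hs) t hst (fun h => aY t ht (hXY h))⟩
      (fun a _ b hb hab ha => step1 a ha b hab (fun h => aY b hb (hXY h)))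
  -- levels
  set L : ℕ → Finset S := fun j => Finset.univ.filter (fun s => s ∈ S1 ∧ j ≤ d s ∧ d s < j + w s) with hL
  have memL : ∀ j s, s ∈ L j ↔ s ∈ S1 ∧ j ≤ d s ∧ d s < j + w s := by
    intro j s; simp [hL]
  have Lsum : ∀ j, ∑ i ∈ Finset.range k, (L (j + 1 + i)).card ≤ k * k := by
    intro j
    refine le_trans ?_ hW
    simp only [Finset.card_eq_sum_ones, hL, Finset.sum_filter]
    rw [Finset.sum_comm]
    apply Finset.sum_le_sum
    intro s _
    rw [← Finset.sum_filter, ← Finset.card_eq_sum_ones]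
    have : (Finset.range k |>.filter (fun i => s ∈ S1 ∧ j + 1 + i ≤ d s ∧ d s < j + 1 + i + w s)).card
        ≤ (Finset.Ioc (d s - w s) (d s)).card := by
      apply Finset.card_le_card_of_injOn (fun i => j + 1 + i)
      · intro i hi
        simp only [Finset.coe_filter, Set.mem_ofPred_eq] at hi
        simp only [Finset.coe_Ioc, Set.mem_Ioc]
        omega
      · intro a _ b _ h
        simp only at h; omega
    refine this.trans ?_
    simp only [Nat.card_Ioc]
    show _ ≤ w s
    omega
  have goodex : ∀ j, ∃ i, j < i ∧ i ≤ j + k ∧ (L i).card ≤ k := by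
    intro j
    by_contra hcon
    push Not at hcon
    have := Lsum j
    have h2 : ∑ i ∈ Finset.range k, (k + 1) ≤ ∑ i ∈ Finset.range k, (L (j + 1 + i)).card := by
      apply Finset.sum_le_sum
      intro i hi
      rw [Finset.mem_range] at hi
      exact hcon (j + 1 + i) (by omega) (by omega)
    simp only [Finset.sum_const, Finset.card_range, smul_eq_mul] at h2
    nlinarith
  -- sides of a level
  have sides : ∀ j, ∀ A : Set S, Conn T A → (∀ s ∈ A, s ∈ S1 ∧ s ∉ L j) →
      ((∃ s ∈ A, d s < j) → ∀ s ∈ A, d s < j) := by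
    intro j A hA hA1 hex
    refine hA _ hex ?_
    intro a ha b hb hab h
    have h1 := dstep a (hA1 a ha).1 b hab (hA1 b hb).1
    have h2 := (hA1 b hb).2
    rw [memL] at h2
    by_contra hcon
    exact h2 ⟨(hA1 b hb).1, by omega, by omega⟩
  have XLc : ∀ j, (L j).card ≤ k → (XB ∪ L j).card ≤ 11 * k := by
    intro j hj
    have := Finset.card_union_le XB (L j)
    omega
  let Out : ℕ → Prop := fun j => (L j).card ≤ k ∧ ∀ s ∈ β (XB ∪ L j), j ≤ d s
  have out0 : Out 0 := by
    refine ⟨?_, fun s _ => Nat.zero_le _⟩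
    have : L 0 = ∅ := by
      rw [Finset.eq_empty_iff_forall_notMem]
      intro s hs
      rw [memL] at hs
      have : w s ≤ d s := le_dist hs.1
      have := hs.2.2
      omega
    rw [this]; simp
  obtain ⟨J, hJ⟩ : ∃ J, ∀ s, d s < J := by
    refine ⟨∑ s, d s + 1, fun s => ?_⟩
    have := Finset.single_le_sum (f := d) (fun i _ => Nat.zero_le _) (Finset.mem_univ s)
    omega
  have outJ : ∀ j, Out j → j ≤ J := by
    intro j hj
    obtain ⟨⟨s, hs⟩, _, _⟩ := hβ _ (XLc j hj.1)
    have := hj.2 s hs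
    have := hJ s
    omega
  set j1 := Nat.findGreatest Out J with hj1
  have out1 : Out j1 := Nat.findGreatest_spec (P := Out) (Nat.zero_le J) out0
  obtain ⟨j2, hj12, hj2k, hLj2⟩ := goodex j1
  have nout2 : ¬ Out j2 := by
    intro h
    have := Nat.le_findGreatest (P := Out) (outJ _ h) h
    omega
  have in2 : ∀ s ∈ β (XB ∪ L j2), d s < j2 := by
    have : ∃ s ∈ β (XB ∪ L j2), d s < j2 := by
      by_contra hcon
      push Not at hcon
      exact nout2 ⟨hLj2, hcon⟩
    obtain ⟨_, cY, aY⟩ := hβ _ (XLc j2 hLj2)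
    refine sides j2 _ cY (fun s hs => ⟨absorb _ (XLc j2 hLj2) Finset.subset_union_left s hs, ?_⟩) this
    intro h
    exact aY s hs (Finset.mem_union_right _ h)
  have mid : ∀ Y : Finset S, Y.card ≤ 11 * k → XB ∪ L j1 ∪ L j2 ⊆ Y →
      ∀ s ∈ β Y, s ∈ S1 ∧ j1 + w s ≤ d s ∧ d s < j2 := by
    intro Y hY hsub
    have s1 := absorb Y hY (fun x hx => hsub (by simp [hx]))
    obtain ⟨_, cY, aY⟩ := hβ Y hY
    have n1 : ∀ s ∈ β Y, s ∉ L j1 := fun s hs h => aY s hs (hsub (by simp [h]))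
    have n2 : ∀ s ∈ β Y, s ∉ L j2 := fun s hs h => aY s hs (hsub (by simp [h]))
    have i1 : ∀ s ∈ β Y, j1 ≤ d s := by
      by_contra hcon
      push Not at hcon
      have hall := sides j1 _ cY (fun s hs => ⟨s1 s hs, n1 s hs⟩) hcon
      obtain ⟨a, ha, b, hb, hab⟩ := touch Y (XB ∪ L j1) hY (XLc j1 out1.1)
      have hb1 := absorb _ (XLc j1 out1.1) Finset.subset_union_left b hb
      have h1 := dstep a (s1 a ha) b hab hb1
      have h2 := out1.2 b hb
      have h3 := hall a ha
      refine (hβ _ (XLc j1 out1.1)).2.2 b hb (Finset.mem_union_right _ ?_)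
      rw [memL]
      exact ⟨hb1, by omega, by omega⟩
    have i2 : ∀ s ∈ β Y, d s < j2 := by
      apply sides j2 _ cY (fun s hs => ⟨s1 s hs, n2 s hs⟩)
      obtain ⟨a, ha, b, hb, hab⟩ := touch (XB ∪ L j2) Y (XLc j2 hLj2) hY
      have ha1 := absorb _ (XLc j2 hLj2) Finset.subset_union_left a ha
      refine ⟨b, hb, ?_⟩
      have h1 := dstep a ha1 b hab (s1 b hb)
      have h2 := in2 a ha
      by_contra hcon
      refine n2 b hb ?_
      rw [memL]
      exact ⟨s1 b hb, by omega, by omega⟩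
    intro s hs
    refine ⟨s1 s hs, ?_, i2 s hs⟩
    have := n1 s hs
    rw [memL] at this
    by_contra hcon
    exact this ⟨s1 s hs, i1 s hs, by omega⟩
  -- free cells
  let K : Finset S → Set (ℤ × ℤ) := fun N =>
    {x | ∀ t, x ∈ R t → t ∈ S1 → d t < j2 → t ∈ N ∨ d t < j1 + w t}
  have Kmono : ∀ N N' : Finset S, N ⊆ N' → K N ⊆ K N' := by
    intro N N' h x hx t h1 h2 h3
    rcases hx t h1 h2 h3 with h4 | h4
    · exact Or.inl (h h4)
    · exact Or.inr h4
  obtain ⟨o, ho⟩ := hne r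
  have RK0 : ∀ s ∈ S1, ∀ N, d s < j1 → R s ⊆ K N := by
    intro s hs N hds x hx t h1 h2 h3
    right
    have := dstep s hs t ((hT _ _).2 ⟨x, hx, h1⟩) h2
    omega
  have RK1 : ∀ s, ∀ N, nb s ⊆ N → R s ⊆ K N := by
    intro s N hN x hx t h1 h2 h3
    left
    exact hN ((hnb _ _).2 ((hT _ _).2 ⟨x, hx, h1⟩))
  have extend : ∀ s N, R s ⊆ K N → (∃ x ∈ R s, ∃ g, Wk o (K N) g x) →
      ∀ x ∈ R s, ∃ g, Wk o (K N) g x := by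
    intro s N hs hex
    refine hconn s _ hex ?_
    rintro a _ b hb hab ⟨g, hg⟩
    exact ⟨_, .cons hg hab (hs hb)⟩
  have claim1 : ∀ D, ∀ s ∈ S1, d s = D → ∃ N : Finset S,
      ((d s < j1 ∧ N = ∅) ∨ (j1 ≤ d s ∧ N.card + j1 ≤ d s + k)) ∧
      ∀ x ∈ R s, ∃ g, Wk o (K N) g x := by
    intro D
    induction D using Nat.strong_induction_on with
    | _ D ih =>
      intro s hs hsD
      rcases dist_parent hs with ⟨rfl, hds⟩ | ⟨p, hp, hps, hds⟩
      · by_cases hlt : d s < j1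
        · refine ⟨∅, Or.inl ⟨hlt, rfl⟩, extend s _ (RK0 s hs _ hlt) ⟨o, ho, _, .nil (RK0 s hs _ hlt ho)⟩⟩
        · refine ⟨nb s, Or.inr ⟨by omega, ?_⟩, extend s _ (RK1 s _ subset_rfl) ⟨o, ho, _, .nil (RK1 s _ subset_rfl ho)⟩⟩
          have := wk s hs
          show w s + j1 ≤ _
          omega
      · have hds' : d s = d p + w s := hds
        have := wpos s
        obtain ⟨Np, hNp, hwp⟩ := ih (d p) (by omega) p hp rfl
        obtain ⟨x, hxp, hxs⟩ := (hT _ _).1 hps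
        obtain ⟨g, hg⟩ := hwp x hxp
        by_cases hlt : d s < j1
        · rcases hNp with ⟨h1, rfl⟩ | ⟨h1, h2⟩
          · exact ⟨∅, Or.inl ⟨hlt, rfl⟩, extend s _ (RK0 s hs _ hlt) ⟨x, hxs, g, hg⟩⟩
          · omega
        · refine ⟨Np ∪ nb s, Or.inr ⟨by omega, ?_⟩, extend s _ (RK1 s _ Finset.subset_union_right)
            ⟨x, hxs, g, hg.mono (Kmono _ _ Finset.subset_union_left)⟩⟩
          have h5 := Finset.card_union_le Np (nb s)
          have h6 : (nb s).card = w s := rfl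
          have h7 := wk s hs
          rcases hNp with ⟨h1, rfl⟩ | ⟨h1, h2⟩
          · simp only [Finset.card_empty] at h5
            omega
          · omega
  have claim2 : ∀ s ∈ S1, d s < j2 → ∃ N : Finset S, N.card ≤ 2 * k ∧
      ∀ x ∈ R s, ∃ g, Wk o (K N) g x := by
    intro s hs hds
    obtain ⟨N, hN, h⟩ := claim1 _ s hs rfl
    refine ⟨N, ?_, h⟩
    rcases hN with ⟨_, rfl⟩ | ⟨h1, h2⟩
    · simp
    · omega
  let Good : Finset S → ℤ × ℤ → Prop := fun N v => ∃ g, Wk o (K N) g v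
  have spread : ∀ u v, Adj u v → (∃ N : Finset S, N.card ≤ 2 * k ∧ Good N u) →
      (∃ N : Finset S, N.card ≤ 2 * k ∧ Good N v) := by
    rintro u v huv ⟨N, hN, g, hg⟩
    by_cases hv : ∃ s ∈ S1, d s < j2 ∧ v ∈ R s
    · obtain ⟨s, hs, h1, h2⟩ := hv
      obtain ⟨N', hN', h⟩ := claim2 s hs h1
      exact ⟨N', hN', h v h2⟩
    · push Not at hv
      refine ⟨N, hN, _, .cons hg huv ?_⟩
      intro t h1 h2 h3
      exact absurd h1 (hv t h2 h3)
  have spreadN : ∀ N u v, Adj u v → (∀ s, v ∉ R s) → Good N u → Good N v := by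
    rintro N u v huv hv ⟨g, hg⟩
    exact ⟨_, .cons hg huv (fun t h1 _ _ => absurd h1 (hv t))⟩
  have good_o : ∃ N : Finset S, N.card ≤ 2 * k ∧ Good N o := by
    obtain ⟨N, hN, h⟩ := claim1 _ r rS1 rfl
    have hdr : d r ≤ w r := dist_le .root
    refine ⟨N, ?_, h o ho⟩
    have := wk r rS1
    rcases hN with ⟨_, rfl⟩ | ⟨h1, h2⟩
    · simp
    · omega
  have good_all : ∀ v, ∃ N : Finset S, N.card ≤ 2 * k ∧ Good N v := by
    have hx : ∀ m : ℕ, ∀ a b : ℤ, (a - o.1).natAbs + (b - o.2).natAbs = m →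
        ∃ N : Finset S, N.card ≤ 2 * k ∧ Good N (a, b) := by
      intro m
      induction m with
      | zero =>
        intro a b h
        have : (a, b) = o := by ext <;> simp <;> omega
        rw [this]; exact good_o
      | succ m ih =>
        intro a b h
        rcases lt_trichotomy a o.1 with h1 | h1 | h1
        · exact spread (a+1, b) _ (by simp [Adj]) (ih _ _ (by omega))
        · rcases lt_trichotomy b o.2 with h2 | h2 | h2
          · exact spread (a, b+1) _ (by simp [Adj]) (ih _ _ (by omega))
          · omega
          · exact spread (a, b-1) _ (by simp [Adj]) (ih _ _ (by omega))
        · exact spread (a-1, b) _ (by simp [Adj]) (ih _ _ (by omega))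
    intro v
    exact hx _ v.1 v.2 rfl
  -- perimeter
  obtain ⟨Nc, hNc, gc⟩ := good_all (pt c 0 0)
  have bot : ∀ i, Good Nc (pt c i 0) := by
    intro i
    induction i with
    | zero => exact gc
    | succ i ih => exact spreadN _ _ _ (adj_h c i 0) (fun s hs => by have := hbd s _ hs; simp [pt] at this) ih
  have lef : ∀ i, Good Nc (pt c 0 i) := by
    intro i
    induction i with
    | zero => exact gc
    | succ i ih => exact spreadN _ _ _ (adj_v c 0 i) (fun s hs => by have := hbd s _ hs; simp [pt] at this) ih
  have top : ∀ i, Good Nc (pt c i nn) := by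
    intro i
    induction i with
    | zero => exact lef nn
    | succ i ih => exact spreadN _ _ _ (adj_h c i nn) (fun s hs => by have := hbd s _ hs; simp [pt] at this) ih
  have rig : ∀ i, Good Nc (pt c nn i) := by
    intro i
    induction i with
    | zero => exact bot nn
    | succ i ih => exact spreadN _ _ _ (adj_v c nn i) (fun s hs => by have := hbd s _ hs; simp [pt] at this) ih
  let per : ℤ × ℤ → Prop := fun v => v.1 = c ∨ v.1 = c + nn ∨ v.2 = c ∨ v.2 = c + nn
  have choice : ∀ v : ℤ × ℤ, ∃ (N : Finset S) (g : ℤ × ℤ → ZMod 2), N.card ≤ 2 * k ∧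
      (∀ i j : ℕ, v = pt c i j → per v → N = Nc) ∧ Wk o (K N) g v := by
    intro v
    by_cases h : per v ∧ ∃ i j : ℕ, v = pt c i j
    · obtain ⟨h1, i, j, rfl⟩ := h
      have : Good Nc (pt c i j) := by
        rcases h1 with h1 | h1 | h1 | h1 <;> simp only [pt] at h1
        · have : i = 0 := by omega
          subst this; exact lef _
        · have : i = nn := by omega
          subst this; exact rig _
        · have : j = 0 := by omega
          subst this; exact bot _
        · have : j = nn := by omega
          subst this; exact top _
      obtain ⟨g, hg⟩ := this
      exact ⟨Nc, g, hNc, fun _ _ _ _ => rfl, hg⟩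
    · obtain ⟨N, hN, g, hg⟩ := good_all v
      exact ⟨N, g, hN, fun i j h1 h2 => absurd ⟨h2, i, j, h1⟩ h, hg⟩
  choose N g hN hNper hg using choice
  -- points
  let XX : Finset S → Finset S := fun M => XB ∪ L j1 ∪ L j2 ∪ M
  have XXc : ∀ M : Finset S, M.card ≤ 8 * k → (XX M).card ≤ 11 * k := by
    intro M hM
    have a := Finset.card_union_le (XB ∪ L j1 ∪ L j2) M
    have b := Finset.card_union_le (XB ∪ L j1) (L j2)
    have e := Finset.card_union_le XB (L j1)
    have f := out1.1
    show (XB ∪ L j1 ∪ L j2 ∪ M).card ≤ _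
    omega
  have ptx : ∀ M : Finset S, ∃ q : ℤ × ℤ, M.card ≤ 8 * k → ∃ s ∈ β (XX M), q ∈ R s := by
    intro M
    by_cases hM : M.card ≤ 8 * k
    · obtain ⟨⟨s, hs⟩, _, _⟩ := hβ _ (XXc M hM)
      obtain ⟨q, hq⟩ := hne s
      exact ⟨q, fun _ => ⟨s, hs, hq⟩⟩
    · exact ⟨o, fun h => absurd h hM⟩
  choose q hq using ptx
  have avoid : ∀ M : Finset S, M.card ≤ 8 * k → ∀ N' ⊆ M, ∀ s ∈ β (XX M), Disjoint (R s) (K N') := by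
    intro M hM N' hN' s hs
    rw [Set.disjoint_left]
    intro x hx hxK
    obtain ⟨m1, m2, m3⟩ := mid (XX M) (XXc M hM) Finset.subset_union_left s hs
    rcases hxK s hx m1 m3 with h | h
    · exact (hβ _ (XXc M hM)).2.2 s hs (Finset.mem_union_right _ (hN' h))
    · omega
  have linkg : ∀ M M' N1 N2 : Finset S, M.card ≤ 8 * k → M'.card ≤ 8 * k → N1 ⊆ M → N1 ⊆ M' →
      N2 ⊆ M → N2 ⊆ M' → ∃ A : Set (ℤ × ℤ), Conn Adj A ∧ Disjoint A (K N1) ∧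
          Disjoint A (K N2) ∧ q M ∈ A ∧ q M' ∈ A := by
    intro M M' N1 N2 hM hM' h1 h2 h3 h4
    refine ⟨⋃ s ∈ β (XX M) ∪ β (XX M'), R s, ?_, ?_, ?_, ?_, ?_⟩
    · intro P hP hcl
      obtain ⟨x, hx, hPx⟩ := hP
      have inR : ∀ s ∈ β (XX M) ∪ β (XX M'), (∃ a ∈ R s, P a) → ∀ a ∈ R s, P a := by
        intro s hs hex
        refine hconn s P hex ?_
        intro a ha b hb
        exact hcl a (Set.mem_biUnion hs ha) b (Set.mem_biUnion hs hb)
      have tr : ∀ s ∈ β (XX M) ∪ β (XX M'), ∀ t ∈ β (XX M) ∪ β (XX M'), T s t →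
          (∀ a ∈ R s, P a) → (∀ a ∈ R t, P a) := by
        intro s hs t ht hst h
        obtain ⟨y, hy1, hy2⟩ := (hT _ _).1 hst
        exact inR t ht ⟨y, hy2, h y hy1⟩
      have c1 := (hβ _ (XXc M hM)).2.1 (fun s => ∀ a ∈ R s, P a)
      have c2 := (hβ _ (XXc M' hM')).2.1 (fun s => ∀ a ∈ R s, P a)
      obtain ⟨u, hu, v, hv, huv⟩ := touch _ _ (XXc M hM) (XXc M' hM')
      have c1' := fun h => c1 h (fun a ha b hb hab => tr a (Or.inl ha) b (Or.inl hb) hab)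
      have c2' := fun h => c2 h (fun a ha b hb hab => tr a (Or.inr ha) b (Or.inr hb) hab)
      obtain ⟨s, hs, hxs⟩ := Set.mem_iUnion₂.1 hx
      have hPs := inR s hs ⟨x, hxs, hPx⟩
      have both : (∀ s ∈ β (XX M), ∀ a ∈ R s, P a) ∧ (∀ s ∈ β (XX M'), ∀ a ∈ R s, P a) := by
        rcases hs with hs | hs
        · have a1 := c1' ⟨s, hs, hPs⟩
          exact ⟨a1, c2' ⟨v, hv, tr u (Or.inl hu) v (Or.inr hv) huv (a1 u hu)⟩⟩
        · have a1 := c2' ⟨s, hs, hPs⟩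
          exact ⟨c1' ⟨u, hu, tr v (Or.inr hv) u (Or.inl hu) (Tsymm _ _ huv) (a1 v hv)⟩, a1⟩
      intro y hy
      obtain ⟨t, ht, hyt⟩ := Set.mem_iUnion₂.1 hy
      rcases ht with ht | ht
      · exact both.1 t ht y hyt
      · exact both.2 t ht y hyt
    · rw [Set.disjoint_iUnion₂_left]
      rintro s (hs | hs)
      · exact avoid M hM _ h1 s hs
      · exact avoid M' hM' _ h2 s hs
    · rw [Set.disjoint_iUnion₂_left]
      rintro s (hs | hs)
      · exact avoid M hM _ h3 s hs
      · exact avoid M' hM' _ h4 s hs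
    · obtain ⟨s, hs, h⟩ := hq M hM
      exact Set.mem_biUnion (Or.inl hs) h
    · obtain ⟨s, hs, h⟩ := hq M' hM'
      exact Set.mem_biUnion (Or.inr hs) h
  let F : ℕ → ℕ → Finset S := fun i j => (N (pt c i j) ∪ N (pt c (i+1) j)) ∪
    (N (pt c i (j+1)) ∪ N (pt c (i+1) (j+1)))
  have Ec : ∀ u v, (N u ∪ N v).card ≤ 4 * k := by
    intro u v
    have := Finset.card_union_le (N u) (N v)
    have := hN u
    have := hN v
    omega
  have Fc : ∀ i j, (F i j).card ≤ 8 * k := by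
    intro i j
    have a := Finset.card_union_le (N (pt c i j) ∪ N (pt c (i+1) j)) (N (pt c i (j+1)) ∪ N (pt c (i+1) (j+1)))
    have b := Ec (pt c i j) (pt c (i+1) j)
    have e := Ec (pt c i (j+1)) (pt c (i+1) (j+1))
    show Finset.card (_ ∪ _) ≤ _
    omega
  have Fsub : ∀ i j, N (pt c i j) ⊆ F i j ∧ N (pt c (i+1) j) ⊆ F i j ∧ N (pt c i (j+1)) ⊆ F i j ∧
      N (pt c (i+1) (j+1)) ⊆ F i j := by
    intro i j
    refine ⟨?_, ?_, ?_, ?_⟩ <;> intro x hx <;> simp [F, hx]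
  have qinf := hq Nc (by omega)
  obtain ⟨sinf, _, hsinf⟩ := qinf
  have hb := hbd sinf _ hsinf
  refine topo o c nn (fun v => K (N v)) g (fun i _ j _ => hg _) (fun u v => q (N u ∪ N v))
    (fun i j => q (F i j)) (q Nc) (by omega) (by omega) (by omega) (by omega) ?_ ?_ ?_ ?_ ?_ ?_
  · intro i _
    rw [hNper (pt c i 0) _ _ rfl (by simp [per, pt]), hNper (pt c (i+1) 0) _ _ rfl (by simp [per, pt]), Finset.union_self]
  · intro i _
    rw [hNper (pt c i nn) _ _ rfl (by simp [per, pt]), hNper (pt c (i+1) nn) _ _ rfl (by simp [per, pt]), Finset.union_self]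
  · intro i _
    rw [hNper (pt c 0 i) _ _ rfl (by simp [per, pt]), hNper (pt c 0 (i+1)) _ _ rfl (by simp [per, pt]), Finset.union_self]
  · intro i _
    rw [hNper (pt c nn i) _ _ rfl (by simp [per, pt]), hNper (pt c nn (i+1)) _ _ rfl (by simp [per, pt]), Finset.union_self]
  · intro i _ j _ heq
    obtain ⟨s, hs, h⟩ := hq (F i j) (Fc i j)
    have := avoid _ (Fc i j) _ (Fsub i j).1 s hs
    rw [Set.disjoint_left] at this
    refine this h ?_
    rw [heq]
    exact (hg (pt c i j)).mem
  · intro i _ j _ u v huv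
    have hsub : N u ⊆ F i j ∧ N v ⊆ F i j := by
      obtain ⟨f1, f2, f3, f4⟩ := Fsub i j
      rcases huv with ⟨rfl, rfl⟩ | ⟨rfl, rfl⟩ | ⟨rfl, rfl⟩ | ⟨rfl, rfl⟩
      · exact ⟨f1, f2⟩
      · exact ⟨f2, f4⟩
      · exact ⟨f3, f4⟩
      · exact ⟨f1, f3⟩
    have := Ec u v
    exact linkg (F i j) (N u ∪ N v) (N u) (N v) (Fc i j) (by omega) hsub.1 Finset.subset_union_left
      hsub.2 Finset.subset_union_right

end bramble
end BW
namespace BW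

theorem Adj_or {i i' j : ℤ} (h1 : i - i' < 2) (h2 : i' - i < 2) : (i, j) = (i', j) ∨ Adj (i, j) (i', j) := by
  simp only [Adj, Prod.mk.injEq, true_and, and_true]; omega

theorem Adj_or' {i j j' : ℤ} (h1 : j - j' < 2) (h2 : j' - j < 2) : (i, j) = (i, j') ∨ Adj (i, j) (i, j') := by
  simp only [Adj, Prod.mk.injEq, true_and, and_true]; omega

/-- closeness of a point to a lattice cell -/
def near (δ : ℝ) (a : ℝ × ℝ) (z : ℤ × ℤ) : Prop := |a.1 - δ * z.1| < δ ∧ |a.2 - δ * z.2| < δ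

theorem near_close {δ x : ℝ} (hδ : 0 < δ) {i i' : ℤ} (h1 : |x - δ * i| < δ) (h2 : |x - δ * i'| < δ) :
    i - i' < 2 ∧ i' - i < 2 := by
  rw [abs_lt] at h1 h2
  constructor
  · have : δ * ((i - i' : ℤ) : ℝ) < δ * 2 := by push_cast; linarith
    exact_mod_cast lt_of_mul_lt_mul_left this hδ.le
  · have : δ * ((i' - i : ℤ) : ℝ) < δ * 2 := by push_cast; linarith
    exact_mod_cast lt_of_mul_lt_mul_left this hδ.le

theorem near_exists {δ : ℝ} (hδ : 0 < δ) (a : ℝ × ℝ) : ∃ z, near δ a z := by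
  have key : ∀ x : ℝ, |x - δ * ⌊x / δ⌋| < δ := by
    intro x
    have h1 := Int.floor_le (x / δ)
    have h2 := Int.lt_floor_add_one (x / δ)
    rw [le_div_iff₀ hδ] at h1
    rw [div_lt_iff₀ hδ] at h2
    rw [abs_lt]
    constructor <;> nlinarith
  exact ⟨(⌊a.1 / δ⌋, ⌊a.2 / δ⌋), key _, key _⟩

theorem near_conn {δ : ℝ} (hδ : 0 < δ) (A : Set (ℝ × ℝ)) (hA : IsPreconnected A) :
    Conn Adj {z | ∃ a ∈ A, near δ a z} := by
  intro P hP hcl z hz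
  by_contra hPz
  have op : ∀ z, IsOpen {a | near δ a z} := by
    intro z
    exact (isOpen_lt (f := fun a : ℝ × ℝ => |a.1 - δ * z.1|) (g := fun _ => δ) (by fun_prop) (by fun_prop)).inter
      (isOpen_lt (f := fun a : ℝ × ℝ => |a.2 - δ * z.2|) (g := fun _ => δ) (by fun_prop) (by fun_prop))
  set U : Set (ℝ × ℝ) := ⋃ z ∈ {z | P z}, {a | near δ a z} with hU
  set V : Set (ℝ × ℝ) := ⋃ z ∈ {z | ¬ P z}, {a | near δ a z} with hV
  obtain ⟨z0, ⟨a0, ha0, hn0⟩, hP0⟩ := hP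
  obtain ⟨a1, ha1, hn1⟩ := hz
  obtain ⟨a, haA, haU, haV⟩ := hA U V (isOpen_biUnion fun z _ => op z) (isOpen_biUnion fun z _ => op z)
    (by
      intro a ha
      obtain ⟨z, hz⟩ := near_exists hδ a
      by_cases h : P z
      · exact Or.inl (Set.mem_biUnion (s := {z | P z}) h hz)
      · exact Or.inr (Set.mem_biUnion (s := {z | ¬ P z}) h hz))
    ⟨a0, ha0, Set.mem_biUnion (s := {z | P z}) hP0 hn0⟩
    ⟨a1, ha1, Set.mem_biUnion (s := {z | ¬ P z}) hPz hn1⟩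
  obtain ⟨⟨i, j⟩, hPi, hni⟩ := Set.mem_iUnion₂.1 haU
  obtain ⟨⟨i', j'⟩, hPi', hni'⟩ := Set.mem_iUnion₂.1 haV
  have c1 := near_close hδ hni.1 hni'.1
  have c2 := near_close hδ hni.2 hni'.2
  have hmid : near δ a (i', j) := ⟨hni'.1, hni.2⟩
  have hPm : P (i', j) := by
    rcases Adj_or (j := j) c1.1 c1.2 with h | h
    · rw [← h]; exact hPi
    · exact hcl _ ⟨a, haA, hni⟩ _ ⟨a, haA, hmid⟩ h hPi
  apply hPi'
  rcases Adj_or' (i := i') c2.1 c2.2 with h | h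
  · rw [← h]; exact hPm
  · exact hcl _ ⟨a, haA, hmid⟩ _ ⟨a, haA, hni'⟩ h hPm

theorem discretize {S : Type*} [Finite S] (A : S → Set (ℝ × ℝ)) (hc : ∀ s, IsCompact (A s))
    (hp : ∀ s, IsPreconnected (A s)) (hne : ∀ s, (A s).Nonempty) :
    ∃ (R : S → Set (ℤ × ℤ)) (c : ℤ) (nn : ℕ),
      (∀ s, ∀ p ∈ R s, c < p.1 ∧ p.1 < c + nn ∧ c < p.2 ∧ p.2 < c + nn) ∧
      (∀ s, (R s).Nonempty) ∧ (∀ s, Conn Adj (R s)) ∧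
      (∀ s t, (A s ∩ A t).Nonempty ↔ (R s ∩ R t).Nonempty) := by
  have hδ : ∀ᶠ δ in nhdsWithin (0:ℝ) (Set.Ioi 0), ∀ s t, ¬ (A s ∩ A t).Nonempty →
      ∀ a ∈ A s, ∀ b ∈ A t, 2 * δ ≤ Dist.dist a b := by
    rw [Filter.eventually_all]
    intro s
    rw [Filter.eventually_all]
    intro t
    by_cases h : (A s ∩ A t).Nonempty
    · exact Filter.Eventually.of_forall (fun δ h' => absurd h h')
    · obtain ⟨⟨a, b⟩, ⟨ha, hb⟩, hmin⟩ := ((hc s).prod (hc t)).exists_isMinOn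
        ((hne s).prod (hne t)) (f := fun x => Dist.dist x.1 x.2) (by fun_prop)
      have hpos : 0 < Dist.dist a b := by
        rw [dist_pos]
        rintro rfl
        exact h ⟨a, ha, hb⟩
      have : Set.Ioo (0:ℝ) (Dist.dist a b / 2) ∈ nhdsWithin (0:ℝ) (Set.Ioi 0) :=
        Ioo_mem_nhdsGT (by linarith)
      filter_upwards [this] with δ hδ _ a' ha' b' hb'
      have := hmin (show (a', b') ∈ A s ×ˢ A t from ⟨ha', hb'⟩)
      simp only [Set.mem_ofPred_eq] at this
      have h2 := hδ.2
      linarith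
  obtain ⟨δ, hδ, hδ0⟩ := (hδ.and self_mem_nhdsWithin).exists
  obtain ⟨B, hB⟩ := (isCompact_iUnion hc).isBounded.exists_norm_le
  obtain ⟨m, hm⟩ := exists_nat_gt (B / δ + 1)
  refine ⟨fun s => {z | ∃ a ∈ A s, near δ a z}, -m, 2 * m, ?_, ?_, fun s => near_conn hδ0 _ (hp s), ?_⟩
  · have key : ∀ (x : ℝ) (i : ℤ), |x| ≤ B → |x - δ * i| < δ → -(m:ℤ) < i ∧ i < m := by
      intro x i hx hi
      rw [abs_le] at hx
      rw [abs_lt] at hi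
      have e : δ * (B / δ + 1) = B + δ := by field_simp
      have hm' : B + δ < δ * m := by rw [← e]; exact mul_lt_mul_of_pos_left hm hδ0
      constructor
      · have : δ * ((-m : ℤ) : ℝ) < δ * i := by push_cast; linarith
        exact_mod_cast lt_of_mul_lt_mul_left this hδ0.le
      · have : δ * (i : ℝ) < δ * ((m : ℤ) : ℝ) := by push_cast; linarith
        exact_mod_cast lt_of_mul_lt_mul_left this hδ0.le
    rintro s z ⟨a, ha, h1, h2⟩
    have hn := hB a (Set.mem_iUnion.2 ⟨s, ha⟩)
    have k1 := key _ _ ((norm_fst_le a).trans hn) h1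
    have k2 := key _ _ ((norm_snd_le a).trans hn) h2
    push_cast
    omega
  · intro s
    obtain ⟨a, ha⟩ := hne s
    obtain ⟨z, hz⟩ := near_exists hδ0 a
    exact ⟨z, a, ha, hz⟩
  · intro s t
    constructor
    · rintro ⟨a, ha, hb⟩
      obtain ⟨z, hz⟩ := near_exists hδ0 a
      exact ⟨z, ⟨a, ha, hz⟩, ⟨a, hb, hz⟩⟩
    · rintro ⟨z, ⟨a, ha, ha1, ha2⟩, ⟨b, hb, hb1, hb2⟩⟩
      by_contra hcon
      have h := hδ s t hcon a ha b hb
      have : Dist.dist a b < 2 * δ := by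
        rw [Prod.dist_eq, max_lt_iff, Real.dist_eq, Real.dist_eq]
        rw [abs_lt] at *
        rw [abs_lt]
        constructor <;> constructor <;> linarith
      linarith

/-- grouping components -/
theorem grouping {n : ℕ} (a : Fin n → Fin n → Prop) (hs : ∀ u v, a u v → a v u)
    (h : ∀ v, 3 * {u | Relation.ReflTransGen a v u}.ncard ≤ 2 * n) :
    ∃ A : Set (Fin n), (∀ u v, a u v → u ∈ A → v ∈ A) ∧ 3 * A.ncard ≤ 2 * n ∧ 3 * Aᶜ.ncard ≤ 2 * n := by
  have compl : ∀ A : Set (Fin n), A.ncard + Aᶜ.ncard = n := by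
    intro A
    rw [Set.ncard_add_ncard_compl]; simp
  obtain ⟨A, ⟨hA1, hA2⟩, hmax⟩ := Set.exists_max_image
    {A : Set (Fin n) | (∀ u v, a u v → u ∈ A → v ∈ A) ∧ 3 * A.ncard ≤ 2 * n} Set.ncard
    (Set.toFinite _) ⟨∅, by simp⟩
  by_cases hAc : 3 * Aᶜ.ncard ≤ 2 * n
  · exact ⟨A, hA1, hA2, hAc⟩
  have hcA := compl A
  have : Aᶜ.Nonempty := by
    rw [Set.nonempty_iff_ne_empty]
    intro h0
    rw [h0] at hAc
    simp at hAc
  obtain ⟨v, hv⟩ := this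
  set C : Set (Fin n) := {u | Relation.ReflTransGen a v u} with hC
  have hCcl : ∀ u v, a u v → u ∈ C → v ∈ C := fun u w huw hu => Relation.ReflTransGen.tail hu huw
  have hdisj : Disjoint A C := by
    rw [Set.disjoint_right]
    intro u hu
    have : Relation.ReflTransGen a v u := hu
    induction this with
    | refl => exact hv
    | @tail b c hb hbc ih => exact fun hc => ih hb (hA1 _ _ (hs _ _ hbc) hc)
  have hun : (A ∪ C).ncard = A.ncard + C.ncard := Set.ncard_union_eq hdisj
  have hCpos : 0 < C.ncard := (Set.ncard_pos).2 ⟨v, Relation.ReflTransGen.refl⟩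
  have hcC := compl C
  by_cases hbig : 3 * (A ∪ C).ncard ≤ 2 * n
  · have := hmax (A ∪ C) ⟨fun u w huw hu => hu.imp (hA1 u w huw) (hCcl u w huw), hbig⟩
    omega
  · refine ⟨C, hCcl, h v, ?_⟩
    omega

end BW
namespace BW

open Classical in
theorem weight_bound {n : ℕ} (G : SimpleGraph (Fin n)) (D : Drawing G) (T : G.edgeSet → G.edgeSet → Prop)
    (hT : ∀ e f, T e f ↔ (D.curve e '' Set.Icc 0 1 ∩ D.curve f '' Set.Icc 0 1).Nonempty) :
    ∑ e, (Finset.univ.filter (fun f => T e f)).card ≤ ssqd G + 2 * D.numCrossingPairs := by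
  let inc : Fin n → Finset G.edgeSet := fun v => Finset.univ.filter (fun e => v ∈ e.1)
  let Z1 : Finset (G.edgeSet × G.edgeSet) := Finset.univ.biUnion (fun v => inc v ×ˢ inc v)
  let Z2 : Finset (G.edgeSet × G.edgeSet) :=
    Finset.univ.filter (fun x => x.1 ≠ x.2 ∧ ∃ p, D.IsCross x.1 x.2 p)
  have hsum : ∑ e, (Finset.univ.filter (fun f => T e f)).card
      = (Finset.univ.filter (fun x : G.edgeSet × G.edgeSet => T x.1 x.2)).card := by
    simp only [Finset.card_filter]
    rw [Fintype.sum_prod_type]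
  have hends : ∀ e, ∀ t ∈ Set.Icc (0:ℝ) 1, t ∈ Set.Ioo (0:ℝ) 1 ∨ ∃ v ∈ e.1, D.curve e t = D.pos v := by
    intro e t ht
    obtain ⟨u, v, he, h0, h1⟩ := D.curve_ends e
    by_cases h : t = 0
    · right; exact ⟨u, by rw [he]; simp, by rw [h, h0]⟩
    by_cases h' : t = 1
    · right; exact ⟨v, by rw [he]; simp, by rw [h', h1]⟩
    left
    exact ⟨lt_of_le_of_ne ht.1 (Ne.symm h), lt_of_le_of_ne ht.2 h'⟩
  have hsub : Finset.univ.filter (fun x : G.edgeSet × G.edgeSet => T x.1 x.2) ⊆ Z1 ∪ Z2 := by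
    rintro ⟨e, f⟩ hx
    simp only [Finset.mem_filter, Finset.mem_univ, true_and] at hx
    rw [hT] at hx
    obtain ⟨p, ⟨t, ht, rfl⟩, ⟨t', ht', heq⟩⟩ := hx
    rw [Finset.mem_union]
    have share : ∀ v, v ∈ e.1 → v ∈ f.1 → (e, f) ∈ Z1 := by
      intro v h1 h2
      simp only [Z1, inc, Finset.mem_biUnion, Finset.mem_univ, true_and, Finset.mem_product, Finset.mem_filter]
      exact ⟨v, h1, h2⟩
    by_cases hef : e = f
    · left
      obtain ⟨u, v, he, -, -⟩ := D.curve_ends e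
      exact share u (by rw [he]; simp) (by rw [← hef, he]; simp)
    rcases hends e t ht with h1 | ⟨v, hv, h1⟩
    · rcases hends f t' ht' with h2 | ⟨v', hv', h2⟩
      · right
        simp only [Z2, Finset.mem_filter, Finset.mem_univ, true_and]
        exact ⟨hef, D.curve e t, ⟨t, h1, rfl⟩, ⟨t', h2, heq⟩⟩
      · exact absurd ⟨v', by rw [← h2, heq]⟩ (D.curve_avoid e t h1)
    · rcases hends f t' ht' with h2 | ⟨v', hv', h2⟩
      · exact absurd ⟨v, by rw [heq, h1]⟩ (D.curve_avoid f t' h2)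
      · left
        have : v = v' := D.pos_inj (by rw [← h1, ← h2, heq])
        exact share v hv (this ▸ hv')
  have hinc : ∀ v, (inc v).card ≤ (G.neighborSet v).ncard := by
    intro v
    rw [Set.ncard_eq_toFinset_card', ← SimpleGraph.neighborFinset_def, SimpleGraph.card_neighborFinset_eq_degree, ← SimpleGraph.card_incidenceFinset_eq_degree]
    apply Finset.card_le_card_of_injOn (fun e => e.1)
    · intro e he
      simp only [inc, Finset.coe_filter, Finset.mem_univ, true_and, Set.mem_ofPred_eq] at he
      simp only [SimpleGraph.coe_incidenceFinset]
      exact ⟨e.2, he⟩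
    · intro a _ b _ h
      exact Subtype.ext h
  have hZ1 : Z1.card ≤ ssqd G := by
    unfold ssqd
    rw [finsum_eq_sum_of_fintype]
    refine Finset.card_biUnion_le.trans (Finset.sum_le_sum ?_)
    intro v _
    rw [Finset.card_product, sq]
    exact Nat.mul_le_mul (hinc v) (hinc v)
  have hZ2 : Z2.card ≤ 2 * D.numCrossingPairs := by
    have h1 := Finset.card_le_mul_card_image (f := fun x : G.edgeSet × G.edgeSet => s(x.1, x.2)) Z2 2 (by
      intro b _
      induction b using Sym2.ind with
      | _ x y =>
        refine (Finset.card_le_card (t := {(x, y), (y, x)}) ?_).trans Finset.card_le_two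
        rintro ⟨e, f⟩ h
        simp only [Finset.mem_filter, Sym2.eq_iff] at h
        simp only [Finset.mem_insert, Finset.mem_singleton, Prod.mk.injEq]
        exact h.2)
    refine h1.trans (Nat.mul_le_mul_left _ ?_)
    unfold Drawing.numCrossingPairs
    rw [← Set.ncard_coe_finset]
    apply Set.ncard_le_ncard _ (Set.toFinite _)
    intro q hq
    simp only [Finset.coe_image, Set.mem_image, Finset.mem_coe] at hq
    obtain ⟨⟨e, f⟩, h, rfl⟩ := hq
    simp only [Z2, Finset.mem_filter, Finset.mem_univ, true_and] at h
    exact ⟨e, f, h.1, rfl, h.2⟩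
  rw [hsum]
  have := Finset.card_le_card hsub
  have := Finset.card_union_le Z1 Z2
  omega

theorem main_bound {n : ℕ} (G : SimpleGraph (Fin n)) (D : Drawing G) (hE : Nonempty G.edgeSet)
    (k : ℕ) (hk : 1 ≤ k) (hW : ssqd G + 2 * D.numCrossingPairs ≤ k * k) :
    bisectionWidth G ≤ 11 * k := by
  classical
  by_contra hbw
  push Not at hbw
  have hn : 2 ≤ n := by
    obtain ⟨e, he⟩ := hE
    induction e using Sym2.ind with
    | _ x y =>
      have := G.ne_of_adj he
      have : (x : ℕ) ≠ y := fun h => this (Fin.ext h)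
      have := x.2
      have := y.2
      omega
  let a : Finset G.edgeSet → Fin n → Fin n → Prop := fun X u v => ∃ e : G.edgeSet, e ∉ X ∧ e.1 = s(u, v)
  have asymm : ∀ X u v, a X u v → a X v u := by
    rintro X u v ⟨e, h1, h2⟩
    exact ⟨e, h1, by rw [h2, Sym2.eq_swap]⟩
  have heavy : ∀ X : Finset G.edgeSet, ∃ v : Fin n, X.card ≤ 11 * k →
      2 * n < 3 * {u | Relation.ReflTransGen (a X) v u}.ncard := by
    intro X
    by_contra hcon
    push Not at hcon
    have hX := (hcon ⟨0, by omega⟩).1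
    obtain ⟨A, hA1, hA2, hA3⟩ := grouping (a X) (asymm X) (fun v => (hcon v).2)
    have h1 : bisectionWidth G ≤ _ := Nat.sInf_le ⟨A, hA2, hA3, rfl⟩
    have h2 : { e ∈ G.edgeSet | ∃ u v : Fin n, e = s(u, v) ∧ u ∈ A ∧ v ∉ A }.ncard ≤ X.card := by
      rw [← Finset.card_image_of_injective X Subtype.val_injective, ← Set.ncard_coe_finset]
      apply Set.ncard_le_ncard _ (Set.toFinite _)
      rintro e ⟨he, u, v, rfl, hu, hv⟩
      simp only [Finset.coe_image, Set.mem_image, Finset.mem_coe]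
      refine ⟨⟨_, he⟩, ?_, rfl⟩
      by_contra hX'
      exact hv (hA1 u v ⟨⟨_, he⟩, hX', rfl⟩ hu)
    omega
  choose r hr using heavy
  let C : Finset G.edgeSet → Set (Fin n) := fun X => {u | Relation.ReflTransGen (a X) (r X) u}
  let β : Finset G.edgeSet → Set G.edgeSet := fun X => {e | e ∉ X ∧ ∃ x ∈ e.1, x ∈ C X}
  have Ccl : ∀ X u v, a X u v → u ∈ C X → v ∈ C X := fun X u w huw hu => Relation.ReflTransGen.tail hu huw
  have rtsymm : ∀ X u v, Relation.ReflTransGen (a X) u v → Relation.ReflTransGen (a X) v u := by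
    intro X u v h
    induction h with
    | refl => exact .refl
    | tail _ h2 ih => exact .head (asymm X _ _ h2) ih
  have Cconn : ∀ X, ∀ u ∈ C X, ∀ v ∈ C X, Relation.ReflTransGen (a X) u v :=
    fun X u hu v hv => (rtsymm X _ _ hu).trans hv
  have Cinc : ∀ X : Finset G.edgeSet, X.card ≤ 11 * k → ∀ u ∈ C X, ∃ e ∈ β X, u ∈ e.1 := by
    intro X hX u hu
    have h1 : 1 < (C X).ncard := by
      have := hr X hX
      show 1 < {u | Relation.ReflTransGen (a X) (r X) u}.ncard
      omega
    obtain ⟨v, hv, hvu⟩ := Set.exists_ne_of_one_lt_ncard h1 u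
    have := Cconn X u hu v hv
    rcases Relation.ReflTransGen.cases_head this with h | ⟨x, ⟨e, he, hex⟩, -⟩
    · exact absurd h.symm hvu
    · exact ⟨e, ⟨he, u, by rw [hex]; simp, hu⟩, by rw [hex]; simp⟩
  have allC : ∀ X, ∀ e ∈ β X, ∀ x ∈ e.1, x ∈ C X := by
    rintro X e ⟨h1, y, hy, hyC⟩ x hx
    by_cases hxy : y = x
    · rwa [← hxy]
    · exact Ccl X y x ⟨e, h1, (Sym2.mem_and_mem_iff hxy).1 ⟨hy, hx⟩⟩ hyC
  obtain ⟨R, c, nn, hbd, hne, hconn, hRT⟩ := discretize (fun e => D.curve e '' Set.Icc 0 1)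
    (fun e => isCompact_Icc.image_of_continuousOn (D.curve_cont e))
    (fun e => isPreconnected_Icc.image _ (D.curve_cont e))
    (fun e => ⟨_, 0, by simp, rfl⟩)
  let T : G.edgeSet → G.edgeSet → Prop :=
    fun e f => (D.curve e '' Set.Icc 0 1 ∩ D.curve f '' Set.Icc 0 1).Nonempty
  have onc : ∀ e : G.edgeSet, ∀ v ∈ e.1, D.pos v ∈ D.curve e '' Set.Icc 0 1 := by
    intro e v hv
    obtain ⟨x, y, he, h0, h1⟩ := D.curve_ends e
    rw [he, Sym2.mem_iff] at hv
    rcases hv with rfl | rfl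
    · exact ⟨0, by simp, h0⟩
    · exact ⟨1, by simp, h1⟩
  have Tshare : ∀ e f : G.edgeSet, ∀ v, v ∈ e.1 → v ∈ f.1 → T e f :=
    fun e f v h1 h2 => ⟨D.pos v, onc e v h1, onc f v h2⟩
  refine no_bramble R c nn hbd hne hconn T hRT (fun e => Finset.univ.filter (fun f => T e f))
    (by intro s t; simp) k hk ((weight_bound G D T (fun _ _ => Iff.rfl)).trans hW) β ?_ ?_
  · intro X hX
    refine ⟨?_, ?_, fun s hs => hs.1⟩
    · obtain ⟨e, he, -⟩ := Cinc X hX (r X) Relation.ReflTransGen.refl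
      exact ⟨e, he⟩
    · rintro P ⟨e0, he0, hP0⟩ hcl e he
      obtain ⟨u, hu0, huC⟩ := he0.2
      have key : ∀ v, Relation.ReflTransGen (a X) u v → ∀ f ∈ β X, v ∈ f.1 → P f := by
        intro v hv
        induction hv with
        | refl =>
          intro f hf huf
          exact hcl e0 he0 f hf (Tshare _ _ u hu0 huf) hP0
        | @tail b c hb hbc ih =>
          intro f hf hcf
          obtain ⟨e1, h1, h2⟩ := hbc
          have hbC : b ∈ C X := Relation.ReflTransGen.trans huC hb
          have he1 : e1 ∈ β X := ⟨h1, b, by rw [h2]; simp, hbC⟩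
          exact hcl e1 he1 f hf (Tshare _ _ c (by rw [h2]; simp) hcf) (ih e1 he1 (by rw [h2]; simp))
      obtain ⟨x, hx, hxC⟩ := he.2
      exact key x (Cconn X u huC x hxC) e he hx
  · intro X Y hX hY
    have : (C X ∩ C Y).Nonempty := by
      by_contra hcon
      rw [Set.not_nonempty_iff_eq_empty, ← Set.disjoint_iff_inter_eq_empty] at hcon
      have h1 := Set.ncard_union_eq hcon
      have h2 : (C X ∪ C Y).ncard ≤ n := by
        have := Set.ncard_le_card (C X ∪ C Y)
        simpa using this
      have h3 : 2 * n < 3 * (C X).ncard := hr X hX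
      have h4 : 2 * n < 3 * (C Y).ncard := hr Y hY
      omega
    obtain ⟨v, hvX, hvY⟩ := this
    obtain ⟨e, he, h1⟩ := Cinc X hX v hvX
    obtain ⟨f, hf, h2⟩ := Cinc Y hY v hvY
    exact ⟨e, he, f, hf, Tshare e f v h1 h2⟩

end BW
namespace BW

/-- parabola -/
noncomputable def qq {E : Type*} (lo hi : E → ℝ) (e : E) (x : ℝ) : ℝ := (x - lo e) * (hi e - x)

theorem qq_finite {E : Type*} (lo hi : E → ℝ) (hlt : ∀ e, lo e < hi e)
    (hinj : ∀ e f, lo e = lo f → hi e = hi f → e = f) (c : E → ℝ) (hc : ∀ e, 0 < c e) (e f : E) (hef : e ≠ f) :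
    {x | c e * qq lo hi e x = c f * qq lo hi f x}.Finite := by
  let p : Polynomial ℝ := Polynomial.C (c e) * ((Polynomial.X - Polynomial.C (lo e)) * (Polynomial.C (hi e) - Polynomial.X))
    - Polynomial.C (c f) * ((Polynomial.X - Polynomial.C (lo f)) * (Polynomial.C (hi f) - Polynomial.X))
  have hev : ∀ x, p.eval x = c e * qq lo hi e x - c f * qq lo hi f x := by
    intro x; simp [p, qq]
  have hp : p ≠ 0 := by
    intro h0
    have h1 := hev (lo e)
    have h2 := hev (hi e)
    rw [h0] at h1 h2
    simp only [Polynomial.eval_zero, qq, sub_self, zero_mul, mul_zero, zero_sub] at h1 h2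
    have hcf := (hc f).ne'
    have h1' : (lo e - lo f) * (hi f - lo e) = 0 := by
      have : c f * ((lo e - lo f) * (hi f - lo e)) = 0 := by linarith
      exact (mul_eq_zero.1 this).resolve_left hcf
    have h2' : (hi e - lo f) * (hi f - hi e) = 0 := by
      have : c f * ((hi e - lo f) * (hi f - hi e)) = 0 := by linarith
      exact (mul_eq_zero.1 this).resolve_left hcf
    have a := hlt e
    have b := hlt f
    rcases mul_eq_zero.1 h1' with h | h <;> rcases mul_eq_zero.1 h2' with h' | h'
    · linarith
    · exact hef (hinj e f (by linarith) (by linarith))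
    · linarith
    · linarith
  refine (Polynomial.finite_setOf_isRoot hp).subset ?_
  intro x hx
  have hx' : c e * qq lo hi e x = c f * qq lo hi f x := hx
  show p.eval x = 0
  rw [hev, hx', sub_self]

theorem generic {E : Type*} [Finite E] (lo hi : E → ℝ) (hlt : ∀ e, lo e < hi e)
    (hinj : ∀ e f, lo e = lo f → hi e = hi f → e = f) :
    ∃ c : E → ℝ, (∀ e, 0 < c e) ∧ ∀ e f g, e ≠ f → f ≠ g → e ≠ g → ∀ x, 0 < qq lo hi e x →
      0 < qq lo hi f x → 0 < qq lo hi g x → c e * qq lo hi e x = c f * qq lo hi f x →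
      c f * qq lo hi f x = c g * qq lo hi g x → False := by
  classical
  have := Fintype.ofFinite E
  suffices H : ∀ s : Finset E, ∃ c : E → ℝ, (∀ e, 0 < c e) ∧ ∀ e ∈ s, ∀ f ∈ s, ∀ g ∈ s, e ≠ f → f ≠ g → e ≠ g →
      ∀ x, 0 < qq lo hi e x →
      0 < qq lo hi f x → 0 < qq lo hi g x → c e * qq lo hi e x = c f * qq lo hi f x →
      c f * qq lo hi f x = c g * qq lo hi g x → False by
    obtain ⟨c, h1, h2⟩ := H Finset.univ
    exact ⟨c, h1, fun e f g => h2 e (Finset.mem_univ _) f (Finset.mem_univ _) g (Finset.mem_univ _)⟩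
  intro s
  induction s using Finset.induction_on with
  | empty => exact ⟨fun _ => 1, fun _ => one_pos, by simp⟩
  | insert a s ha ih =>
    obtain ⟨c, hc, hgen⟩ := ih
    let B : Set ℝ := ⋃ e : E, ⋃ f : E, ⋃ _ : e ≠ f,
      (fun x => c e * qq lo hi e x / qq lo hi a x) '' {x | c e * qq lo hi e x = c f * qq lo hi f x}
    have hB : B.Finite := by
      refine Set.finite_iUnion fun e => Set.finite_iUnion fun f => Set.finite_iUnion fun h => ?_
      exact (qq_finite lo hi hlt hinj c hc e f h).image _
    obtain ⟨γ, hγ0, hγB⟩ := ((Set.Ioi_infinite (0:ℝ)).diff hB).nonempty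
    have hγ : ∀ e f, e ≠ f → ∀ x, 0 < qq lo hi a x → c e * qq lo hi e x = c f * qq lo hi f x →
        c e * qq lo hi e x = γ * qq lo hi a x → False := by
      intro e f hef x hx h1 h2
      apply hγB
      simp only [B, Set.mem_iUnion]
      refine ⟨e, f, hef, x, h1, ?_⟩
      simp only
      rw [h2, mul_div_assoc, div_self hx.ne', mul_one]
    refine ⟨Function.update c a γ, ?_, ?_⟩
    · intro e
      by_cases h : e = a
      · subst h; simpa using hγ0
      · rw [Function.update_of_ne h]; exact hc e
    · intro e he f hf g hg hef hfg heg x xe xf xg h1 h2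
      by_cases e1 : e = a
      · subst e1
        rw [Function.update_self, Function.update_of_ne hef.symm] at h1
        rw [Function.update_of_ne hef.symm, Function.update_of_ne heg.symm] at h2
        exact hγ f g hfg x xe h2 h1.symm
      by_cases f1 : f = a
      · subst f1
        rw [Function.update_self, Function.update_of_ne hef] at h1
        rw [Function.update_self, Function.update_of_ne hfg.symm] at h2
        exact hγ e g heg x xf (h1.trans h2) h1
      by_cases g1 : g = a
      · subst g1
        rw [Function.update_of_ne e1, Function.update_of_ne f1] at h1
        rw [Function.update_self, Function.update_of_ne f1] at h2
        exact hγ e f hef x xg h1 (h1.trans h2)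
      rw [Function.update_of_ne e1, Function.update_of_ne f1] at h1
      rw [Function.update_of_ne f1, Function.update_of_ne g1] at h2
      exact hgen e (Finset.mem_of_mem_insert_of_ne he e1) f (Finset.mem_of_mem_insert_of_ne hf f1)
        g (Finset.mem_of_mem_insert_of_ne hg g1) hef hfg heg x xe xf xg h1 h2

theorem exists_drawing {n : ℕ} (G : SimpleGraph (Fin n)) : Nonempty (Drawing G) := by
  classical
  have hex : ∀ e : G.edgeSet, ∃ u v : Fin n, u < v ∧ e.1 = s(u, v) := by
    rintro ⟨e, he⟩
    induction e using Sym2.ind with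
    | _ x y =>
      rcases lt_or_gt_of_ne (G.ne_of_adj he) with h | h
      · exact ⟨x, y, h, rfl⟩
      · exact ⟨y, x, h, Sym2.eq_swap⟩
  choose U V hUV hE using hex
  let lo : G.edgeSet → ℝ := fun e => ((U e : ℕ) : ℝ)
  let hi : G.edgeSet → ℝ := fun e => ((V e : ℕ) : ℝ)
  have hlt : ∀ e, lo e < hi e := fun e => by
    simp only [lo, hi]; exact_mod_cast hUV e
  have hinj : ∀ e f, lo e = lo f → hi e = hi f → e = f := by
    intro e f h1 h2
    simp only [lo, hi] at h1 h2
    have h1' : U e = U f := Fin.ext (by exact_mod_cast h1)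
    have h2' : V e = V f := Fin.ext (by exact_mod_cast h2)
    apply Subtype.ext
    rw [hE e, hE f, h1', h2']
  obtain ⟨c, hc, hgen⟩ := generic lo hi hlt hinj
  let X : G.edgeSet → ℝ → ℝ := fun e t => lo e + t * (hi e - lo e)
  have qpos : ∀ e, ∀ t ∈ Set.Ioo (0:ℝ) 1, 0 < qq lo hi e (X e t) := by
    intro e t ht
    have := hlt e
    simp only [qq, X]
    apply mul_pos
    · have := mul_pos ht.1 (sub_pos.2 this); linarith
    · have := mul_pos (sub_pos.2 ht.2) (sub_pos.2 this); nlinarith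
  let cu : G.edgeSet → ℝ → ℝ × ℝ := fun e t => (X e t, c e * qq lo hi e (X e t))
  have inX : ∀ e (p : ℝ × ℝ) (S : Set ℝ), p ∈ cu e '' S → p.2 = c e * qq lo hi e p.1 := by
    rintro e p S ⟨t, _, rfl⟩
    rfl
  refine ⟨⟨fun v => (((v : ℕ) : ℝ), 0), ?_, cu, ?_, ?_, ?_, ?_, ?_, ?_⟩⟩
  · intro u v h
    simp only [Prod.mk.injEq, Nat.cast_inj, and_true] at h
    exact Fin.ext h
  · intro e
    apply Continuous.continuousOn
    simp only [cu, qq, X]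
    fun_prop
  · intro e s _ t _ h
    simp only [cu, X, Prod.mk.injEq] at h
    have h1 := h.1
    have := sub_pos.2 (hlt e)
    exact mul_right_cancel₀ this.ne' (by linarith)
  · intro e
    refine ⟨U e, V e, hE e, ?_, ?_⟩
    · simp [cu, X, qq, lo]
    · simp [cu, X, qq, hi]
  · rintro e t ht ⟨v, hv⟩
    have h2 := congrArg Prod.snd hv
    have := mul_pos (hc e) (qpos e t ht)
    simp only [cu] at h2
    linarith
  · intro e f hef
    have hfin := qq_finite lo hi hlt hinj c hc e f hef
    refine (hfin.image (fun x => (x, c e * qq lo hi e x))).subset ?_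
    rintro p ⟨h1, h2⟩
    have e1 := inX e p _ h1
    have e2 := inX f p _ h2
    exact ⟨p.1, e1.symm.trans e2, Prod.ext rfl e1.symm⟩
  · rintro e f g hef hfg heg p ⟨h1, h2, h3⟩
    have e1 := inX e p _ h1
    have e2 := inX f p _ h2
    have e3 := inX g p _ h3
    obtain ⟨t1, ht1, r1⟩ := h1
    obtain ⟨t2, ht2, r2⟩ := h2
    obtain ⟨t3, ht3, r3⟩ := h3
    have p1 := qpos e t1 ht1
    have p2 := qpos f t2 ht2
    have p3 := qpos g t3 ht3
    have r1' : X e t1 = p.1 := congrArg Prod.fst r1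
    have r2' : X f t2 = p.1 := congrArg Prod.fst r2
    have r3' : X g t3 = p.1 := congrArg Prod.fst r3
    rw [r1'] at p1
    rw [r2'] at p2
    rw [r3'] at p3
    exact hgen e f g hef hfg heg p.1 p1 p2 p3 (e1.symm.trans e2) (e2.symm.trans e3)

end BW

/-- There exists an absolute constant `c > 0` such that for every simple graph `G`,
`bw(G) ≤ c · sqrt(pcr(G) + Σ d_k²)`. -/
theorem bisectionWidth_le_sqrt_pcr_ssqd :
    ∃ c : ℝ, 0 < c ∧ ∀ (n : ℕ) (G : SimpleGraph (Fin n)),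
      (bisectionWidth G : ℝ) ≤ c * Real.sqrt (pcrNum G + ssqd G) := by
  refine ⟨33, by norm_num, ?_⟩
  intro n G
  by_cases hE : Nonempty G.edgeSet
  · obtain ⟨D, hD⟩ : ∃ D : Drawing G, D.numCrossingPairs = pcrNum G :=
      Nat.sInf_mem (s := { n | ∃ D : Drawing G, D.numCrossingPairs = n })
        (by obtain ⟨D⟩ := BW.exists_drawing G; exact ⟨_, D, rfl⟩)
    set W := ssqd G + 2 * pcrNum G with hW
    have h1 := BW.main_bound G D hE (Nat.sqrt W + 1) (by omega)
      (by rw [hD]; exact (Nat.lt_succ_sqrt W).le)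
    have hpos : 1 ≤ ssqd G := by
      obtain ⟨e, he⟩ := hE
      induction e using Sym2.ind with
      | _ x y =>
        unfold ssqd
        rw [finsum_eq_sum_of_fintype]
        have h2 : 0 < (G.neighborSet x).ncard := (Set.ncard_pos (Set.toFinite _)).2 ⟨y, he⟩
        have h3 := Finset.single_le_sum (f := fun v => (G.neighborSet v).ncard ^ 2)
          (fun i _ => Nat.zero_le _) (Finset.mem_univ x)
        have h4 : 0 < (G.neighborSet x).ncard ^ 2 := by positivity
        exact le_trans h4 h3
    set Q : ℝ := (pcrNum G : ℝ) + ssqd G with hQ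
    have hQ1 : 1 ≤ Q := by
      have : (1 : ℝ) ≤ ssqd G := by exact_mod_cast hpos
      have : (0 : ℝ) ≤ pcrNum G := Nat.cast_nonneg _
      linarith
    have hs1 : 1 ≤ Real.sqrt Q := Real.one_le_sqrt.2 hQ1
    have hsW : (Nat.sqrt W : ℝ) ≤ 2 * Real.sqrt Q := by
      have h5 : (Nat.sqrt W : ℝ) ≤ Real.sqrt W := Real.nat_sqrt_le_real_sqrt
      have h6 : Real.sqrt W ≤ Real.sqrt (2 ^ 2 * Q) := by
        apply Real.sqrt_le_sqrt
        rw [hW, hQ]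
        push_cast
        have : (0 : ℝ) ≤ pcrNum G := Nat.cast_nonneg _
        have : (0 : ℝ) ≤ ssqd G := Nat.cast_nonneg _
        linarith
      rw [Real.sqrt_mul (by norm_num), Real.sqrt_sq (by norm_num)] at h6
      linarith
    have h7 : (bisectionWidth G : ℝ) ≤ 11 * (Nat.sqrt W + 1) := by exact_mod_cast h1
    linarith
  · have : bisectionWidth G = 0 := by
      unfold bisectionWidth
      rw [Nat.sInf_eq_zero]
      by_cases h : { m : ℕ | ∃ A : Set (Fin n),
        3 * A.ncard ≤ 2 * n ∧ 3 * Aᶜ.ncard ≤ 2 * n ∧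
        { e ∈ G.edgeSet | ∃ u v : Fin n, e = s(u, v) ∧ u ∈ A ∧ v ∉ A }.ncard = m } = ∅
      · exact Or.inr h
      · left
        obtain ⟨m, A, h1, h2, h3⟩ := Set.nonempty_iff_ne_empty.2 h
        refine ⟨A, h1, h2, ?_⟩
        rw [Set.ncard_eq_zero (Set.toFinite _), Set.eq_empty_iff_forall_notMem]
        rintro e ⟨he, -⟩
        exact hE ⟨⟨e, he⟩⟩
    rw [this]
    simp only [Nat.cast_zero]
    positivity
end
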